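/- Let Ω ⊂ ℝ be an open bounded interval, let f satisfy hypothesis (F), and let K > 0, T > 0. Then there exists Γ₃(K,T) > 0 with the property that if (u₀,u_{0t},Θ₀) and (û₀,û_{0t},Θ̂₀) satisfy the data hypothesis (I), and if (u,Θ) and (û,Θ̂) are weak solutions of system (P) on Ω×(0,T) emanating from these respective data, both in the regularity class (R_T), which in addition satisfy ‖û_t(·,t)‖_{L²(Ω)} + ‖Θ(·,t)‖_{L¹(Ω)} ≤ K for all t ∈ (0,T) and ∫₀^T∫_Ω Θ_x² ≤ K, then sup_{t∈(0,T)} {∫_Ω |u_t(·,t)−û_t(·,t)|² + ∫_Ω |u_x(·,t)−û_x(·,t)|² + ∫_Ω |Θ(·,t)−Θ̂(·,t)|²} + ∫₀^T∫_Ω |Θ_x−Θ̂_x|² ≤ Γ₃(K,T)·{∫_Ω |u_{0t}−û_{0t}|² + ∫_Ω |u_{0x}−û_{0x}|² + ∫_Ω |Θ₀−Θ̂₀|²}. -/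

import Mathlib

open MeasureTheory Filter Set Function

noncomputable section

/-- Integral over `Ω = (a,b)`. -/
def intOm (a b : ℝ) (g : ℝ → ℝ) : ℝ := ∫ x in Ioo a b, g x

/-- Double integral over `Ω × (0,T)`. -/
def intOmT (a b T : ℝ) (F : ℝ → ℝ → ℝ) : ℝ :=
  ∫ p in (Ioo a b) ×ˢ (Ioo 0 T), F p.1 p.2

/-- Squared `L²(Ω)` integral of `g`. -/
def sqOm (a b : ℝ) (g : ℝ → ℝ) : ℝ := ∫ x in Ioo a b, (g x) ^ 2

/-- `L²(Ω)` norm. -/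
def nrmL2 (a b : ℝ) (g : ℝ → ℝ) : ℝ := (∫ x in Ioo a b, (g x) ^ 2) ^ (1 / 2 : ℝ)

/-- `L¹(Ω)` norm. -/
def nrmL1 (a b : ℝ) (g : ℝ → ℝ) : ℝ := ∫ x in Ioo a b, |g x|

/-- Membership in `L²(Ω)`. -/
def MemL2 (a b : ℝ) (g : ℝ → ℝ) : Prop :=
  AEStronglyMeasurable g (volume.restrict (Ioo a b)) ∧
    IntegrableOn (fun x => (g x) ^ 2) (Ioo a b)

/-- Zero-trace weak derivative on `(a,b)`: `g ∈ W₀^{1,1}(a,b)` with weak derivative `g'`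
(integration by parts against all smooth test functions, with no boundary terms). -/
def WeakDerivZ (a b : ℝ) (g g' : ℝ → ℝ) : Prop :=
  ∀ ψ : ℝ → ℝ, ContDiff ℝ (⊤ : ℕ∞) ψ →
    ∫ x in Ioo a b, g x * deriv ψ x = - ∫ x in Ioo a b, g' x * ψ x

/-- Interior weak derivative on `(a,b)`: `g ∈ W^{1,1}(a,b)` with weak derivative `g'`. -/
def WeakDerivI (a b : ℝ) (g g' : ℝ → ℝ) : Prop :=
  ∀ ψ : ℝ → ℝ, ContDiff ℝ (⊤ : ℕ∞) ψ → tsupport ψ ⊆ Ioo a b →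
    ∫ x in Ioo a b, g x * deriv ψ x = - ∫ x in Ioo a b, g' x * ψ x

/-- Hypothesis (F) on the nonlinearity `f`, where `f'`, `f''` denote its first and second
derivatives on `[0,∞)`: `f ∈ C²([0,∞))`, `f(0)=0`, `f' > 0` on `[0,∞)`,
and `f' ∈ W^{1,∞}((0,∞))` (i.e. `f'` and `f''` are bounded). -/
structure HypF (f f' f'' : ℝ → ℝ) : Prop where
  hasDeriv₁ : ∀ x ∈ Ici (0 : ℝ), HasDerivWithinAt f (f' x) (Ici 0) x
  hasDeriv₂ : ∀ x ∈ Ici (0 : ℝ), HasDerivWithinAt f' (f'' x) (Ici 0) x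
  cont₂ : ContinuousOn f'' (Ici 0)
  zero : f 0 = 0
  pos : ∀ x ∈ Ici (0 : ℝ), 0 < f' x
  bdd : ∃ M : ℝ, ∀ x ∈ Ici (0 : ℝ), |f' x| ≤ M ∧ |f'' x| ≤ M

/-- Partial derivative in the first (spatial) variable. -/
def pdx (w : ℝ → ℝ → ℝ) : ℝ → ℝ → ℝ := fun x t => deriv (fun y => w y t) x

/-- Partial derivative in the second (time) variable. -/
def pdt (w : ℝ → ℝ → ℝ) : ℝ → ℝ → ℝ := fun x t => deriv (fun s => w x s) t

/-- Test functions in `C₀^∞(Ω × [0,T))`. -/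
structure TestU (a b T : ℝ) (φ : ℝ → ℝ → ℝ) : Prop where
  smooth : ContDiff ℝ (⊤ : ℕ∞) (uncurry φ)
  suppx : ∃ K : Set ℝ, IsCompact K ∧ K ⊆ Ioo a b ∧ ∀ x t, x ∉ K → φ x t = 0
  suppt : ∃ T' : ℝ, T' < T ∧ ∀ x t, T' ≤ t → φ x t = 0

/-- Test functions in `C^∞(Ω̄ × [0,T))`, compactly supported in time. -/
structure TestT (T : ℝ) (φ : ℝ → ℝ → ℝ) : Prop where
  smooth : ContDiff ℝ (⊤ : ℕ∞) (uncurry φ)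
  suppt : ∃ T' : ℝ, T' < T ∧ ∀ x t, T' ≤ t → φ x t = 0

/-- Test functions in `C₀^∞(Ω × (0,T))`. -/
structure TestInt (a b T : ℝ) (φ : ℝ → ℝ → ℝ) : Prop where
  smooth : ContDiff ℝ (⊤ : ℕ∞) (uncurry φ)
  suppx : ∃ K : Set ℝ, IsCompact K ∧ K ⊆ Ioo a b ∧ ∀ x t, x ∉ K → φ x t = 0
  supptime : ∃ K : Set ℝ, IsCompact K ∧ K ⊆ Ioo 0 T ∧ ∀ x t, t ∉ K → φ x t = 0

/-- Definition (W): weak solution of (P) on `Ω × (0,T)`.  Here `ut`, `ux`, `Θx` denote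
the weak derivatives of `u` (in time and space) and of `Θ` (in space). -/
structure IsWeakSol (a b T : ℝ) (f f' : ℝ → ℝ) (u0 u0t Θ0 : ℝ → ℝ)
    (u ut ux Θ Θx : ℝ → ℝ → ℝ) : Prop where
  u_sliceL1 : ∀ t ∈ Icc 0 T, IntegrableOn (fun x => u x t) (Ioo a b)
  u_contL1 : ∀ t₀ ∈ Icc 0 T,
    Tendsto (fun t => ∫ x in Ioo a b, |u x t - u x t₀|) (nhdsWithin t₀ (Icc 0 T)) (nhds 0)
  u_int : IntegrableOn (fun p : ℝ × ℝ => u p.1 p.2) ((Ioo a b) ×ˢ (Ioo 0 T))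
  ux_int : IntegrableOn (fun p : ℝ × ℝ => ux p.1 p.2) ((Ioo a b) ×ˢ (Ioo 0 T))
  u_W0 : ∀ᵐ t ∂volume.restrict (Ioo 0 T), WeakDerivZ a b (fun x => u x t) (fun x => ux x t)
  Θ_int : IntegrableOn (fun p : ℝ × ℝ => Θ p.1 p.2) ((Ioo a b) ×ˢ (Ioo 0 T))
  Θx_int : IntegrableOn (fun p : ℝ × ℝ => Θx p.1 p.2) ((Ioo a b) ×ˢ (Ioo 0 T))
  Θ_W : ∀ᵐ t ∂volume.restrict (Ioo 0 T), WeakDerivI a b (fun x => Θ x t) (fun x => Θx x t)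
  Θ_nonneg : ∀ᵐ p ∂volume.restrict ((Ioo a b) ×ˢ (Ioo 0 T)), 0 ≤ Θ p.1 p.2
  ut_weak : ∀ φ : ℝ → ℝ → ℝ, TestInt a b T φ →
    intOmT a b T (fun x t => u x t * pdt φ x t) = - intOmT a b T (fun x t => ut x t * φ x t)
  ut_int : IntegrableOn (fun p : ℝ × ℝ => ut p.1 p.2) ((Ioo a b) ×ˢ (Ioo 0 T))
  g1_int : IntegrableOn (fun p : ℝ × ℝ => f' (Θ p.1 p.2) * Θx p.1 p.2)
    ((Ioo a b) ×ˢ (Ioo 0 T))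
  g2_int : IntegrableOn (fun p : ℝ × ℝ => f' (Θ p.1 p.2) * Θx p.1 p.2 * ut p.1 p.2)
    ((Ioo a b) ×ˢ (Ioo 0 T))
  g3_int : IntegrableOn (fun p : ℝ × ℝ => f (Θ p.1 p.2) * ut p.1 p.2)
    ((Ioo a b) ×ˢ (Ioo 0 T))
  weak_u : ∀ φ : ℝ → ℝ → ℝ, TestU a b T φ →
    intOmT a b T (fun x t => u x t * pdt (pdt φ) x t)
        - intOm a b (fun x => u0t x * φ x 0) + intOm a b (fun x => u0 x * pdt φ x 0)
      = - intOmT a b T (fun x t => ux x t * pdx φ x t)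
        - intOmT a b T (fun x t => f' (Θ x t) * Θx x t * φ x t)
  weak_Θ : ∀ φ : ℝ → ℝ → ℝ, TestT T φ →
    - intOmT a b T (fun x t => Θ x t * pdt φ x t) - intOm a b (fun x => Θ0 x * φ x 0)
      = - intOmT a b T (fun x t => Θx x t * pdx φ x t)
        + intOmT a b T (fun x t => f' (Θ x t) * Θx x t * ut x t * φ x t)
        + intOmT a b T (fun x t => f (Θ x t) * ut x t * pdx φ x t)

/-- Continuity of `t ↦ w(·,t)` as a map `J → L²(Ω)` (with slices in `L²(Ω)`). -/
def ContL2 (a b : ℝ) (J : Set ℝ) (w : ℝ → ℝ → ℝ) : Prop :=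
  (∀ t ∈ J, MemL2 a b (fun x => w x t)) ∧
    ∀ t₀ ∈ J, Tendsto (fun t => ∫ x in Ioo a b, (w x t - w x t₀) ^ 2)
      (nhdsWithin t₀ J) (nhds 0)

/-- The regularity class (R_T):  `u ∈ C⁰([0,T];W₀^{1,2})`, `u_t ∈ C⁰([0,T];L²)`,
`Θ ∈ C⁰([0,T];L²) ∩ L²((0,T);W^{1,2})`. -/
structure RegT (a b T : ℝ) (u ut ux Θ Θx : ℝ → ℝ → ℝ) : Prop where
  u_cont : ContL2 a b (Icc 0 T) u
  ux_cont : ContL2 a b (Icc 0 T) ux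
  u_W0 : ∀ t ∈ Icc (0 : ℝ) T, WeakDerivZ a b (fun x => u x t) (fun x => ux x t)
  ut_cont : ContL2 a b (Icc 0 T) ut
  Θ_cont : ContL2 a b (Icc 0 T) Θ
  Θ_sq_int : IntegrableOn (fun p : ℝ × ℝ => (Θ p.1 p.2) ^ 2) ((Ioo a b) ×ˢ (Ioo 0 T))
  Θx_sq_int : IntegrableOn (fun p : ℝ × ℝ => (Θx p.1 p.2) ^ 2) ((Ioo a b) ×ˢ (Ioo 0 T))

/-- Data hypothesis (I), with `u0x` the weak derivative of `u0 ∈ W₀^{1,2}(Ω)`. -/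
structure DataI (a b : ℝ) (u0 u0x u0t Θ0 : ℝ → ℝ) : Prop where
  u0_L2 : MemL2 a b u0
  u0x_L2 : MemL2 a b u0x
  u0_W0 : WeakDerivZ a b u0 u0x
  u0t_L2 : MemL2 a b u0t
  Θ0_L2 : MemL2 a b Θ0
  Θ0_nonneg : ∀ᵐ x ∂volume.restrict (Ioo a b), 0 ≤ Θ0 x

/-- Smooth-data hypothesis (I∞). -/
structure SmoothData (a b : ℝ) (v0 u0 Θ0 : ℝ → ℝ) : Prop where
  v0_smooth : ContDiff ℝ (⊤ : ℕ∞) v0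
  v0_supp : ∃ K : Set ℝ, IsCompact K ∧ K ⊆ Ioo a b ∧ ∀ x, x ∉ K → v0 x = 0
  u0_smooth : ContDiff ℝ (⊤ : ℕ∞) u0
  u0_supp : ∃ K : Set ℝ, IsCompact K ∧ K ⊆ Ioo a b ∧ ∀ x, x ∉ K → u0 x = 0
  Θ0_smooth : ContDiff ℝ (⊤ : ℕ∞) Θ0
  Θ0_pos : ∀ x ∈ Icc a b, 0 < Θ0 x
  Θ0x_supp : ∃ K : Set ℝ, IsCompact K ∧ K ⊆ Ioo a b ∧ ∀ x, x ∉ K → deriv Θ0 x = 0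

/-- Classical solution of the regularized problem (P_ε), of class
`C^{4,1} × C^{2,1} × C^{2,1}(Ω̄ × [0,∞))`, with positive temperature. -/
structure IsClassicalSolEps (a b : ℝ) (f : ℝ → ℝ) (ε : ℝ) (v0 u0 Θ0 : ℝ → ℝ)
    (v u Θ : ℝ → ℝ → ℝ) : Prop where
  diffx_v : ∀ k < 4, ∀ x ∈ Icc a b, ∀ t ∈ Ici (0 : ℝ),
    DifferentiableAt ℝ (fun y => pdx^[k] v y t) x
  difft_v : ∀ x ∈ Icc a b, ∀ t ∈ Ici (0 : ℝ), DifferentiableAt ℝ (fun s => v x s) t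
  cont_v : ∀ k ≤ 4, ContinuousOn (uncurry (pdx^[k] v)) ((Icc a b) ×ˢ (Ici 0))
  contt_v : ContinuousOn (uncurry (pdt v)) ((Icc a b) ×ˢ (Ici 0))
  diffx_u : ∀ k < 2, ∀ x ∈ Icc a b, ∀ t ∈ Ici (0 : ℝ),
    DifferentiableAt ℝ (fun y => pdx^[k] u y t) x
  difft_u : ∀ x ∈ Icc a b, ∀ t ∈ Ici (0 : ℝ), DifferentiableAt ℝ (fun s => u x s) t
  cont_u : ∀ k ≤ 2, ContinuousOn (uncurry (pdx^[k] u)) ((Icc a b) ×ˢ (Ici 0))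
  contt_u : ContinuousOn (uncurry (pdt u)) ((Icc a b) ×ˢ (Ici 0))
  diffx_Θ : ∀ k < 2, ∀ x ∈ Icc a b, ∀ t ∈ Ici (0 : ℝ),
    DifferentiableAt ℝ (fun y => pdx^[k] Θ y t) x
  difft_Θ : ∀ x ∈ Icc a b, ∀ t ∈ Ici (0 : ℝ), DifferentiableAt ℝ (fun s => Θ x s) t
  cont_Θ : ∀ k ≤ 2, ContinuousOn (uncurry (pdx^[k] Θ)) ((Icc a b) ×ˢ (Ici 0))
  contt_Θ : ContinuousOn (uncurry (pdt Θ)) ((Icc a b) ×ˢ (Ici 0))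
  Θ_pos : ∀ x ∈ Icc a b, ∀ t ∈ Ici (0 : ℝ), 0 < Θ x t
  eq_v : ∀ x ∈ Ioo a b, ∀ t ∈ Ioi (0 : ℝ),
    pdt v x t = -ε * pdx^[4] v x t + pdx^[2] u x t - pdx (fun y s => f (Θ y s)) x t
  eq_u : ∀ x ∈ Ioo a b, ∀ t ∈ Ioi (0 : ℝ), pdt u x t = ε * pdx^[2] u x t + v x t
  eq_Θ : ∀ x ∈ Ioo a b, ∀ t ∈ Ioi (0 : ℝ),
    pdt Θ x t = pdx^[2] Θ x t - f (Θ x t) * pdx v x t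
  bc_v : ∀ t ∈ Ioi (0 : ℝ),
    v a t = 0 ∧ v b t = 0 ∧ pdx^[2] v a t = 0 ∧ pdx^[2] v b t = 0
  bc_u : ∀ t ∈ Ioi (0 : ℝ), u a t = 0 ∧ u b t = 0
  bc_Θ : ∀ t ∈ Ioi (0 : ℝ), pdx Θ a t = 0 ∧ pdx Θ b t = 0
  init : ∀ x ∈ Icc a b, v x 0 = v0 x ∧ u x 0 = u0 x ∧ Θ x 0 = Θ0 x

/-- Weak convergence in `L²_loc(Ω̄ × [0,∞))`. -/
def WkL2loc (a b : ℝ) (wj : ℕ → ℝ → ℝ → ℝ) (w : ℝ → ℝ → ℝ) : Prop :=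
  ∀ T > (0 : ℝ), ∀ ψ : ℝ → ℝ → ℝ,
    AEStronglyMeasurable (fun p : ℝ × ℝ => ψ p.1 p.2)
      (volume.restrict ((Icc a b) ×ˢ (Icc 0 T))) →
    IntegrableOn (fun p : ℝ × ℝ => (ψ p.1 p.2) ^ 2) ((Icc a b) ×ˢ (Icc 0 T)) →
    Tendsto (fun j => ∫ p in (Icc a b) ×ˢ (Icc 0 T), wj j p.1 p.2 * ψ p.1 p.2) atTop
      (nhds (∫ p in (Icc a b) ×ˢ (Icc 0 T), w p.1 p.2 * ψ p.1 p.2))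

theorem ac_primitive {p : ℝ → ℝ} {a b : ℝ} (hp : IntervalIntegrable p volume a b) (A : ℝ) :
    AbsolutelyContinuousOnInterval (fun x => A + ∫ s in a..x, p s) a b := by
  have h1 := hp.absolutelyContinuousOnInterval_intervalIntegral (c := a) (by simp)
  have h2 : AbsolutelyContinuousOnInterval (fun _ : ℝ => A) a b :=
    (LipschitzOnWith.of_dist_le_mul (K := 0) (by simp)).absolutelyContinuousOnInterval
  exact h2.add h1

theorem ae_deriv_primitive {p : ℝ → ℝ} {a b : ℝ} (hp : IntervalIntegrable p volume a b) (A : ℝ) :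
    ∀ᵐ x, x ∈ uIcc a b → HasDerivAt (fun x => A + ∫ s in a..x, p s) (p x) x := by
  filter_upwards [hp.ae_hasDerivAt_integral] with x hx hx'
  exact (hx hx' a (by simp)).const_add A

/-- Product rule for two primitives of integrable functions. -/
theorem primitive_mul {p q : ℝ → ℝ} {a b : ℝ} (hp : IntervalIntegrable p volume a b)
    (hq : IntervalIntegrable q volume a b) (A B : ℝ) :
    (A + ∫ s in a..b, p s) * (B + ∫ s in a..b, q s)
      = A * B + ∫ x in a..b, (p x * (B + ∫ s in a..x, q s) + (A + ∫ s in a..x, p s) * q x) := by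
  have h := (ac_primitive hp A).integral_deriv_mul_eq_sub (ac_primitive hq B)
  have h2 : ∫ x in a..b, (p x * (B + ∫ s in a..x, q s) + (A + ∫ s in a..x, p s) * q x)
      = ∫ x in a..b, deriv (fun x => A + ∫ s in a..x, p s) x * (B + ∫ s in a..x, q s)
        + (A + ∫ s in a..x, p s) * deriv (fun x => B + ∫ s in a..x, q s) x := by
    apply intervalIntegral.integral_congr_ae
    filter_upwards [ae_deriv_primitive hp A, ae_deriv_primitive hq B] with x h1 h2 hx
    have hx' : x ∈ uIcc a b := uIoc_subset_uIcc hx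
    rw [(h1 hx').deriv, (h2 hx').deriv]
  rw [h2, h]
  simp

theorem ac_exp_neg {h : ℝ → ℝ} {a b : ℝ} (hh : AbsolutelyContinuousOnInterval h a b)
    (h0 : ∀ x ∈ uIcc a b, 0 ≤ h x) :
    AbsolutelyContinuousOnInterval (fun x => Real.exp (-h x)) a b := by
  rw [absolutelyContinuousOnInterval_iff] at hh ⊢
  intro ε hε
  obtain ⟨δ, hδ, H⟩ := hh ε hε
  refine ⟨δ, hδ, fun E hE hE' => lt_of_le_of_lt (Finset.sum_le_sum fun i hi => ?_) (H E hE hE')⟩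
  have hE1 := hE.1 i hi
  have key : ∀ u v : ℝ, 0 ≤ u → u ≤ v → |Real.exp (-u) - Real.exp (-v)| ≤ |u - v| := by
    intro u v hu huv
    have h1 : Real.exp (-v) ≤ Real.exp (-u) := Real.exp_le_exp.2 (by linarith)
    rw [abs_of_nonneg (by linarith), abs_of_nonpos (by linarith)]
    have h2 : Real.exp (-v) = Real.exp (-u) * Real.exp (u - v) := by
      rw [← Real.exp_add]; ring_nf
    have h3 := Real.add_one_le_exp (u - v)
    have h4 : Real.exp (-u) ≤ 1 := Real.exp_le_one_iff.2 (by linarith)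
    have h5 := Real.exp_pos (-u)
    rw [h2]; nlinarith
  rw [Real.dist_eq, Real.dist_eq]
  rcases le_total (h (E.2 i).1) (h (E.2 i).2) with hle | hle
  · exact key _ _ (h0 _ hE1.1) hle
  · rw [abs_sub_comm, abs_sub_comm (h _)]
    exact key _ _ (h0 _ hE1.2) hle

/-- Integral Gronwall inequality with an integrable weight. -/
theorem gronwall_integral {E h : ℝ → ℝ} {A T : ℝ} (hT : 0 ≤ T)
    (hh : IntervalIntegrable h volume 0 T) (h0 : ∀ᵐ s, s ∈ Icc 0 T → 0 ≤ h s)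
    (hE : IntervalIntegrable (fun s => h s * E s) volume 0 T)
    (hle : ∀ t ∈ Icc 0 T, E t ≤ A + ∫ s in (0:ℝ)..t, h s * E s) :
    ∀ t ∈ Icc 0 T, E t ≤ A * Real.exp (∫ s in (0:ℝ)..t, h s) := by
  intro t ht
  have hsub : uIcc 0 t ⊆ uIcc 0 T := by
    rw [uIcc_of_le ht.1, uIcc_of_le hT]; exact Icc_subset_Icc_right ht.2
  have hEt := hE.mono_set hsub
  have hht := hh.mono_set hsub
  have acF := ac_primitive hEt A
  have acH := ac_primitive hht 0
  simp only [zero_add] at acH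
  have hH0 : ∀ x ∈ uIcc 0 t, 0 ≤ ∫ s in (0:ℝ)..x, h s := by
    intro x hx
    rw [uIcc_of_le ht.1] at hx
    apply intervalIntegral.integral_nonneg_of_ae_restrict hx.1
    rw [EventuallyLE, ae_restrict_iff' measurableSet_Icc]
    filter_upwards [h0] with s hs hs'
    exact hs ⟨hs'.1, hs'.2.trans (hx.2.trans ht.2)⟩
  have acX := ac_exp_neg acH hH0
  have acP := acF.mul acX
  have h1 := acP.integral_deriv_eq_sub
  have h2 : ∫ x in (0:ℝ)..t, deriv ((fun x => A + ∫ s in (0:ℝ)..x, h s * E s) *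
      fun x => Real.exp (-∫ s in (0:ℝ)..x, h s)) x ≤ ∫ x in (0:ℝ)..t, (0:ℝ) := by
    apply intervalIntegral.integral_mono_ae_restrict ht.1 acP.intervalIntegrable_deriv (by simp)
    rw [EventuallyLE, ae_restrict_iff' measurableSet_Icc]
    filter_upwards [h0, ae_deriv_primitive hEt A, ae_deriv_primitive hht 0] with x hx0 hF hH hx
    have hx' : x ∈ uIcc 0 t := by rwa [uIcc_of_le ht.1]
    have hH' := hH hx'
    simp only [zero_add] at hH'
    have hd := (hF hx').mul hH'.neg.exp
    have hxT : x ∈ Icc 0 T := ⟨hx.1, hx.2.trans ht.2⟩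
    have e1 := hle x hxT
    have e2 := hx0 hxT
    have e3 := Real.exp_pos (-∫ s in (0:ℝ)..x, h s)
    refine (le_of_eq hd.deriv).trans ?_
    simp only [Pi.neg_apply]
    have := mul_le_mul_of_nonneg_right (mul_le_mul_of_nonneg_left e1 e2) e3.le
    linarith
  simp only [intervalIntegral.integral_zero, h1, Pi.mul_apply, intervalIntegral.integral_same,
    neg_zero, Real.exp_zero, mul_one, add_zero] at h2
  have h3 := hle t ht
  rw [Real.exp_neg] at h2
  have h4 := Real.exp_pos (∫ s in (0:ℝ)..t, h s)
  have h5 : (A + ∫ s in (0:ℝ)..t, h s * E s) ≤ A * Real.exp (∫ s in (0:ℝ)..t, h s) := by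
    rw [← div_le_iff₀ h4, div_eq_mul_inv]; linarith
  linarith

/-- A complete orthonormal system of real functions in `L²(μ)`. -/
structure IsONB (μ : Measure ℝ) (e : ℕ → ℝ → ℝ) : Prop where
  memLp : ∀ k, MemLp (e k) 2 μ
  orth : ∀ j k, ∫ x, e j x * e k x ∂μ = if j = k then 1 else 0
  complete : ∀ g : ℝ → ℝ, MemLp g 2 μ → (∀ k, ∫ x, g x * e k x ∂μ = 0) → g =ᵐ[μ] 0

theorem inner_toLp {μ : Measure ℝ} {g h : ℝ → ℝ} (hg : MemLp g 2 μ) (hh : MemLp h 2 μ) :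
    inner ℝ (hg.toLp g) (hh.toLp h) = ∫ x, g x * h x ∂μ := by
  rw [L2.inner_def]
  apply integral_congr_ae
  filter_upwards [hg.coeFn_toLp, hh.coeFn_toLp] with x h1 h2
  rw [h1, h2]
  simp [mul_comm]

theorem norm_toLp_sq {μ : Measure ℝ} {g : ℝ → ℝ} (hg : MemLp g 2 μ) :
    ‖hg.toLp g‖ ^ 2 = ∫ x, g x ^ 2 ∂μ := by
  rw [← real_inner_self_eq_norm_sq, inner_toLp]
  simp [pow_two]

/-- Cauchy-Schwarz for integrals. -/
theorem abs_integral_mul_le {μ : Measure ℝ} {g h : ℝ → ℝ} (hg : MemLp g 2 μ) (hh : MemLp h 2 μ) :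
    |∫ x, g x * h x ∂μ| ≤ √(∫ x, g x ^ 2 ∂μ) * √(∫ x, h x ^ 2 ∂μ) := by
  rw [← inner_toLp hg hh, ← norm_toLp_sq hg, ← norm_toLp_sq hh, Real.sqrt_sq (norm_nonneg _),
    Real.sqrt_sq (norm_nonneg _)]
  exact abs_real_inner_le_norm _ _

theorem IsONB.hasSum_parseval {μ : Measure ℝ} {e : ℕ → ℝ → ℝ} (he : IsONB μ e) {g h : ℝ → ℝ}
    (hg : MemLp g 2 μ) (hh : MemLp h 2 μ) :
    HasSum (fun k => (∫ x, g x * e k x ∂μ) * ∫ x, h x * e k x ∂μ) (∫ x, g x * h x ∂μ) := by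
  have hon : Orthonormal ℝ (fun k => (he.memLp k).toLp (e k)) := by
    rw [orthonormal_iff_ite]
    intro i j
    rw [inner_toLp, he.orth]
  have hbot : (Submodule.span ℝ (Set.range fun k => (he.memLp k).toLp (e k)))ᗮ = ⊥ := by
    rw [Submodule.eq_bot_iff]
    intro v hv
    have hv' : ∀ k, ∫ x, v x * e k x ∂μ = 0 := by
      intro k
      have := (Submodule.mem_orthogonal _ _).1 hv _ (Submodule.subset_span ⟨k, rfl⟩)
      rw [← Lp.toLp_coeFn v (Lp.memLp v), inner_toLp] at this
      simpa [mul_comm] using this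
    have := he.complete v (Lp.memLp v) hv'
    exact (Lp.eq_zero_iff_ae_eq_zero).2 this
  have H := (HilbertBasis.mkOfOrthogonalEqBot hon hbot).hasSum_inner_mul_inner
    (hg.toLp g) (hh.toLp h)
  simp only [HilbertBasis.coe_mkOfOrthogonalEqBot, inner_toLp] at H
  have hc : ∀ k, ∫ x, h x * e k x ∂μ = ∫ x, e k x * h x ∂μ := fun k => by
    congr 1; ext x; exact mul_comm _ _
  simp_rw [hc]
  exact H

/-- Partial sums of the expansion of `g`. -/
def onbProj (μ : Measure ℝ) (e : ℕ → ℝ → ℝ) (n : ℕ) (g : ℝ → ℝ) : ℝ → ℝ :=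
  fun x => ∑ k ∈ Finset.range n, (∫ y, g y * e k y ∂μ) * e k x

theorem IsONB.memLp_proj {μ : Measure ℝ} {e : ℕ → ℝ → ℝ} (he : IsONB μ e) (n : ℕ) (g : ℝ → ℝ) :
    MemLp (onbProj μ e n g) 2 μ :=
  memLp_finsetSum _ fun k _ => (he.memLp k).const_mul _

theorem IsONB.integral_mul_proj {μ : Measure ℝ} {e : ℕ → ℝ → ℝ} {n : ℕ} {g h : ℝ → ℝ}
    (hi : ∀ k, Integrable (fun x => h x * e k x) μ) :
    ∫ x, h x * onbProj μ e n g x ∂μ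
      = ∑ k ∈ Finset.range n, (∫ x, g x * e k x ∂μ) * ∫ x, h x * e k x ∂μ := by
  unfold onbProj
  simp_rw [Finset.mul_sum]
  rw [integral_finsetSum]
  · refine Finset.sum_congr rfl fun k _ => ?_
    rw [← integral_const_mul]
    congr 1; ext x; ring
  · intro k _
    refine ((hi k).const_mul (∫ x, g x * e k x ∂μ)).congr (ae_of_all _ fun x => ?_)
    simp only; ring

theorem IsONB.integral_proj_sq {μ : Measure ℝ} {e : ℕ → ℝ → ℝ} (he : IsONB μ e) (n : ℕ)
    (g : ℝ → ℝ) : ∫ x, onbProj μ e n g x ^ 2 ∂μ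
      = ∑ k ∈ Finset.range n, (∫ x, g x * e k x ∂μ) ^ 2 := by
  simp_rw [pow_two]
  rw [IsONB.integral_mul_proj fun k => (he.memLp_proj n g).integrable_mul (he.memLp k)]
  refine Finset.sum_congr rfl fun k hk => ?_
  congr 1
  have : ∀ x, onbProj μ e n g x * e k x = e k x * onbProj μ e n g x := fun x => mul_comm _ _
  simp_rw [this]
  rw [IsONB.integral_mul_proj fun j => (he.memLp k).integrable_mul (he.memLp j)]
  simp_rw [he.orth]
  simp at hk
  simp [hk]

theorem IsONB.proj_sq_le {μ : Measure ℝ} {e : ℕ → ℝ → ℝ} (he : IsONB μ e) (n : ℕ)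
    {g : ℝ → ℝ} (hg : MemLp g 2 μ) :
    ∫ x, onbProj μ e n g x ^ 2 ∂μ ≤ ∫ x, g x ^ 2 ∂μ := by
  rw [he.integral_proj_sq]
  have := he.hasSum_parseval hg hg
  simp_rw [← pow_two] at this
  exact sum_le_hasSum _ (fun k _ => sq_nonneg _) this

theorem IsONB.tendsto_proj {μ : Measure ℝ} {e : ℕ → ℝ → ℝ} (he : IsONB μ e)
    {g : ℝ → ℝ} (hg : MemLp g 2 μ) :
    Tendsto (fun n => ∫ x, (g x - onbProj μ e n g x) ^ 2 ∂μ) atTop (nhds 0) := by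
  have h1 : ∀ n, ∫ x, (g x - onbProj μ e n g x) ^ 2 ∂μ
      = (∫ x, g x ^ 2 ∂μ) - ∑ k ∈ Finset.range n, (∫ x, g x * e k x ∂μ) ^ 2 := by
    intro n
    have hP := he.memLp_proj n g
    have e1 : ∀ x, (g x - onbProj μ e n g x) ^ 2
        = g x ^ 2 - 2 * (g x * onbProj μ e n g x) + onbProj μ e n g x ^ 2 := fun x => by ring
    simp_rw [e1]
    have i1 := hg.integrable_sq
    have i2 := hP.integrable_sq
    have i3 : Integrable (fun x => g x * onbProj μ e n g x) μ := hg.integrable_mul hP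
    have i4 : Integrable (fun x => g x ^ 2 - 2 * (g x * onbProj μ e n g x)) μ :=
      i1.sub (i3.const_mul 2)
    rw [integral_add i4 i2, integral_sub i1 (i3.const_mul 2),
      integral_const_mul, he.integral_proj_sq,
      IsONB.integral_mul_proj fun j => hg.integrable_mul (he.memLp j)]
    simp_rw [← pow_two]; ring
  simp_rw [h1]
  have := (he.hasSum_parseval hg hg).tendsto_sum_nat
  simp_rw [← pow_two] at this
  have h2 := this.const_sub (∫ x, g x ^ 2 ∂μ)
  rwa [sub_self] at h2

theorem IsONB.abs_sum_le {μ : Measure ℝ} {e : ℕ → ℝ → ℝ} (he : IsONB μ e) (n : ℕ)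
    {g h : ℝ → ℝ} (hg : MemLp g 2 μ) (hh : MemLp h 2 μ) :
    |∑ k ∈ Finset.range n, (∫ x, g x * e k x ∂μ) * ∫ x, h x * e k x ∂μ|
      ≤ (∫ x, g x ^ 2 ∂μ) + ∫ x, h x ^ 2 ∂μ := by
  rw [← IsONB.integral_mul_proj fun j => hh.integrable_mul (he.memLp j)]
  refine (abs_integral_mul_le hh (he.memLp_proj n g)).trans ?_
  have h1 := he.proj_sq_le n hg
  have h2 : 0 ≤ ∫ x, h x ^ 2 ∂μ := integral_nonneg fun x => sq_nonneg _
  have h3 : 0 ≤ ∫ x, onbProj μ e n g x ^ 2 ∂μ := integral_nonneg fun x => sq_nonneg _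
  nlinarith [sq_nonneg (√(∫ x, h x ^ 2 ∂μ) - √(∫ x, onbProj μ e n g x ^ 2 ∂μ)),
    Real.sq_sqrt h2, Real.sq_sqrt h3]

/-- The function `cos (n π (x - a) / (b - a))`. -/
def cosI (a b : ℝ) (n : ℤ) (x : ℝ) : ℝ := Real.cos (n * (Real.pi / (b - a) * (x - a)))

/-- Normalised Neumann eigenfunctions on `(a,b)`. -/
def cosB (a b : ℝ) (k : ℕ) (x : ℝ) : ℝ :=
  (if k = 0 then √(1 / (b - a)) else √(2 / (b - a))) *
    Real.cos (k * (Real.pi / (b - a) * (x - a)))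

/-- Normalised Dirichlet eigenfunctions on `(a,b)`. -/
def sinB (a b : ℝ) (k : ℕ) (x : ℝ) : ℝ :=
  √(2 / (b - a)) * Real.sin ((k + 1 : ℕ) * (Real.pi / (b - a) * (x - a)))

/-- Square roots of the Dirichlet eigenvalues on `(a,b)`. -/
def freq (a b : ℝ) (k : ℕ) : ℝ := (k + 1 : ℕ) * (Real.pi / (b - a))

theorem contDiff_cosB (a b : ℝ) (k : ℕ) : ContDiff ℝ (⊤ : ℕ∞) (cosB a b k) := by
  unfold cosB; fun_prop

theorem contDiff_sinB (a b : ℝ) (k : ℕ) : ContDiff ℝ (⊤ : ℕ∞) (sinB a b k) := by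
  unfold sinB; fun_prop

theorem cosB_zero (a b x : ℝ) : cosB a b 0 x = √(1 / (b - a)) := by simp [cosB]

theorem hasDerivAt_sinB (a b : ℝ) (k : ℕ) (x : ℝ) :
    HasDerivAt (sinB a b k) (freq a b k * cosB a b (k + 1) x) x := by
  have h1 : HasDerivAt (fun x => ((k + 1 : ℕ) : ℝ) * (Real.pi / (b - a) * (x - a)))
      (((k + 1 : ℕ) : ℝ) * (Real.pi / (b - a) * 1)) x :=
    (((hasDerivAt_id x).sub_const a).const_mul _).const_mul _
  refine (h1.sin.const_mul (√(2 / (b - a)))).congr_deriv ?_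
  simp [freq, cosB]; ring

theorem hasDerivAt_cosB (a b : ℝ) (k : ℕ) (x : ℝ) :
    HasDerivAt (cosB a b (k + 1)) (-(freq a b k * sinB a b k x)) x := by
  have h1 : HasDerivAt (fun x => ((k + 1 : ℕ) : ℝ) * (Real.pi / (b - a) * (x - a)))
      (((k + 1 : ℕ) : ℝ) * (Real.pi / (b - a) * 1)) x :=
    (((hasDerivAt_id x).sub_const a).const_mul _).const_mul _
  refine HasDerivAt.congr_deriv (f' := √(2 / (b - a)) *
    (-Real.sin (((k + 1 : ℕ) : ℝ) * (Real.pi / (b - a) * (x - a))) *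
      (((k + 1 : ℕ) : ℝ) * (Real.pi / (b - a) * 1)))) ?_ ?_
  · have := h1.cos.const_mul (√(2 / (b - a)))
    have e : cosB a b (k + 1) = fun x => √(2 / (b - a)) *
        Real.cos (((k + 1 : ℕ) : ℝ) * (Real.pi / (b - a) * (x - a))) := by
      funext y; simp [cosB]
    rw [e]; exact this
  · simp [freq, sinB]; ring

theorem deriv_sinB (a b : ℝ) (k : ℕ) :
    deriv (sinB a b k) = fun x => freq a b k * cosB a b (k + 1) x :=
  funext fun x => (hasDerivAt_sinB a b k x).deriv

theorem deriv_cosB (a b : ℝ) (k : ℕ) :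
    deriv (cosB a b (k + 1)) = fun x => -(freq a b k * sinB a b k x) :=
  funext fun x => (hasDerivAt_cosB a b k x).deriv

theorem deriv_cosB_zero (a b : ℝ) : deriv (cosB a b 0) = 0 := by
  have : cosB a b 0 = fun _ => √(1 / (b - a)) := funext (cosB_zero a b)
  rw [this]; exact deriv_const' _

theorem sinB_left (a b : ℝ) (k : ℕ) : sinB a b k a = 0 := by simp [sinB]

theorem sinB_right {a b : ℝ} (hab : a < b) (k : ℕ) : sinB a b k b = 0 := by
  have : Real.pi / (b - a) * (b - a) = Real.pi := div_mul_cancel₀ _ (by linarith)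
  simp only [sinB, this, Real.sin_nat_mul_pi, mul_zero]

theorem memLp_of_continuous {a b : ℝ} {φ : ℝ → ℝ} (h : Continuous φ) :
    MemLp φ 2 (volume.restrict (Ioo a b)) := by
  obtain ⟨C, hC⟩ := isCompact_Icc.exists_bound_of_continuousOn (s := Icc a b) h.continuousOn
  refine MemLp.of_bound h.aestronglyMeasurable C ?_
  filter_upwards [ae_restrict_mem measurableSet_Ioo] with x hx using hC x (Ioo_subset_Icc_self hx)

theorem integrable_mul_continuous {a b : ℝ} {g φ : ℝ → ℝ} (hg : IntegrableOn g (Ioo a b))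
    (h : Continuous φ) : IntegrableOn (fun x => g x * φ x) (Ioo a b) := by
  obtain ⟨C, hC⟩ := isCompact_Icc.exists_bound_of_continuousOn (s := Icc a b) h.continuousOn
  refine Integrable.mul_bdd (c := C) hg h.aestronglyMeasurable ?_
  filter_upwards [ae_restrict_mem measurableSet_Ioo] with x hx using hC x (Ioo_subset_Icc_self hx)

theorem integral_cosI {a b : ℝ} (hab : a < b) (n : ℤ) :
    ∫ x in Ioo a b, cosI a b n x = if n = 0 then b - a else 0 := by
  rw [← integral_Ioc_eq_integral_Ioo, ← intervalIntegral.integral_of_le hab.le]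
  split_ifs with hn
  · subst hn; simp [cosI]
  · have hn' : (n : ℝ) ≠ 0 := by exact_mod_cast hn
    have hc : Real.pi / (b - a) ≠ 0 := div_ne_zero Real.pi_ne_zero (by linarith)
    have hd : ∀ x ∈ uIcc a b, HasDerivAt
        (fun x => Real.sin (n * (Real.pi / (b - a) * (x - a))) / (n * (Real.pi / (b - a))))
        (cosI a b n x) x := by
      intro x _
      have h1 : HasDerivAt (fun x => (n : ℝ) * (Real.pi / (b - a) * (x - a)))
          ((n : ℝ) * (Real.pi / (b - a) * 1)) x :=
        (((hasDerivAt_id x).sub_const a).const_mul _).const_mul _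
      refine (h1.sin.div_const _).congr_deriv ?_
      rw [mul_one, mul_div_assoc, div_self (mul_ne_zero hn' hc), mul_one]; rfl
    rw [intervalIntegral.integral_eq_sub_of_hasDerivAt hd
      (Continuous.intervalIntegrable (by unfold cosI; fun_prop) _ _)]
    have : Real.pi / (b - a) * (b - a) = Real.pi := div_mul_cancel₀ _ (by linarith)
    simp [this, Real.sin_int_mul_pi]

theorem continuous_cosI (a b : ℝ) (n : ℤ) : Continuous (cosI a b n) := by
  unfold cosI; fun_prop

theorem cosI_mul_one (a b : ℝ) (n : ℤ) (x : ℝ) :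
    cosI a b n x * cosI a b 1 x = (cosI a b (n + 1) x + cosI a b (n - 1) x) / 2 := by
  simp only [cosI]; push_cast
  rw [add_mul, sub_mul, Real.cos_add, Real.cos_sub]; ring

theorem cosI_neg (a b : ℝ) (n : ℤ) (x : ℝ) : cosI a b (-n) x = cosI a b n x := by
  simp [cosI]

theorem orth_cosB {a b : ℝ} (hab : a < b) (j k : ℕ) :
    ∫ x in Ioo a b, cosB a b j x * cosB a b k x = if j = k then 1 else 0 := by
  have hL : 0 < b - a := by linarith
  set A : ℕ → ℝ := fun k => if k = 0 then √(1 / (b - a)) else √(2 / (b - a)) with hA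
  have h1 : ∀ x, cosB a b j x * cosB a b k x
      = A j * A k / 2 * (cosI a b (j - k) x + cosI a b (j + k) x) := by
    intro x
    simp only [cosB, cosI, hA]; push_cast
    rw [add_mul, sub_mul, Real.cos_add, Real.cos_sub]; ring
  simp_rw [h1]
  rw [integral_const_mul, integral_add ((memLp_of_continuous (continuous_cosI _ _ _)).integrable
    (by norm_num)) ((memLp_of_continuous (continuous_cosI _ _ _)).integrable (by norm_num)),
    integral_cosI hab, integral_cosI hab]
  have s1 : √(1 / (b - a)) * √(1 / (b - a)) = 1 / (b - a) := Real.mul_self_sqrt (by positivity)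
  have s2 : √(2 / (b - a)) * √(2 / (b - a)) = 2 / (b - a) := Real.mul_self_sqrt (by positivity)
  by_cases hjk : j = k
  · subst hjk
    by_cases hj : j = 0
    · subst hj; simp only [hA, if_true, s1]; simp; field_simp; norm_num
    · have : ¬ ((j : ℤ) + j = 0) := by omega
      simp only [hA, hj, this, if_false, s2]; simp; field_simp
  · have h2 : ¬ ((j : ℤ) - k = 0) := by omega
    have h3 : ¬ ((j : ℤ) + k = 0) := by omega
    simp [hjk, h2, h3]

theorem orth_sinB {a b : ℝ} (hab : a < b) (j k : ℕ) :
    ∫ x in Ioo a b, sinB a b j x * sinB a b k x = if j = k then 1 else 0 := by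
  have hL : 0 < b - a := by linarith
  have h1 : ∀ x, sinB a b j x * sinB a b k x
      = 1 / (b - a) * (cosI a b (j - k) x - cosI a b (j + k + 2) x) := by
    intro x
    have s2 : √(2 / (b - a)) * √(2 / (b - a)) = 2 / (b - a) := Real.mul_self_sqrt (by positivity)
    have e1 : cosI a b (j - k) x = cosI a b ((j + 1) - (k + 1)) x := by congr 1; ring
    have e2 : cosI a b (j + k + 2) x = cosI a b ((j + 1) + (k + 1)) x := by congr 1; ring
    rw [e1, e2]
    simp only [sinB, cosI]; push_cast
    rw [add_mul ((j:ℝ) + 1), sub_mul ((j:ℝ) + 1), Real.cos_add, Real.cos_sub]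
    linear_combination (Real.sin (((j:ℝ) + 1) * (Real.pi / (b - a) * (x - a))) *
      Real.sin (((k:ℝ) + 1) * (Real.pi / (b - a) * (x - a)))) * s2
  simp_rw [h1]
  rw [integral_const_mul, integral_sub ((memLp_of_continuous (continuous_cosI _ _ _)).integrable
    (by norm_num)) ((memLp_of_continuous (continuous_cosI _ _ _)).integrable (by norm_num)),
    integral_cosI hab, integral_cosI hab]
  have h3 : ¬ ((j : ℤ) + k + 2 = 0) := by omega
  by_cases hjk : j = k
  · subst hjk
    simp only [h3, if_false]; simp; field_simp
  · have h2 : ¬ ((j : ℤ) - k = 0) := by omega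
    simp [hjk, h2, h3]

theorem integral_mul_poly_cosI {a b : ℝ} {g : ℝ → ℝ} (hg : IntegrableOn g (Ioo a b))
    (h : ∀ n : ℤ, ∫ x in Ioo a b, g x * cosI a b n x = 0) (p : Polynomial ℝ) :
    ∫ x in Ioo a b, g x * p.eval (cosI a b 1 x) = 0 := by
  have hpow : ∀ m : ℕ, ∀ n : ℤ, ∫ x in Ioo a b, g x * (cosI a b n x * cosI a b 1 x ^ m) = 0 := by
    intro m
    induction m with
    | zero => intro n; simpa using h n
    | succ m ih =>
      intro n
      have e : ∀ x, g x * (cosI a b n x * cosI a b 1 x ^ (m + 1))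
          = 1 / 2 * (g x * (cosI a b (n + 1) x * cosI a b 1 x ^ m)
            + g x * (cosI a b (n - 1) x * cosI a b 1 x ^ m)) := by
        intro x
        linear_combination g x * cosI a b 1 x ^ m * cosI_mul_one a b n x
      have hi : ∀ n : ℤ, IntegrableOn (fun x => g x * (cosI a b n x * cosI a b 1 x ^ m))
          (Ioo a b) := fun n => integrable_mul_continuous hg
            ((continuous_cosI a b n).mul ((continuous_cosI a b 1).pow m))
      simp_rw [e]
      rw [integral_const_mul, integral_add (hi _) (hi _), ih, ih]; simp
  induction p using Polynomial.induction_on' with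
  | add p q hp hq =>
    simp only [Polynomial.eval_add, mul_add]
    rw [integral_add, hp, hq, add_zero] <;>
    exact integrable_mul_continuous hg (by have := continuous_cosI a b 1; fun_prop)
  | monomial n c =>
    simp only [Polynomial.eval_monomial]
    have e : ∀ x, g x * (c * cosI a b 1 x ^ n)
        = c * (g x * (cosI a b 0 x * cosI a b 1 x ^ n)) := by
      intro x
      have : cosI a b 0 x = 1 := by simp [cosI]
      rw [this]; ring
    simp_rw [e]
    rw [integral_const_mul, hpow, mul_zero]

theorem complete_cosI {a b : ℝ} (hab : a < b) {g : ℝ → ℝ} (hg : IntegrableOn g (Ioo a b))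
    (h : ∀ n : ℤ, ∫ x in Ioo a b, g x * cosI a b n x = 0) :
    g =ᵐ[volume.restrict (Ioo a b)] 0 := by
  have hL : 0 < b - a := by linarith
  rw [EventuallyEq, ae_restrict_iff' measurableSet_Ioo]
  refine isOpen_Ioo.ae_eq_zero_of_integral_contDiff_smul_eq_zero hg.locallyIntegrableOn ?_
  intro φ hφ _ hφs
  have hφc := hφ.continuous
  have e1 : ∫ x, φ x • g x = ∫ x in Ioo a b, g x * φ x := by
    rw [setIntegral_eq_integral_of_forall_compl_eq_zero]
    · simp [mul_comm]
    · intro x hx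
      have : φ x = 0 := image_eq_zero_of_notMem_tsupport fun h => hx (hφs h)
      simp [this]
  rw [e1]
  set I := ∫ x in Ioo a b, |g x|
  have hI : 0 ≤ I := integral_nonneg fun x => abs_nonneg _
  have key : ∀ ε > 0, |∫ x in Ioo a b, g x * φ x| ≤ ε * I := by
    intro ε hε
    obtain ⟨p, hp⟩ := exists_polynomial_near_of_continuousOn (-1) 1
      (fun y => φ (a + Real.arccos y / (Real.pi / (b - a))))
      (hφc.comp (by have := Real.continuous_arccos; fun_prop)).continuousOn ε hε
    have hpt : ∀ x ∈ Ioo a b, |φ x - p.eval (cosI a b 1 x)| ≤ ε := by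
      intro x hx
      have hc : 0 < Real.pi / (b - a) := div_pos Real.pi_pos hL
      have h1 := hp (cosI a b 1 x) ⟨Real.neg_one_le_cos _, Real.cos_le_one _⟩
      have h2 : Real.arccos (cosI a b 1 x) = Real.pi / (b - a) * (x - a) := by
        simp only [cosI, Int.cast_one, one_mul]
        rw [Real.arccos_cos (mul_nonneg hc.le (by linarith [hx.1]))]
        rw [div_mul_eq_mul_div, div_le_iff₀ hL]
        nlinarith [Real.pi_pos, hx.2]
      rw [h2, mul_div_cancel_left₀ _ hc.ne', add_sub_cancel] at h1
      rw [abs_sub_comm]; exact h1.le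
    have hcp : Continuous fun x => p.eval (cosI a b 1 x) := by
      have := continuous_cosI a b 1; fun_prop
    have e2 : ∫ x in Ioo a b, g x * φ x
        = ∫ x in Ioo a b, g x * (φ x - p.eval (cosI a b 1 x)) := by
      simp_rw [mul_sub]
      rw [integral_sub (integrable_mul_continuous hg hφc) (integrable_mul_continuous hg hcp),
        integral_mul_poly_cosI hg h, sub_zero]
    rw [e2]
    refine (abs_integral_le_integral_abs).trans ?_
    rw [← integral_const_mul]
    refine setIntegral_mono_on
      (integrable_mul_continuous hg (hφc.sub hcp)).abs (hg.abs.const_mul ε) measurableSet_Ioo ?_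
    intro x hx
    rw [abs_mul, mul_comm]
    exact mul_le_mul_of_nonneg_right (hpt x hx) (abs_nonneg _)
  by_contra hne
  have hpos := abs_pos.2 hne
  have := key (|∫ x in Ioo a b, g x * φ x| / (2 * (I + 1))) (by positivity)
  rw [div_mul_eq_mul_div, le_div_iff₀ (by positivity)] at this
  nlinarith

theorem complete_cosB {a b : ℝ} (hab : a < b) {g : ℝ → ℝ} (hg : IntegrableOn g (Ioo a b))
    (h : ∀ k, ∫ x in Ioo a b, g x * cosB a b k x = 0) :
    g =ᵐ[volume.restrict (Ioo a b)] 0 := by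
  have hL : 0 < b - a := by linarith
  have hnat : ∀ k : ℕ, ∫ x in Ioo a b, g x * cosI a b k x = 0 := by
    intro k
    have h1 := h k
    have hA : 0 < (if k = 0 then √(1 / (b - a)) else √(2 / (b - a))) := by
      split_ifs <;> positivity
    have e : ∀ x, g x * cosB a b k x
        = (if k = 0 then √(1 / (b - a)) else √(2 / (b - a))) * (g x * cosI a b k x) := by
      intro x; simp only [cosB, cosI, Int.cast_natCast]; ring
    simp_rw [e] at h1
    rw [integral_const_mul] at h1
    exact (mul_eq_zero.1 h1).resolve_left hA.ne'
  refine complete_cosI hab hg fun n => ?_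
  obtain ⟨k, rfl | rfl⟩ := n.eq_nat_or_neg
  · exact hnat k
  · simp_rw [cosI_neg]; exact hnat k

theorem complete_sinB {a b : ℝ} (hab : a < b) {g : ℝ → ℝ} (hg : IntegrableOn g (Ioo a b))
    (h : ∀ k, ∫ x in Ioo a b, g x * sinB a b k x = 0) :
    g =ᵐ[volume.restrict (Ioo a b)] 0 := by
  have hL : 0 < b - a := by linarith
  have hc : 0 < Real.pi / (b - a) := div_pos Real.pi_pos hL
  let S : ℕ → ℝ → ℝ := fun n x => Real.sin (n * (Real.pi / (b - a) * (x - a)))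
  have hS : ∀ n, Continuous (S n) := fun n => by simp only [S]; fun_prop
  have hS0 : ∀ n, ∫ x in Ioo a b, g x * S n x = 0 := by
    intro n
    cases n with
    | zero => simp [S]
    | succ k =>
      have h1 := h k
      have e : ∀ x, g x * sinB a b k x = √(2 / (b - a)) * (g x * S (k + 1) x) := by
        intro x; simp only [sinB, S]; ring
      simp_rw [e] at h1
      rw [integral_const_mul] at h1
      exact (mul_eq_zero.1 h1).resolve_left (by positivity)
  have hz : (fun x => g x * S 1 x) =ᵐ[volume.restrict (Ioo a b)] 0 := by
    have hnat : ∀ k : ℕ, ∫ x in Ioo a b, g x * S 1 x * cosI a b k x = 0 := by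
      intro k
      cases k with
      | zero => simpa [cosI] using hS0 1
      | succ m =>
        have e : ∀ x, g x * S 1 x * cosI a b (m + 1 : ℕ) x
            = 1 / 2 * (g x * S (m + 2) x - g x * S m x) := by
          intro x
          simp only [S, cosI]; push_cast
          have e1 : ((m : ℝ) + 2) * (Real.pi / (b - a) * (x - a))
            = (m + 1) * (Real.pi / (b - a) * (x - a)) + 1 * (Real.pi / (b - a) * (x - a)) := by
              ring
          have e2 : (m : ℝ) * (Real.pi / (b - a) * (x - a))
            = (m + 1) * (Real.pi / (b - a) * (x - a)) - 1 * (Real.pi / (b - a) * (x - a)) := by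
              ring
          rw [e1, e2, Real.sin_add, Real.sin_sub]; ring
        simp_rw [e]
        rw [integral_const_mul, integral_sub (integrable_mul_continuous hg (hS _))
          (integrable_mul_continuous hg (hS _)), hS0, hS0]; simp
    refine complete_cosI hab (integrable_mul_continuous hg (hS 1)) fun n => ?_
    obtain ⟨k, rfl | rfl⟩ := n.eq_nat_or_neg
    · exact hnat k
    · simp_rw [cosI_neg]; exact hnat k
  filter_upwards [hz, ae_restrict_mem measurableSet_Ioo] with x hx hx'
  have : 0 < S 1 x := by
    simp only [S, Nat.cast_one, one_mul]
    apply Real.sin_pos_of_pos_of_lt_pi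
    · exact mul_pos hc (by linarith [hx'.1])
    · rw [div_mul_eq_mul_div, div_lt_iff₀ hL]
      nlinarith [Real.pi_pos, hx'.2]
  exact (mul_eq_zero.1 hx).resolve_right this.ne'

theorem isONB_cosB {a b : ℝ} (hab : a < b) : IsONB (volume.restrict (Ioo a b)) (cosB a b) where
  memLp k := memLp_of_continuous (contDiff_cosB a b k).continuous
  orth := orth_cosB hab
  complete g hg h := complete_cosB hab (hg.integrable (by norm_num)) h

theorem isONB_sinB {a b : ℝ} (hab : a < b) : IsONB (volume.restrict (Ioo a b)) (sinB a b) where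
  memLp k := memLp_of_continuous (contDiff_sinB a b k).continuous
  orth := orth_sinB hab
  complete g hg h := complete_sinB hab (hg.integrable (by norm_num)) h

theorem exists_bound_mul_deriv_cutoff :
    ∃ C : ℝ, ∀ y : ℝ, 0 ≤ y →
      |y * deriv (fun y => Real.smoothTransition (y - 1)) y| ≤ C := by
  have hc : ContDiff ℝ (⊤ : ℕ∞) (fun y => Real.smoothTransition (y - 1)) :=
    Real.smoothTransition.contDiff.comp (contDiff_id.sub contDiff_const)
  have hd : Continuous (deriv fun y => Real.smoothTransition (y - 1)) :=
    hc.continuous_deriv (by simp)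
  obtain ⟨C, hC⟩ := (isCompact_Icc (a := (0:ℝ)) (b := 2)).exists_bound_of_continuousOn
    (continuous_id.mul hd).continuousOn
  refine ⟨C, fun y hy => ?_⟩
  rcases le_or_gt y 2 with h2 | h2
  · exact hC y ⟨hy, h2⟩
  · have h1 : (fun y => Real.smoothTransition (y - 1)) =ᶠ[nhds y] fun _ => 1 := by
      filter_upwards [lt_mem_nhds h2] with z hz
      exact Real.smoothTransition.one_of_one_le (by linarith)
    rw [h1.deriv_eq]
    simpa using (abs_nonneg _).trans (hC 0 ⟨le_rfl, by norm_num⟩)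

/-- Smooth functions vanishing at the boundary are limits of functions compactly supported in the
interior, boundedly together with first derivatives. -/
theorem exists_interior_approx {a b : ℝ} (hab : a < b) {ψ : ℝ → ℝ}
    (hψ : ContDiff ℝ (⊤ : ℕ∞) ψ) (ha : ψ a = 0) (hb : ψ b = 0) :
    ∃ (Ψ : ℕ → ℝ → ℝ) (C : ℝ), (∀ n, ContDiff ℝ (⊤ : ℕ∞) (Ψ n)) ∧
      (∀ n, tsupport (Ψ n) ⊆ Ioo a b) ∧
      (∀ n, ∀ x ∈ Ioo a b, |Ψ n x| ≤ C ∧ |deriv (Ψ n) x| ≤ C) ∧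
      (∀ x ∈ Ioo a b, ∀ᶠ n in atTop, Ψ n x = ψ x ∧ deriv (Ψ n) x = deriv ψ x) := by
  have hL : 0 < b - a := by linarith
  set η : ℝ → ℝ := fun y => Real.smoothTransition (y - 1) with hη
  have hηc : ContDiff ℝ (⊤ : ℕ∞) η :=
    Real.smoothTransition.contDiff.comp (contDiff_id.sub contDiff_const)
  set q : ℝ → ℝ := fun x => (x - a) * (b - x) with hq
  have hqc : ContDiff ℝ (⊤ : ℕ∞) q := by simp only [hq]; fun_prop
  have hqd : ∀ x, HasDerivAt q ((b - x) - (x - a)) x := by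
    intro x
    have := ((hasDerivAt_id x).sub_const a).mul ((hasDerivAt_id x).const_sub b)
    refine this.congr_deriv ?_
    simp; ring
  obtain ⟨C1, hC1⟩ := exists_bound_mul_deriv_cutoff
  have hψd : Continuous (deriv ψ) := hψ.continuous_deriv (by simp)
  have hψdiff : Differentiable ℝ ψ := hψ.differentiable (by simp)
  obtain ⟨D0, hD0⟩ := isCompact_Icc.exists_bound_of_continuousOn (s := Icc a b) hψ.continuous.continuousOn
  obtain ⟨D, hD⟩ := isCompact_Icc.exists_bound_of_continuousOn (s := Icc a b) hψd.continuousOn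
  have hD0' : 0 ≤ D0 := (norm_nonneg _).trans (hD0 a ⟨le_rfl, hab.le⟩)
  have hD' : 0 ≤ D := (norm_nonneg _).trans (hD a ⟨le_rfl, hab.le⟩)
  have hC1' : 0 ≤ C1 := (abs_nonneg _).trans (hC1 0 le_rfl)
  have hlip : ∀ x ∈ Icc a b, |ψ x| ≤ 2 * D / (b - a) * q x := by
    intro x hx
    have m1 := (convex_Icc a b).norm_image_sub_le_of_norm_deriv_le
      (fun y _ => hψdiff y) hD (left_mem_Icc.2 hab.le) hx
    have m2 := (convex_Icc a b).norm_image_sub_le_of_norm_deriv_le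
      (fun y _ => hψdiff y) hD (right_mem_Icc.2 hab.le) hx
    rw [ha, sub_zero, Real.norm_eq_abs, Real.norm_eq_abs,
      abs_of_nonneg (show (0:ℝ) ≤ x - a by linarith [hx.1])] at m1
    rw [hb, sub_zero, Real.norm_eq_abs, Real.norm_eq_abs,
      abs_of_nonpos (show x - b ≤ 0 by linarith [hx.2])] at m2
    rw [div_mul_eq_mul_div, le_div_iff₀ hL]
    have h1 : 0 ≤ x - a := by linarith [hx.1]
    have h2 : 0 ≤ b - x := by linarith [hx.2]
    simp only [hq]
    nlinarith [mul_le_mul_of_nonneg_right m1 h2, mul_le_mul_of_nonneg_right m2 h1]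
  have hder : ∀ (n : ℕ) x, HasDerivAt (fun x => ψ x * η (n * q x))
      (deriv ψ x * η (n * q x) + ψ x * (deriv η (n * q x) * (n * ((b - x) - (x - a))))) x := by
    intro n x
    have hη1 : HasDerivAt η (deriv η (n * q x)) (n * q x) :=
      (hηc.differentiable (by simp) _).hasDerivAt
    have h2 : HasDerivAt (fun x => η (n * q x)) (deriv η (n * q x) * (n * ((b - x) - (x - a)))) x :=
      HasDerivAt.comp (h₂ := η) x hη1 ((hqd x).const_mul (n : ℝ))
    exact (hψdiff x).hasDerivAt.mul h2
  refine ⟨fun n x => ψ x * η (n * q x), D0 + D + 2 * D / (b - a) * C1 * (b - a),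
    fun n => ?_, fun n => ?_, fun n x hx => ?_, fun x hx => ?_⟩
  · exact hψ.mul (hηc.comp (contDiff_const.mul hqc))
  · have hsub : tsupport (fun x => ψ x * η (n * q x)) ⊆ {x | 1 ≤ n * q x} := by
      apply closure_minimal _ (isClosed_le continuous_const (continuous_const.mul hqc.continuous))
      intro x hx
      by_contra h
      apply hx
      have : η (n * q x) = 0 := Real.smoothTransition.zero_of_nonpos (by
        have h' : (n : ℝ) * q x < 1 := not_le.1 h
        linarith)
      simp [this]
    intro x hx
    have h1 : 1 ≤ n * q x := hsub hx
    have hn : (0:ℝ) ≤ n := Nat.cast_nonneg n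
    have h2 : 0 < q x := by
      by_contra h
      nlinarith
    simp only [hq] at h2
    constructor
    · by_contra h; nlinarith
    · by_contra h; nlinarith
  · have hx' := Ioo_subset_Icc_self hx
    have e0 := hD0 x hx'
    have e1 := hD x hx'
    rw [Real.norm_eq_abs] at e0 e1
    have e2 := hlip x hx'
    have hq0 : 0 ≤ q x := mul_nonneg (by linarith [hx.1]) (by linarith [hx.2])
    have e3 := hC1 (n * q x) (mul_nonneg (Nat.cast_nonneg n) hq0)
    have η0 : |η (n * q x)| ≤ 1 := by
      rw [abs_of_nonneg (Real.smoothTransition.nonneg _)]; exact Real.smoothTransition.le_one _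
    have hK : 0 ≤ 2 * D / (b - a) * C1 * (b - a) := by positivity
    constructor
    · rw [abs_mul]
      nlinarith [abs_nonneg (ψ x), abs_nonneg (η (n * q x))]
    · rw [(hder n x).deriv]
      refine (abs_add_le _ _).trans ?_
      have t1 : |deriv ψ x * η (n * q x)| ≤ D := by
        rw [abs_mul]; nlinarith [abs_nonneg (deriv ψ x), abs_nonneg (η (n * q x))]
      have t2 : |ψ x * (deriv η (n * q x) * (n * ((b - x) - (x - a))))|
          ≤ 2 * D / (b - a) * C1 * (b - a) := by
        have h3 : |(b - x) - (x - a)| ≤ b - a := abs_le.2 ⟨by linarith [hx.2], by linarith [hx.1]⟩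
        rw [abs_mul, abs_mul, abs_mul]
        rw [abs_mul, abs_mul, abs_of_nonneg hq0] at e3
        calc |ψ x| * (|deriv η (n * q x)| * (|(n:ℝ)| * |(b - x) - (x - a)|))
            ≤ (2 * D / (b - a) * q x) * (|deriv η (n * q x)| * (|(n:ℝ)| * |(b - x) - (x - a)|)) :=
              mul_le_mul_of_nonneg_right e2 (by positivity)
          _ = 2 * D / (b - a) * (|(n:ℝ)| * q x * |deriv η (n * q x)|) * |(b - x) - (x - a)| := by
              ring
          _ ≤ 2 * D / (b - a) * C1 * (b - a) := by
              apply mul_le_mul _ h3 (abs_nonneg _) (by positivity)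
              exact mul_le_mul_of_nonneg_left e3 (by positivity)
      linarith
  · have hq0 : 0 < q x := mul_pos (by linarith [hx.1]) (by linarith [hx.2])
    obtain ⟨N, hN⟩ := exists_nat_gt (2 / q x)
    filter_upwards [eventually_ge_atTop N] with n hn
    have h1 : 2 < n * q x := by
      rw [div_lt_iff₀ hq0] at hN
      have : (N : ℝ) ≤ n := by exact_mod_cast hn
      nlinarith
    have hev : (fun x => ψ x * η (n * q x)) =ᶠ[nhds x] ψ := by
      have : ∀ᶠ y in nhds x, 2 < n * q y :=
        (continuous_const.mul hqc.continuous).continuousAt.eventually (lt_mem_nhds h1)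
      filter_upwards [this] with y hy
      have : η (n * q y) = 1 := Real.smoothTransition.one_of_one_le (by linarith)
      simp [this]
    exact ⟨hev.eq_of_nhds, hev.deriv_eq⟩

/-- Integration by parts against smooth functions vanishing at the boundary. -/
theorem WeakDerivI.integral_eq {a b : ℝ} (hab : a < b) {g g' : ℝ → ℝ} (h : WeakDerivI a b g g')
    (hg : IntegrableOn g (Ioo a b)) (hg' : IntegrableOn g' (Ioo a b)) {ψ : ℝ → ℝ}
    (hψ : ContDiff ℝ (⊤ : ℕ∞) ψ) (ha : ψ a = 0) (hb : ψ b = 0) :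
    ∫ x in Ioo a b, g x * deriv ψ x = - ∫ x in Ioo a b, g' x * ψ x := by
  obtain ⟨Ψ, C, hΨ, hs, hbd, hlim⟩ := exists_interior_approx hab hψ ha hb
  have l1 : Tendsto (fun n => ∫ x in Ioo a b, g x * deriv (Ψ n) x) atTop
      (nhds (∫ x in Ioo a b, g x * deriv ψ x)) := by
    apply tendsto_integral_of_dominated_convergence (fun x => C * |g x|)
    · exact fun n => (integrable_mul_continuous hg ((hΨ n).continuous_deriv
        (by simp))).aestronglyMeasurable
    · exact hg.abs.const_mul C
    · intro n
      filter_upwards [ae_restrict_mem measurableSet_Ioo] with x hx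
      rw [Real.norm_eq_abs, abs_mul, mul_comm]
      exact mul_le_mul_of_nonneg_right (hbd n x hx).2 (abs_nonneg _)
    · filter_upwards [ae_restrict_mem measurableSet_Ioo] with x hx
      apply tendsto_const_nhds.congr'
      filter_upwards [hlim x hx] with n hn
      rw [hn.2]
  have l2 : Tendsto (fun n => ∫ x in Ioo a b, g' x * Ψ n x) atTop
      (nhds (∫ x in Ioo a b, g' x * ψ x)) := by
    apply tendsto_integral_of_dominated_convergence (fun x => C * |g' x|)
    · exact fun n => (integrable_mul_continuous hg' (hΨ n).continuous).aestronglyMeasurable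
    · exact hg'.abs.const_mul C
    · intro n
      filter_upwards [ae_restrict_mem measurableSet_Ioo] with x hx
      rw [Real.norm_eq_abs, abs_mul, mul_comm]
      exact mul_le_mul_of_nonneg_right (hbd n x hx).1 (abs_nonneg _)
    · filter_upwards [ae_restrict_mem measurableSet_Ioo] with x hx
      apply tendsto_const_nhds.congr'
      filter_upwards [hlim x hx] with n hn
      rw [hn.1]
  refine tendsto_nhds_unique l1 ?_
  simp_rw [fun n => h (Ψ n) (hΨ n) (hs n)]
  exact l2.neg

theorem intervalIntegrable_of_Ioo {a b : ℝ} (hab : a ≤ b) {g : ℝ → ℝ}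
    (hg : IntegrableOn g (Ioo a b)) : IntervalIntegrable g volume a b := by
  rw [intervalIntegrable_iff_integrableOn_Ioc_of_le hab]
  exact (by rwa [integrableOn_Ioc_iff_integrableOn_Ioo])

theorem setIntegral_Ioo_eq {a b : ℝ} (hab : a ≤ b) (g : ℝ → ℝ) :
    ∫ x in Ioo a b, g x = ∫ x in a..b, g x := by
  rw [intervalIntegral.integral_of_le hab, integral_Ioc_eq_integral_Ioo]

/-- A function with an integrable weak derivative is a.e. equal to a primitive of it. -/
theorem WeakDerivI.ae_eq_primitive {a b : ℝ} (hab : a < b) {g g' : ℝ → ℝ}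
    (h : WeakDerivI a b g g')
    (hg : IntegrableOn g (Ioo a b)) (hg' : IntegrableOn g' (Ioo a b)) :
    ∃ c, ∀ᵐ x ∂volume.restrict (Ioo a b), g x = c + ∫ s in a..x, g' s := by
  have hi' := intervalIntegrable_of_Ioo hab.le hg'
  set P : ℝ → ℝ := fun x => ∫ s in a..x, g' s with hP
  have hPc : ContinuousOn P (Icc a b) := by
    have := (ac_primitive hi' 0).continuousOn
    simpa [uIcc_of_le hab.le] using this
  have hPi : IntegrableOn P (Ioo a b) :=
    (hPc.integrableOn_compact isCompact_Icc).mono_set Ioo_subset_Icc_self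
  set H : ℝ → ℝ := fun x => g x - P x with hH
  have hHi : IntegrableOn H (Ioo a b) := hg.sub hPi
  have hcB := fun k => (contDiff_cosB a b k).continuous
  have hsB := fun k => (contDiff_sinB a b k).continuous
  have h0 : ∀ k, ∫ x in Ioo a b, H x * cosB a b (k + 1) x = 0 := by
    intro k
    have e1 := h.integral_eq hab hg hg' (contDiff_sinB a b k) (sinB_left a b k) (sinB_right hab k)
    have hsd : Continuous (fun x => freq a b k * cosB a b (k + 1) x) :=
      continuous_const.mul (hcB (k + 1))
    have hft : ∀ x, ∫ s in a..x, freq a b k * cosB a b (k + 1) s = sinB a b k x := by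
      intro x
      rw [intervalIntegral.integral_eq_sub_of_hasDerivAt (fun x _ => hasDerivAt_sinB a b k x)
        (hsd.intervalIntegrable _ _), sinB_left, sub_zero]
    have e2 := primitive_mul hi' (hsd.intervalIntegrable a b) 0 0
    simp only [zero_add, hft, sinB_right hab, mul_zero] at e2
    rw [← setIntegral_Ioo_eq hab.le, integral_add (integrable_mul_continuous hg' (hsB k))
      (integrable_mul_continuous hPi hsd)] at e2
    rw [deriv_sinB] at e1
    have e3 : freq a b k * ∫ x in Ioo a b, H x * cosB a b (k + 1) x = 0 := by
      rw [← integral_const_mul]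
      have : ∀ x, freq a b k * (H x * cosB a b (k + 1) x)
          = g x * (freq a b k * cosB a b (k + 1) x) - P x * (freq a b k * cosB a b (k + 1) x) := by
        intro x; simp only [hH]; ring
      simp_rw [this]
      rw [integral_sub (integrable_mul_continuous hg hsd) (integrable_mul_continuous hPi hsd)]
      linarith
    have hf : freq a b k ≠ 0 := by
      have : 0 < b - a := by linarith
      unfold freq; have := Real.pi_pos; positivity
    exact (mul_eq_zero.1 e3).resolve_left hf
  set m := ∫ x in Ioo a b, H x * cosB a b 0 x
  have hz := complete_cosB hab (g := fun x => H x - m * cosB a b 0 x)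
    (hHi.sub ((memLp_of_continuous (hcB 0)).integrable (by norm_num) |>.const_mul m)) (by
      intro k
      have : ∀ x, (H x - m * cosB a b 0 x) * cosB a b k x
        = H x * cosB a b k x - m * (cosB a b 0 x * cosB a b k x) := fun x => by ring
      simp_rw [this]
      rw [integral_sub (integrable_mul_continuous hHi (hcB k))
        (g := fun x => m * (cosB a b 0 x * cosB a b k x))
        (((memLp_of_continuous ((hcB 0).mul (hcB k))).integrable (by norm_num)).const_mul m),
        integral_const_mul, orth_cosB hab]
      cases k with
      | zero => simp [m]
      | succ k => simp [h0])
  refine ⟨m * √(1 / (b - a)), ?_⟩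
  filter_upwards [hz] with x hx
  simp only [cosB_zero, Pi.zero_apply, hH] at hx
  linarith

theorem abs_intervalIntegral_le_setIntegral {a b x y : ℝ} {g : ℝ → ℝ}
    (hg : IntegrableOn g (Ioo a b)) (hx : x ∈ Ioo a b) (hy : y ∈ Ioo a b) :
    |∫ s in y..x, g s| ≤ ∫ s in Ioo a b, |g s| := by
  have h1 : ‖∫ s in y..x, g s‖ ≤ ∫ s in uIoc y x, ‖g s‖ :=
    intervalIntegral.norm_integral_le_integral_norm_uIoc
  refine h1.trans ?_
  refine setIntegral_mono_set hg.norm (ae_of_all _ fun x => norm_nonneg _) ?_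
  refine LE.le.eventuallyLE fun z hz => ?_
  rw [uIoc, mem_Ioc] at hz
  exact ⟨lt_of_lt_of_le' hz.1 (le_min hy.1.le hx.1.le) , lt_of_le_of_lt hz.2 (max_lt hy.2 hx.2)⟩

/-- One-dimensional Agmon inequality. -/
theorem WeakDerivI.sq_le {a b : ℝ} (hab : a < b) {g g' : ℝ → ℝ} (h : WeakDerivI a b g g')
    (hg : MemLp g 2 (volume.restrict (Ioo a b))) (hg' : MemLp g' 2 (volume.restrict (Ioo a b))) :
    ∀ᵐ x ∂volume.restrict (Ioo a b), g x ^ 2 ≤ 1 / (b - a) * (∫ x in Ioo a b, g x ^ 2)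
      + 2 * (√(∫ x in Ioo a b, g x ^ 2) * √(∫ x in Ioo a b, g' x ^ 2)) := by
  have hL : 0 < b - a := by linarith
  have ig : IntegrableOn g (Ioo a b) := hg.integrable (by norm_num)
  have ig' : IntegrableOn g' (Ioo a b) := hg'.integrable (by norm_num)
  obtain ⟨c, hc⟩ := h.ae_eq_primitive hab ig ig'
  have hi' := intervalIntegrable_of_Ioo hab.le ig'
  set P : ℝ → ℝ := fun x => c + ∫ s in a..x, g' s with hP
  have iPg : IntegrableOn (fun x => P x * g' x) (Ioo a b) := by
    refine (hg.integrable_mul hg').congr ?_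
    filter_upwards [hc] with x hx
    simp only [Pi.mul_apply, hP, hx]
  have iPg' := intervalIntegrable_of_Ioo hab.le iPg
  have hsq : ∀ x ∈ Icc a b, P x ^ 2 = c ^ 2 + 2 * ∫ s in a..x, P s * g' s := by
    intro x hx
    have hix := hi'.mono_set (c := a) (d := x)
      (by rw [uIcc_of_le hx.1, uIcc_of_le hab.le]; exact Icc_subset_Icc_right hx.2)
    have := primitive_mul hix hix c c
    rw [pow_two, this, ← intervalIntegral.integral_const_mul, pow_two]
    congr 1
    apply intervalIntegral.integral_congr
    intro s _
    simp only [hP]; ring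
  have hCS : ∫ s in Ioo a b, |P s * g' s|
      ≤ √(∫ x in Ioo a b, g x ^ 2) * √(∫ x in Ioo a b, g' x ^ 2) := by
    have e1 : ∫ s in Ioo a b, |P s * g' s| = ∫ s in Ioo a b, |g s| * |g' s| := by
      apply integral_congr_ae
      filter_upwards [hc] with x hx
      rw [abs_mul, hx]
    have := abs_integral_mul_le hg.abs hg'.abs
    simp only [Pi.abs_apply, sq_abs] at this
    rw [e1]
    exact (le_abs_self _).trans this
  set R := √(∫ x in Ioo a b, g x ^ 2) * √(∫ x in Ioo a b, g' x ^ 2)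
  have hxy : ∀ x ∈ Ioo a b, ∀ y ∈ Ioo a b, P x ^ 2 ≤ P y ^ 2 + 2 * R := by
    intro x hx y hy
    have h1 := hsq x (Ioo_subset_Icc_self hx)
    have h2 := hsq y (Ioo_subset_Icc_self hy)
    have h3 := intervalIntegral.integral_interval_sub_left
      (iPg'.mono_set (c := a) (d := x) (by
        rw [uIcc_of_le hx.1.le, uIcc_of_le hab.le]; exact Icc_subset_Icc_right hx.2.le))
      (iPg'.mono_set (c := a) (d := y) (by
        rw [uIcc_of_le hy.1.le, uIcc_of_le hab.le]; exact Icc_subset_Icc_right hy.2.le))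
    have h4 := abs_intervalIntegral_le_setIntegral iPg hx hy
    have h5 := le_abs_self (∫ s in y..x, P s * g' s)
    linarith
  have hmeas : volume.real (Ioo a b) = b - a := by
    simp [Measure.real, hL.le]
  filter_upwards [hc, ae_restrict_mem measurableSet_Ioo] with x hx hx'
  have i2 : IntegrableOn (fun y => g y ^ 2) (Ioo a b) := hg.integrable_sq
  have hadd : IntegrableOn (fun y => g y ^ 2 + 2 * R) (Ioo a b) := i2.add (integrable_const _)
  have h1 : ∫ y in Ioo a b, g x ^ 2 ≤ ∫ y in Ioo a b, (g y ^ 2 + 2 * R) := by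
    apply integral_mono_ae (integrable_const _) hadd
    filter_upwards [hc, ae_restrict_mem measurableSet_Ioo] with y hy hy'
    simp only [hx, hy]
    exact hxy x hx' y hy'
  rw [integral_add i2 (integrable_const _)] at h1
  simp only [integral_const, measureReal_restrict_apply_univ, hmeas, smul_eq_mul] at h1
  have : g x ^ 2 ≤ ((∫ y in Ioo a b, g y ^ 2) + (b - a) * (2 * R)) / (b - a) := by
    rw [le_div_iff₀ hL]; linarith
  refine this.trans (le_of_eq ?_)
  field_simp

/-- Sup bound by the mean and the norm of the weak derivative. -/
theorem WeakDerivI.abs_le {a b : ℝ} (hab : a < b) {g g' : ℝ → ℝ} (h : WeakDerivI a b g g')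
    (hg : IntegrableOn g (Ioo a b)) (hg' : MemLp g' 2 (volume.restrict (Ioo a b))) :
    ∀ᵐ x ∂volume.restrict (Ioo a b), |g x| ≤ 1 / (b - a) * (∫ x in Ioo a b, |g x|)
      + √(b - a) * √(∫ x in Ioo a b, g' x ^ 2) := by
  have hL : 0 < b - a := by linarith
  have ig' : IntegrableOn g' (Ioo a b) := hg'.integrable (by norm_num)
  obtain ⟨c, hc⟩ := h.ae_eq_primitive hab hg ig'
  have hi' := intervalIntegrable_of_Ioo hab.le ig'
  have hmeas : volume.real (Ioo a b) = b - a := by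
    simp [Measure.real, hL.le]
  have hCS : ∫ s in Ioo a b, |g' s| ≤ √(b - a) * √(∫ x in Ioo a b, g' x ^ 2) := by
    have := abs_integral_mul_le (memLp_const (μ := volume.restrict (Ioo a b)) (1:ℝ)) hg'.abs
    simp only [Pi.abs_apply, sq_abs] at this
    simp only [one_mul, one_pow, integral_const, measureReal_restrict_apply_univ, hmeas,
      smul_eq_mul, mul_one] at this
    exact (le_abs_self _).trans this
  set R := √(b - a) * √(∫ x in Ioo a b, g' x ^ 2)
  filter_upwards [hc, ae_restrict_mem measurableSet_Ioo] with x hx hx'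
  have hadd : IntegrableOn (fun y => |g y| + R) (Ioo a b) := hg.abs.add (integrable_const _)
  have h1 : ∫ y in Ioo a b, |g x| ≤ ∫ y in Ioo a b, (|g y| + R) := by
    apply integral_mono_ae (integrable_const _) hadd
    filter_upwards [hc, ae_restrict_mem measurableSet_Ioo] with y hy hy'
    have h3 := intervalIntegral.integral_interval_sub_left
      (hi'.mono_set (c := a) (d := x) (by
        rw [uIcc_of_le hx'.1.le, uIcc_of_le hab.le]; exact Icc_subset_Icc_right hx'.2.le))
      (hi'.mono_set (c := a) (d := y) (by
        rw [uIcc_of_le hy'.1.le, uIcc_of_le hab.le]; exact Icc_subset_Icc_right hy'.2.le))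
    have h4 := abs_intervalIntegral_le_setIntegral ig' hx' hy'
    have h5 : g x = g y + ∫ s in y..x, g' s := by rw [hx, hy]; linarith
    rw [h5]
    exact (abs_add_le _ _).trans (by linarith)
  rw [integral_add hg.abs (integrable_const _)] at h1
  simp only [integral_const, measureReal_restrict_apply_univ, hmeas, smul_eq_mul] at h1
  have : |g x| ≤ ((∫ y in Ioo a b, |g y|) + (b - a) * R) / (b - a) := by
    rw [le_div_iff₀ hL]; linarith
  refine this.trans (le_of_eq ?_)
  field_simp

/-- A continuous function orthogonal to all compactly supported smooth functions vanishes. -/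
theorem eqOn_zero_of_integral_smooth {T : ℝ} (hT : 0 < T) {h : ℝ → ℝ}
    (hc : ContinuousOn h (Icc 0 T))
    (h0 : ∀ ξ : ℝ → ℝ, ContDiff ℝ (⊤ : ℕ∞) ξ → HasCompactSupport ξ → tsupport ξ ⊆ Ioo 0 T →
      ∫ t in (0:ℝ)..T, h t * ξ t = 0) :
    ∀ t ∈ Icc 0 T, h t = 0 := by
  have hae : ∀ᵐ t, t ∈ Ioo 0 T → h t = 0 := by
    apply isOpen_Ioo.ae_eq_zero_of_integral_contDiff_smul_eq_zero
    · exact ((hc.integrableOn_compact isCompact_Icc).mono_set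
        Ioo_subset_Icc_self).locallyIntegrableOn
    · intro ξ h1 h2 h3
      have := h0 ξ h1 h2 h3
      rw [← setIntegral_Ioo_eq hT.le] at this
      rw [← this, ← setIntegral_eq_integral_of_forall_compl_eq_zero (s := Ioo 0 T)]
      · simp [mul_comm]
      · intro x hx
        have : ξ x = 0 := by
          by_contra hne
          exact hx (h3 (subset_tsupport _ hne))
        simp [this]
  have hae' : ∀ᵐ t ∂volume.restrict (Ioo 0 T), h t = (fun _ => (0:ℝ)) t :=
    (ae_restrict_iff' measurableSet_Ioo).2 hae
  have h1 : EqOn h (fun _ => 0) (Ioo 0 T) :=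
    Measure.eqOn_open_of_ae_eq hae' isOpen_Ioo (hc.mono Ioo_subset_Icc_self) continuousOn_const
  exact h1.of_subset_closure hc continuousOn_const Ioo_subset_Icc_self (closure_Ioo hT.ne).ge

/-- The primitive vanishing for late times of a compactly supported function. -/
theorem exists_late_primitive {T : ℝ} {ξ : ℝ → ℝ} (hξ : ContDiff ℝ (⊤ : ℕ∞) ξ)
    (hl : ∃ T' < T, ∀ t, T' ≤ t → ξ t = 0) :
    ∃ χ : ℝ → ℝ, ContDiff ℝ (⊤ : ℕ∞) χ ∧ (∃ T' < T, ∀ t, T' ≤ t → χ t = 0) ∧ deriv χ = ξ := by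
  have hd : ∀ t, HasDerivAt (fun t => ∫ s in T..t, ξ s) (ξ t) t := fun t =>
    intervalIntegral.integral_hasDerivAt_right (hξ.continuous.intervalIntegrable _ _)
      (hξ.continuous.stronglyMeasurableAtFilter _ _) hξ.continuous.continuousAt
  have hd' : deriv (fun t => ∫ s in T..t, ξ s) = ξ := funext fun t => (hd t).deriv
  refine ⟨fun t => ∫ s in T..t, ξ s, ?_, ?_, hd'⟩
  · rw [contDiff_infty_iff_deriv, hd']
    exact ⟨fun t => (hd t).differentiableAt, hξ⟩
  · obtain ⟨T', hT', h0⟩ := hl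
    refine ⟨T', hT', fun t ht => ?_⟩
    change ∫ s in T..t, ξ s = 0
    rw [intervalIntegral.integral_congr (g := fun _ => (0:ℝ)), intervalIntegral.integral_zero]
    intro s hs
    rw [uIcc, mem_Icc] at hs
    exact h0 s ((le_min hT'.le ht).trans hs.1)

theorem late_of_compactSupport {T : ℝ} (hT : 0 < T) {ξ : ℝ → ℝ} (hc : HasCompactSupport ξ)
    (hs : tsupport ξ ⊆ Ioo 0 T) : ∃ T' < T, ∀ t, T' ≤ t → ξ t = 0 := by
  rcases (tsupport ξ).eq_empty_or_nonempty with he | hne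
  · refine ⟨0, hT, fun t _ => ?_⟩
    rw [tsupport_eq_empty_iff] at he
    simp [he]
  · obtain ⟨x, hx, hmax⟩ := hc.isCompact.exists_isGreatest hne
    refine ⟨(x + T) / 2, by linarith [(hs hx).2], fun t ht => ?_⟩
    by_contra hne
    have := hmax (subset_tsupport _ hne)
    linarith [(hs hx).2]

theorem smooth_eq_primitive {ξ : ℝ → ℝ} (hξ : ContDiff ℝ (⊤ : ℕ∞) ξ) (t : ℝ) :
    ξ t = ξ 0 + ∫ s in (0:ℝ)..t, deriv ξ s := by
  rw [intervalIntegral.integral_deriv_eq_sub (fun x _ => hξ.differentiable (by simp) x)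
    ((hξ.continuous_deriv (by simp)).intervalIntegrable _ _)]
  ring

theorem primitive_mul_smooth {T A : ℝ} {p ξ : ℝ → ℝ} (hp : IntervalIntegrable p volume 0 T)
    (hξ : ContDiff ℝ (⊤ : ℕ∞) ξ) (hl : ξ T = 0) :
    0 = A * ξ 0 + (∫ t in (0:ℝ)..T, p t * ξ t)
      + ∫ t in (0:ℝ)..T, (A + ∫ s in (0:ℝ)..t, p s) * deriv ξ t := by
  have hd := hξ.continuous_deriv (n := (⊤ : ℕ∞)) (by simp)
  have h := primitive_mul hp (hd.intervalIntegrable 0 T) A (ξ 0)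
  simp only [← smooth_eq_primitive hξ] at h
  have hc : ContinuousOn (fun t => A + ∫ s in (0:ℝ)..t, p s) (uIcc 0 T) :=
    (ac_primitive hp A).continuousOn
  have hi : IntervalIntegrable (fun t => (A + ∫ s in (0:ℝ)..t, p s) * deriv ξ t) volume 0 T :=
    (hc.mul hd.continuousOn).intervalIntegrable
  rw [intervalIntegral.integral_add (hp.mul_continuousOn hξ.continuous.continuousOn) hi, hl, mul_zero] at h
  linarith

/-- Weak solutions of `m' = p`, `m(0) = A` are mild. -/
theorem ode_of_weak {T A : ℝ} (hT : 0 < T) {m p : ℝ → ℝ} (hm : ContinuousOn m (Icc 0 T))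
    (hp : IntervalIntegrable p volume 0 T)
    (h : ∀ χ : ℝ → ℝ, ContDiff ℝ (⊤ : ℕ∞) χ → (∃ T' < T, ∀ t, T' ≤ t → χ t = 0) →
      - (∫ t in (0:ℝ)..T, m t * deriv χ t) - A * χ 0 = ∫ t in (0:ℝ)..T, p t * χ t) :
    ∀ t ∈ Icc 0 T, m t = A + ∫ s in (0:ℝ)..t, p s := by
  have hP : ContinuousOn (fun t => A + ∫ s in (0:ℝ)..t, p s) (Icc 0 T) := by
    have := (ac_primitive hp A).continuousOn
    rwa [uIcc_of_le hT.le] at this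
  have key := eqOn_zero_of_integral_smooth hT (hm.sub hP) (by
    intro ξ h1 h2 h3
    obtain ⟨χ, hχ, hχl, rfl⟩ := exists_late_primitive h1 (late_of_compactSupport hT h2 h3)
    have e1 := h χ hχ hχl
    obtain ⟨T', hT', h0⟩ := hχl
    have e2 := primitive_mul_smooth (A := A) hp hχ (h0 T hT'.le)
    simp_rw [Pi.sub_apply, sub_mul]
    rw [intervalIntegral.integral_sub]
    · linarith
    · exact ((hm.mul h1.continuous.continuousOn).intervalIntegrable_of_Icc hT.le)
    · exact ((hP.mul h1.continuous.continuousOn).intervalIntegrable_of_Icc hT.le))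
  intro t ht
  have := key t ht
  simp only [Pi.sub_apply] at this
  linarith

/-- Weak solutions of `m'' = p`, `m(0) = A`, `m'(0) = B` are mild, with `v = m'`. -/
theorem ode2_of_weak {T A B : ℝ} (hT : 0 < T) {m v p : ℝ → ℝ} (hm : ContinuousOn m (Icc 0 T))
    (hv : ContinuousOn v (Icc 0 T)) (hp : IntervalIntegrable p volume 0 T)
    (hvm : ∀ χ : ℝ → ℝ, ContDiff ℝ (⊤ : ℕ∞) χ → HasCompactSupport χ → tsupport χ ⊆ Ioo 0 T →
      ∫ t in (0:ℝ)..T, m t * deriv χ t = - ∫ t in (0:ℝ)..T, v t * χ t)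
    (h : ∀ χ : ℝ → ℝ, ContDiff ℝ (⊤ : ℕ∞) χ → (∃ T' < T, ∀ t, T' ≤ t → χ t = 0) →
      (∫ t in (0:ℝ)..T, m t * deriv (deriv χ) t) - B * χ 0 + A * deriv χ 0
        = ∫ t in (0:ℝ)..T, p t * χ t) :
    ∀ t ∈ Icc 0 T, v t = B + (∫ s in (0:ℝ)..t, p s) ∧ m t = A + ∫ s in (0:ℝ)..t, v s := by
  set P : ℝ → ℝ := fun t => B + ∫ s in (0:ℝ)..t, p s with hPd
  have hP : ContinuousOn P (Icc 0 T) := by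
    have := (ac_primitive hp B).continuousOn
    rwa [uIcc_of_le hT.le] at this
  have hPi : IntervalIntegrable P volume 0 T := hP.intervalIntegrable_of_Icc hT.le
  set R : ℝ → ℝ := fun t => A + ∫ s in (0:ℝ)..t, P s with hRd
  have hR : ContinuousOn R (Icc 0 T) := by
    have := (ac_primitive hPi A).continuousOn
    rwa [uIcc_of_le hT.le] at this
  have hmR := eqOn_zero_of_integral_smooth hT (hm.sub hR) (by
    intro ξ h1 h2 h3
    obtain ⟨χ', hχ', hχl', rfl⟩ := exists_late_primitive h1 (late_of_compactSupport hT h2 h3)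
    obtain ⟨χ, hχ, hχl, rfl⟩ := exists_late_primitive hχ' hχl'
    have e1 := h χ hχ hχl
    obtain ⟨T', hT', h0⟩ := hχl
    obtain ⟨T'', hT'', h0'⟩ := hχl'
    have e2 := primitive_mul_smooth (A := B) hp hχ (h0 T hT'.le)
    have e3 := primitive_mul_smooth (A := A) hPi hχ' (h0' T hT''.le)
    simp_rw [Pi.sub_apply, sub_mul]
    rw [intervalIntegral.integral_sub]
    · linarith
    · exact ((hm.mul h1.continuous.continuousOn).intervalIntegrable_of_Icc hT.le)
    · exact ((hR.mul h1.continuous.continuousOn).intervalIntegrable_of_Icc hT.le))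
  have hmR' : ∀ t ∈ Icc 0 T, m t = R t := fun t ht => sub_eq_zero.1 (hmR t ht)
  have hvP := eqOn_zero_of_integral_smooth hT (hv.sub hP) (by
    intro ξ h1 h2 h3
    have e1 := hvm ξ h1 h2 h3
    have hξ0 : ξ 0 = 0 := by
      by_contra hne; exact lt_irrefl _ (h3 (subset_tsupport _ hne)).1
    have hξT : ξ T = 0 := by
      by_contra hne; exact lt_irrefl _ (h3 (subset_tsupport _ hne)).2
    have e2 := primitive_mul_smooth (A := A) hPi h1 hξT
    have e3 : ∫ t in (0:ℝ)..T, m t * deriv ξ t = ∫ t in (0:ℝ)..T, R t * deriv ξ t := by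
      apply intervalIntegral.integral_congr
      intro t ht
      rw [uIcc_of_le hT.le] at ht
      simp only [hmR' t ht]
    simp_rw [Pi.sub_apply, sub_mul]
    rw [intervalIntegral.integral_sub]
    · rw [hξ0, mul_zero, zero_add] at e2
      linarith
    · exact ((hv.mul h1.continuous.continuousOn).intervalIntegrable_of_Icc hT.le)
    · exact ((hP.mul h1.continuous.continuousOn).intervalIntegrable_of_Icc hT.le))
  have hvP' : ∀ t ∈ Icc 0 T, v t = P t := fun t ht => sub_eq_zero.1 (hvP t ht)
  intro t ht
  refine ⟨hvP' t ht, ?_⟩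
  rw [hmR' t ht, hRd]
  simp only
  congr 1
  apply intervalIntegral.integral_congr
  intro s hs
  rw [uIcc_of_le ht.1] at hs
  exact (hvP' s ⟨hs.1, hs.2.trans ht.2⟩).symm

/-- Spatial pairing of a space-time function with a profile. -/
def mode (a b : ℝ) (h : ℝ → ℝ → ℝ) (ψ : ℝ → ℝ) (t : ℝ) : ℝ := ∫ x in Ioo a b, h x t * ψ x

/-- Lebesgue measure on the space-time cylinder as a product. -/
abbrev cylM (a b T : ℝ) : Measure (ℝ × ℝ) :=
  (volume.restrict (Ioo a b)).prod (volume.restrict (Ioo 0 T))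

theorem restrict_cylinder (a b T : ℝ) :
    (volume : Measure (ℝ × ℝ)).restrict (Ioo a b ×ˢ Ioo 0 T) = cylM a b T := by
  rw [cylM, Measure.volume_eq_prod, Measure.prod_restrict]

theorem intOmT_eq_cylM (a b T : ℝ) (H : ℝ → ℝ → ℝ) :
    intOmT a b T H = ∫ p, H p.1 p.2 ∂cylM a b T := by
  rw [intOmT, restrict_cylinder]

theorem intOmT_eq_iterated {a b T : ℝ} (hT : 0 ≤ T) {H : ℝ → ℝ → ℝ}
    (h : Integrable (fun p : ℝ × ℝ => H p.1 p.2) (cylM a b T)) :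
    intOmT a b T H = ∫ t in (0:ℝ)..T, ∫ x in Ioo a b, H x t := by
  rw [intOmT_eq_cylM, integral_prod_symm _ h, setIntegral_Ioo_eq hT]

theorem intervalIntegrable_slice {a b T : ℝ} (hT : 0 ≤ T) {H : ℝ → ℝ → ℝ}
    (h : Integrable (fun p : ℝ × ℝ => H p.1 p.2) (cylM a b T)) :
    IntervalIntegrable (fun t => ∫ x in Ioo a b, H x t) volume 0 T :=
  intervalIntegrable_of_Ioo hT h.integral_prod_right

theorem integrable_slice_ae {a b T : ℝ} {H : ℝ → ℝ → ℝ}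
    (h : Integrable (fun p : ℝ × ℝ => H p.1 p.2) (cylM a b T)) :
    ∀ᵐ t ∂volume.restrict (Ioo 0 T), IntegrableOn (fun x => H x t) (Ioo a b) :=
  h.prod_left_ae

theorem ae_mem_cylinder (a b T : ℝ) :
    ∀ᵐ p ∂cylM a b T, p.1 ∈ Ioo a b ∧ p.2 ∈ Ioo 0 T := by
  rw [← restrict_cylinder]
  exact ae_restrict_mem (measurableSet_Ioo.prod measurableSet_Ioo)

theorem integrable_mul_continuous₂ {a b T : ℝ} {H φ : ℝ → ℝ → ℝ}
    (h : Integrable (fun p : ℝ × ℝ => H p.1 p.2) (cylM a b T)) (hφ : Continuous (uncurry φ)) :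
    Integrable (fun p : ℝ × ℝ => H p.1 p.2 * φ p.1 p.2) (cylM a b T) := by
  obtain ⟨C, hC⟩ := ((isCompact_Icc (a := a) (b := b)).prod
    (isCompact_Icc (a := (0:ℝ)) (b := T))).exists_bound_of_continuousOn hφ.continuousOn
  refine h.mul_bdd (c := C) (g := fun p : ℝ × ℝ => φ p.1 p.2) hφ.aestronglyMeasurable ?_
  filter_upwards [ae_mem_cylinder a b T] with p hp
  exact hC p ⟨Ioo_subset_Icc_self hp.1, Ioo_subset_Icc_self hp.2⟩

theorem continuous_uncurry_mul {ψ χ : ℝ → ℝ} (hψ : Continuous ψ) (hχ : Continuous χ) :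
    Continuous (uncurry fun x t => ψ x * χ t) :=
  (hψ.comp continuous_fst).mul (hχ.comp continuous_snd)

theorem intOmT_mul_sep {a b T : ℝ} (hT : 0 ≤ T) {H : ℝ → ℝ → ℝ} {ψ χ : ℝ → ℝ}
    (h : Integrable (fun p : ℝ × ℝ => H p.1 p.2) (cylM a b T)) (hψ : Continuous ψ)
    (hχ : Continuous χ) :
    intOmT a b T (fun x t => H x t * (ψ x * χ t)) = ∫ t in (0:ℝ)..T, mode a b H ψ t * χ t := by
  rw [intOmT_eq_iterated hT (integrable_mul_continuous₂ h (continuous_uncurry_mul hψ hχ))]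
  congr 1
  ext t
  rw [mode, ← integral_mul_const]
  simp_rw [mul_assoc]

theorem intervalIntegrable_mode {a b T : ℝ} (hT : 0 ≤ T) {H : ℝ → ℝ → ℝ} {ψ : ℝ → ℝ}
    (h : Integrable (fun p : ℝ × ℝ => H p.1 p.2) (cylM a b T)) (hψ : Continuous ψ) :
    IntervalIntegrable (mode a b H ψ) volume 0 T := by
  have := intervalIntegrable_slice (H := fun x t => H x t * (ψ x * 1)) hT (integrable_mul_continuous₂ h
    (continuous_uncurry_mul hψ (continuous_const (y := (1:ℝ)))))
  simp only [mul_one] at this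
  exact this

theorem tendsto_mode_integral {a b T : ℝ} (hT : 0 ≤ T) {H : ℝ → ℝ → ℝ} {ψ χ : ℝ → ℝ}
    {Ψ : ℕ → ℝ → ℝ} {C : ℝ}
    (h : Integrable (fun p : ℝ × ℝ => H p.1 p.2) (cylM a b T)) (hψ : Continuous ψ)
    (hΨ : ∀ n, Continuous (Ψ n)) (hχ : Continuous χ) (hC : ∀ n, ∀ x ∈ Ioo a b, |Ψ n x| ≤ C)
    (hl : ∀ x ∈ Ioo a b, ∀ᶠ n in atTop, Ψ n x = ψ x) :
    Tendsto (fun n => ∫ t in (0:ℝ)..T, mode a b H (Ψ n) t * χ t) atTop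
      (nhds (∫ t in (0:ℝ)..T, mode a b H ψ t * χ t)) := by
  simp_rw [← fun n => intOmT_mul_sep hT h (hΨ n) hχ, ← intOmT_mul_sep hT h hψ hχ, intOmT_eq_cylM]
  have hb := integrable_mul_continuous₂ h (continuous_uncurry_mul (continuous_const (y := (1:ℝ))) hχ)
  apply tendsto_integral_of_dominated_convergence (fun p => C * |H p.1 p.2 * (1 * χ p.2)|)
  · exact fun n => (integrable_mul_continuous₂ h
      (continuous_uncurry_mul (hΨ n) hχ)).aestronglyMeasurable
  · exact hb.abs.const_mul C
  · intro n
    filter_upwards [ae_mem_cylinder a b T] with p hp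
    rw [Real.norm_eq_abs, one_mul, abs_mul, abs_mul, abs_mul]
    calc |H p.1 p.2| * (|Ψ n p.1| * |χ p.2|) = |Ψ n p.1| * (|H p.1 p.2| * |χ p.2|) := by ring
      _ ≤ _ := mul_le_mul_of_nonneg_right (hC n _ hp.1) (by positivity)
  · filter_upwards [ae_mem_cylinder a b T] with p hp
    apply tendsto_const_nhds.congr'
    filter_upwards [hl p.1 hp.1] with n hn
    rw [hn]

theorem tendsto_integral_mul_approx {a b : ℝ} {h ψ : ℝ → ℝ} {Ψ : ℕ → ℝ → ℝ} {C : ℝ}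
    (hh : IntegrableOn h (Ioo a b)) (hΨ : ∀ n, Continuous (Ψ n))
    (hC : ∀ n, ∀ x ∈ Ioo a b, |Ψ n x| ≤ C)
    (hl : ∀ x ∈ Ioo a b, ∀ᶠ n in atTop, Ψ n x = ψ x) :
    Tendsto (fun n => ∫ x in Ioo a b, h x * Ψ n x) atTop
      (nhds (∫ x in Ioo a b, h x * ψ x)) := by
  apply tendsto_integral_of_dominated_convergence (fun x => C * |h x|)
  · exact fun n => (integrable_mul_continuous hh (hΨ n)).aestronglyMeasurable
  · exact hh.abs.const_mul C
  · intro n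
    filter_upwards [ae_restrict_mem measurableSet_Ioo] with x hx
    rw [Real.norm_eq_abs, abs_mul, mul_comm]
    exact mul_le_mul_of_nonneg_right (hC n x hx) (abs_nonneg _)
  · filter_upwards [ae_restrict_mem measurableSet_Ioo] with x hx
    apply tendsto_const_nhds.congr'
    filter_upwards [hl x hx] with n hn
    rw [hn]

theorem pdt_sep (ψ χ : ℝ → ℝ) : pdt (fun x t => ψ x * χ t) = fun x t => ψ x * deriv χ t := by
  funext x t
  simp [pdt]

theorem pdx_sep (ψ χ : ℝ → ℝ) : pdx (fun x t => ψ x * χ t) = fun x t => deriv ψ x * χ t := by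
  funext x t
  simp [pdx]

theorem contDiff_sep {ψ χ : ℝ → ℝ} (hψ : ContDiff ℝ (⊤ : ℕ∞) ψ) (hχ : ContDiff ℝ (⊤ : ℕ∞) χ) :
    ContDiff ℝ (⊤ : ℕ∞) (uncurry fun x t => ψ x * χ t) :=
  (hψ.comp contDiff_fst).mul (hχ.comp contDiff_snd)

theorem isCompact_tsupport_of_subset_Ioo {a b : ℝ} {ψ : ℝ → ℝ} (h : tsupport ψ ⊆ Ioo a b) :
    IsCompact (tsupport ψ) :=
  isCompact_Icc.of_isClosed_subset (isClosed_tsupport ψ) (h.trans Ioo_subset_Icc_self)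

theorem eq_zero_of_notMem_tsupport {ψ : ℝ → ℝ} {x : ℝ} (h : x ∉ tsupport ψ) : ψ x = 0 :=
  image_eq_zero_of_notMem_tsupport h

theorem contDiff_deriv {χ : ℝ → ℝ} (hχ : ContDiff ℝ (⊤ : ℕ∞) χ) :
    ContDiff ℝ (⊤ : ℕ∞) (deriv χ) := (contDiff_infty_iff_deriv.1 hχ).2

/-- Weak form of the wave equation with separated test functions vanishing at the boundary. -/
theorem wave_weak_sep {a b T : ℝ} (hab : a < b) (hT : 0 < T) {w wx g : ℝ → ℝ → ℝ} {w0 w1 : ℝ → ℝ}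
    (hw : Integrable (fun p : ℝ × ℝ => w p.1 p.2) (cylM a b T))
    (hwx : Integrable (fun p : ℝ × ℝ => wx p.1 p.2) (cylM a b T))
    (hg : Integrable (fun p : ℝ × ℝ => g p.1 p.2) (cylM a b T))
    (hw0 : IntegrableOn w0 (Ioo a b)) (hw1 : IntegrableOn w1 (Ioo a b))
    (h : ∀ φ : ℝ → ℝ → ℝ, TestU a b T φ →
      intOmT a b T (fun x t => w x t * pdt (pdt φ) x t)
          - intOm a b (fun x => w1 x * φ x 0) + intOm a b (fun x => w0 x * pdt φ x 0)
        = - intOmT a b T (fun x t => wx x t * pdx φ x t)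
          - intOmT a b T (fun x t => g x t * φ x t))
    {ψ χ : ℝ → ℝ} (hψ : ContDiff ℝ (⊤ : ℕ∞) ψ) (ha : ψ a = 0) (hb : ψ b = 0)
    (hχ : ContDiff ℝ (⊤ : ℕ∞) χ) (hl : ∃ T' < T, ∀ t, T' ≤ t → χ t = 0) :
    (∫ t in (0:ℝ)..T, mode a b w ψ t * deriv (deriv χ) t)
        - (∫ x in Ioo a b, w1 x * ψ x) * χ 0 + (∫ x in Ioo a b, w0 x * ψ x) * deriv χ 0
      = - (∫ t in (0:ℝ)..T, mode a b wx (deriv ψ) t * χ t)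
        - ∫ t in (0:ℝ)..T, mode a b g ψ t * χ t := by
  obtain ⟨Ψ, C, hΨ, hs, hbd, hlim⟩ := exists_interior_approx hab hψ ha hb
  have hχ1 := contDiff_deriv hχ
  have hχ2 := contDiff_deriv hχ1
  have key : ∀ n, (∫ t in (0:ℝ)..T, mode a b w (Ψ n) t * deriv (deriv χ) t)
        - (∫ x in Ioo a b, w1 x * Ψ n x) * χ 0 + (∫ x in Ioo a b, w0 x * Ψ n x) * deriv χ 0
      = - (∫ t in (0:ℝ)..T, mode a b wx (deriv (Ψ n)) t * χ t)
        - ∫ t in (0:ℝ)..T, mode a b g (Ψ n) t * χ t := by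
    intro n
    have e := h (fun x t => Ψ n x * χ t) ⟨contDiff_sep (hΨ n) hχ,
      ⟨tsupport (Ψ n), isCompact_tsupport_of_subset_Ioo (hs n), hs n, fun x t hx => by
        rw [eq_zero_of_notMem_tsupport hx, zero_mul]⟩,
      by
        obtain ⟨T', hT', h0⟩ := hl
        exact ⟨T', hT', fun x t ht => by rw [h0 t ht, mul_zero]⟩⟩
    rw [pdt_sep, pdt_sep, pdx_sep, intOmT_mul_sep hT.le hw (hΨ n).continuous hχ2.continuous,
      intOmT_mul_sep hT.le hwx (contDiff_deriv (hΨ n)).continuous hχ.continuous,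
      intOmT_mul_sep hT.le hg (hΨ n).continuous hχ.continuous, intOm, intOm] at e
    simp_rw [← mul_assoc] at e
    rwa [integral_mul_const, integral_mul_const] at e
  have l1 := tendsto_mode_integral hT.le hw hψ.continuous (fun n => (hΨ n).continuous)
    hχ2.continuous (fun n x hx => (hbd n x hx).1) (fun x hx => (hlim x hx).mono fun n hn => hn.1)
  have l2 := tendsto_mode_integral hT.le hwx (contDiff_deriv hψ).continuous
    (fun n => (contDiff_deriv (hΨ n)).continuous)
    hχ.continuous (fun n x hx => (hbd n x hx).2) (fun x hx => (hlim x hx).mono fun n hn => hn.2)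
  have l3 := tendsto_mode_integral hT.le hg hψ.continuous (fun n => (hΨ n).continuous)
    hχ.continuous (fun n x hx => (hbd n x hx).1) (fun x hx => (hlim x hx).mono fun n hn => hn.1)
  have l4 := tendsto_integral_mul_approx hw1 (fun n => (hΨ n).continuous)
    (fun n x hx => (hbd n x hx).1) (fun x hx => (hlim x hx).mono fun n hn => hn.1)
  have l5 := tendsto_integral_mul_approx hw0 (fun n => (hΨ n).continuous)
    (fun n x hx => (hbd n x hx).1) (fun x hx => (hlim x hx).mono fun n hn => hn.1)
  refine tendsto_nhds_unique ((l1.sub (l4.mul_const (χ 0))).add (l5.mul_const (deriv χ 0))) ?_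
  simp_rw [key]
  exact l2.neg.sub l3

/-- Weak time derivatives with separated test functions vanishing at the boundary. -/
theorem time_weak_sep {a b T : ℝ} (hab : a < b) (hT : 0 < T) {w wt : ℝ → ℝ → ℝ}
    (hw : Integrable (fun p : ℝ × ℝ => w p.1 p.2) (cylM a b T))
    (hwt : Integrable (fun p : ℝ × ℝ => wt p.1 p.2) (cylM a b T))
    (h : ∀ φ : ℝ → ℝ → ℝ, TestInt a b T φ →
      intOmT a b T (fun x t => w x t * pdt φ x t) = - intOmT a b T (fun x t => wt x t * φ x t))
    {ψ χ : ℝ → ℝ} (hψ : ContDiff ℝ (⊤ : ℕ∞) ψ) (ha : ψ a = 0) (hb : ψ b = 0)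
    (hχ : ContDiff ℝ (⊤ : ℕ∞) χ) (hc : HasCompactSupport χ) (hl : tsupport χ ⊆ Ioo 0 T) :
    ∫ t in (0:ℝ)..T, mode a b w ψ t * deriv χ t
      = - ∫ t in (0:ℝ)..T, mode a b wt ψ t * χ t := by
  obtain ⟨Ψ, C, hΨ, hs, hbd, hlim⟩ := exists_interior_approx hab hψ ha hb
  have hχ1 := contDiff_deriv hχ
  have key : ∀ n, ∫ t in (0:ℝ)..T, mode a b w (Ψ n) t * deriv χ t
      = - ∫ t in (0:ℝ)..T, mode a b wt (Ψ n) t * χ t := by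
    intro n
    have e := h (fun x t => Ψ n x * χ t) ⟨contDiff_sep (hΨ n) hχ,
      ⟨tsupport (Ψ n), isCompact_tsupport_of_subset_Ioo (hs n), hs n, fun x t hx => by
        rw [eq_zero_of_notMem_tsupport hx, zero_mul]⟩,
      ⟨tsupport χ, hc.isCompact, hl, fun x t ht => by
        rw [eq_zero_of_notMem_tsupport ht, mul_zero]⟩⟩
    rwa [pdt_sep, intOmT_mul_sep hT.le hw (hΨ n).continuous hχ1.continuous,
      intOmT_mul_sep hT.le hwt (hΨ n).continuous hχ.continuous] at e
  have l1 := tendsto_mode_integral hT.le hw hψ.continuous (fun n => (hΨ n).continuous)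
    hχ1.continuous (fun n x hx => (hbd n x hx).1) (fun x hx => (hlim x hx).mono fun n hn => hn.1)
  have l3 := tendsto_mode_integral hT.le hwt hψ.continuous (fun n => (hΨ n).continuous)
    hχ.continuous (fun n x hx => (hbd n x hx).1) (fun x hx => (hlim x hx).mono fun n hn => hn.1)
  refine tendsto_nhds_unique l1 ?_
  simp_rw [key]
  exact l3.neg

/-- Weak form of the heat equation with separated test functions. -/
theorem heat_weak_sep {a b T : ℝ} (hT : 0 < T) {z zx G F : ℝ → ℝ → ℝ} {z0 : ℝ → ℝ}
    (hz : Integrable (fun p : ℝ × ℝ => z p.1 p.2) (cylM a b T))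
    (hzx : Integrable (fun p : ℝ × ℝ => zx p.1 p.2) (cylM a b T))
    (hG : Integrable (fun p : ℝ × ℝ => G p.1 p.2) (cylM a b T))
    (hF : Integrable (fun p : ℝ × ℝ => F p.1 p.2) (cylM a b T))
    (h : ∀ φ : ℝ → ℝ → ℝ, TestT T φ →
      - intOmT a b T (fun x t => z x t * pdt φ x t) - intOm a b (fun x => z0 x * φ x 0)
        = - intOmT a b T (fun x t => zx x t * pdx φ x t)
          + intOmT a b T (fun x t => G x t * φ x t)
          + intOmT a b T (fun x t => F x t * pdx φ x t))
    {ψ χ : ℝ → ℝ} (hψ : ContDiff ℝ (⊤ : ℕ∞) ψ)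
    (hχ : ContDiff ℝ (⊤ : ℕ∞) χ) (hl : ∃ T' < T, ∀ t, T' ≤ t → χ t = 0) :
    - (∫ t in (0:ℝ)..T, mode a b z ψ t * deriv χ t) - (∫ x in Ioo a b, z0 x * ψ x) * χ 0
      = - (∫ t in (0:ℝ)..T, mode a b zx (deriv ψ) t * χ t)
        + (∫ t in (0:ℝ)..T, mode a b G ψ t * χ t)
        + ∫ t in (0:ℝ)..T, mode a b F (deriv ψ) t * χ t := by
  have hψ1 := contDiff_deriv hψ
  have e := h (fun x t => ψ x * χ t) ⟨contDiff_sep hψ hχ, by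
    obtain ⟨T', hT', h0⟩ := hl
    exact ⟨T', hT', fun x t ht => by rw [h0 t ht, mul_zero]⟩⟩
  rw [pdt_sep, pdx_sep, intOmT_mul_sep hT.le hz hψ.continuous (contDiff_deriv hχ).continuous,
    intOmT_mul_sep hT.le hzx hψ1.continuous hχ.continuous,
    intOmT_mul_sep hT.le hF hψ1.continuous hχ.continuous,
    intOmT_mul_sep hT.le hG hψ.continuous hχ.continuous, intOm] at e
  simp_rw [← mul_assoc] at e
  rwa [integral_mul_const] at e

theorem integrable_fun_mul {μ : Measure ℝ} {g h : ℝ → ℝ} (hg : MemLp g 2 μ) (hh : MemLp h 2 μ) :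
    Integrable (fun x => g x * h x) μ := hg.integrable_mul hh

theorem MemL2.memLp {a b : ℝ} {g : ℝ → ℝ} (h : MemL2 a b g) :
    MemLp g 2 (volume.restrict (Ioo a b)) :=
  (memLp_two_iff_integrable_sq h.1).2 h.2

theorem MemL2.sub {a b : ℝ} {g h : ℝ → ℝ} (hg : MemL2 a b g) (hh : MemL2 a b h) :
    MemL2 a b (fun x => g x - h x) :=
  ⟨hg.1.sub hh.1, (hg.memLp.sub hh.memLp).integrable_sq⟩

theorem ContL2.sub {a b : ℝ} {J : Set ℝ} {w v : ℝ → ℝ → ℝ} (hw : ContL2 a b J w)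
    (hv : ContL2 a b J v) : ContL2 a b J (fun x t => w x t - v x t) := by
  refine ⟨fun t ht => (hw.1 t ht).sub (hv.1 t ht), fun t₀ h₀ => ?_⟩
  have hlim := ((hw.2 t₀ h₀).const_mul 2).add ((hv.2 t₀ h₀).const_mul 2)
  rw [mul_zero, add_zero] at hlim
  refine squeeze_zero' (Eventually.of_forall fun t => integral_nonneg fun x => sq_nonneg _) ?_ hlim
  filter_upwards [self_mem_nhdsWithin] with t ht
  have i1 := ((hw.1 t ht).sub (hw.1 t₀ h₀)).2.const_mul 2
  have i2 := ((hv.1 t ht).sub (hv.1 t₀ h₀)).2.const_mul 2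
  rw [← integral_const_mul, ← integral_const_mul, ← integral_add i1 i2]
  refine integral_mono (((hw.1 t ht).sub (hv.1 t ht)).sub ((hw.1 t₀ h₀).sub (hv.1 t₀ h₀))).2
    (i1.add i2) fun x => ?_
  simp only
  nlinarith [sq_nonneg (w x t - w x t₀ + (v x t - v x t₀))]

theorem ContL2.continuousOn_mode {a b : ℝ} {J : Set ℝ} {w : ℝ → ℝ → ℝ} {ψ : ℝ → ℝ}
    (hw : ContL2 a b J w) (hψ : MemLp ψ 2 (volume.restrict (Ioo a b))) :
    ContinuousOn (mode a b w ψ) J := by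
  intro t₀ h₀
  rw [ContinuousWithinAt, tendsto_iff_dist_tendsto_zero]
  have hlim := ((hw.2 t₀ h₀).sqrt).mul_const (√(∫ x in Ioo a b, ψ x ^ 2))
  rw [Real.sqrt_zero, zero_mul] at hlim
  refine squeeze_zero' (Eventually.of_forall fun t => dist_nonneg) ?_ hlim
  filter_upwards [self_mem_nhdsWithin] with t ht
  have e : mode a b w ψ t - mode a b w ψ t₀ = ∫ x in Ioo a b, (w x t - w x t₀) * ψ x := by
    simp_rw [sub_mul]
    rw [integral_sub (integrable_fun_mul (hw.1 t ht).memLp hψ)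
      (integrable_fun_mul (hw.1 t₀ h₀).memLp hψ)]
    rfl
  rw [Real.dist_eq, e]
  exact abs_integral_mul_le ((hw.1 t ht).sub (hw.1 t₀ h₀)).memLp hψ

theorem ContL2.continuousOn_sq {a b : ℝ} {J : Set ℝ} {w : ℝ → ℝ → ℝ}
    (hw : ContL2 a b J w) : ContinuousOn (fun t => ∫ x in Ioo a b, w x t ^ 2) J := by
  intro t₀ h₀
  have hm := hw.continuousOn_mode (hw.1 t₀ h₀).memLp t₀ h₀
  have hlim := ((hw.2 t₀ h₀).add (hm.tendsto.const_mul 2)).sub_const (∫ x in Ioo a b, w x t₀ ^ 2)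
  have hval : (0:ℝ) + 2 * mode a b w (fun x => w x t₀) t₀ - ∫ x in Ioo a b, w x t₀ ^ 2
      = ∫ x in Ioo a b, w x t₀ ^ 2 := by
    have : mode a b w (fun x => w x t₀) t₀ = ∫ x in Ioo a b, w x t₀ ^ 2 := by
      simp [mode, pow_two]
    rw [this]; ring
  rw [hval] at hlim
  refine hlim.congr' ?_
  filter_upwards [self_mem_nhdsWithin] with t ht
  have i1 : IntegrableOn (fun x => (w x t - w x t₀) ^ 2) (Ioo a b) :=
    ((hw.1 t ht).sub (hw.1 t₀ h₀)).2
  have i2 := (integrable_fun_mul (hw.1 t ht).memLp (hw.1 t₀ h₀).memLp).const_mul 2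
  have i3 : IntegrableOn (fun x => (w x t - w x t₀) ^ 2 + 2 * (w x t * w x t₀)) (Ioo a b) :=
    i1.add i2
  rw [mode, ← integral_const_mul, ← integral_add i1 i2, ← integral_sub i3 (hw.1 t₀ h₀).2]
  congr 1
  ext x
  ring

theorem WeakDerivZ.integral_mul_cosB_zero {a b : ℝ} {g g' : ℝ → ℝ} (h : WeakDerivZ a b g g') :
    ∫ x in Ioo a b, g' x * cosB a b 0 x = 0 := by
  have := h _ (contDiff_cosB a b 0)
  rw [deriv_cosB_zero] at this
  simpa using this

theorem WeakDerivZ.integral_mul_cosB_succ {a b : ℝ} {g g' : ℝ → ℝ} (h : WeakDerivZ a b g g')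
    (k : ℕ) :
    ∫ x in Ioo a b, g' x * cosB a b (k + 1) x
      = freq a b k * ∫ x in Ioo a b, g x * sinB a b k x := by
  have := h _ (contDiff_cosB a b (k + 1))
  rw [deriv_cosB] at this
  have e : ∀ x, g x * -(freq a b k * sinB a b k x) = -(freq a b k) * (g x * sinB a b k x) :=
    fun x => by ring
  simp_rw [e] at this
  rw [integral_const_mul] at this
  linarith

theorem WeakDerivZ.tendsto_sum_cosB {a b : ℝ} (hab : a < b) {g g' : ℝ → ℝ}
    (h : WeakDerivZ a b g g') (hg : MemLp g' 2 (volume.restrict (Ioo a b))) :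
    Tendsto (fun n => ∑ k ∈ Finset.range n, (∫ x in Ioo a b, g' x * cosB a b (k + 1) x) ^ 2) atTop
      (nhds (∫ x in Ioo a b, g' x ^ 2)) := by
  have := ((isONB_cosB hab).hasSum_parseval hg hg).tendsto_sum_nat.comp (tendsto_add_atTop_nat 1)
  simp_rw [← pow_two] at this
  refine this.congr fun n => ?_
  simp only [comp_apply]
  rw [Finset.sum_range_succ', h.integral_mul_cosB_zero]
  simp

theorem IsONB.tendsto_sum_sq {μ : Measure ℝ} {e : ℕ → ℝ → ℝ} (he : IsONB μ e) {g : ℝ → ℝ}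
    (hg : MemLp g 2 μ) :
    Tendsto (fun n => ∑ k ∈ Finset.range n, (∫ x, g x * e k x ∂μ) ^ 2) atTop
      (nhds (∫ x, g x ^ 2 ∂μ)) := by
  have := (he.hasSum_parseval hg hg).tendsto_sum_nat
  simpa only [← pow_two] using this

theorem primitive_sq {T A : ℝ} {p m : ℝ → ℝ} (hp : IntervalIntegrable p volume 0 T)
    (hm : ∀ t ∈ Icc 0 T, m t = A + ∫ s in (0:ℝ)..t, p s) :
    ∀ t ∈ Icc 0 T, m t ^ 2 = A ^ 2 + ∫ s in (0:ℝ)..t, 2 * (p s * m s) := by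
  intro t ht
  have hpt : IntervalIntegrable p volume 0 t := hp.mono_set (by
    rw [uIcc_of_le ht.1, uIcc_of_le (ht.1.trans ht.2)]; exact Icc_subset_Icc_right ht.2)
  have := primitive_mul hpt hpt A A
  rw [← hm t ht, ← pow_two, ← pow_two] at this
  rw [this]
  congr 1
  apply intervalIntegral.integral_congr
  intro s hs
  rw [uIcc_of_le ht.1] at hs
  simp only [← hm s ⟨hs.1, hs.2.trans ht.2⟩]
  ring

/-- Energy identity for a forced harmonic oscillator. -/
theorem oscillator_energy {T A B l : ℝ} {m v G : ℝ → ℝ} (hT : 0 ≤ T)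
    (hmc : ContinuousOn m (Icc 0 T)) (hvc : ContinuousOn v (Icc 0 T))
    (hG : IntervalIntegrable G volume 0 T)
    (hv : ∀ t ∈ Icc 0 T, v t = B + ∫ s in (0:ℝ)..t, (-(l * (l * m s)) - G s))
    (hm : ∀ t ∈ Icc 0 T, m t = A + ∫ s in (0:ℝ)..t, v s) :
    ∀ t ∈ Icc 0 T, v t ^ 2 + (l * m t) ^ 2
      = B ^ 2 + (l * A) ^ 2 - 2 * ∫ s in (0:ℝ)..t, G s * v s := by
  intro t ht
  have hmi : IntervalIntegrable m volume 0 T := hmc.intervalIntegrable_of_Icc hT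
  have hvi : IntervalIntegrable v volume 0 T := hvc.intervalIntegrable_of_Icc hT
  have hpi : IntervalIntegrable (fun s => -(l * (l * m s)) - G s) volume 0 T :=
    ((hmi.const_mul l).const_mul l).neg.sub hG
  have hmono : ∀ {h : ℝ → ℝ}, IntervalIntegrable h volume 0 T → IntervalIntegrable h volume 0 t :=
    fun h => h.mono_set (by
      rw [uIcc_of_le ht.1, uIcc_of_le hT]; exact Icc_subset_Icc_right ht.2)
  have e1 := primitive_sq hpi hv t ht
  have e2 := primitive_sq hvi hm t ht
  have hvc' : ContinuousOn v (uIcc 0 T) := by rwa [uIcc_of_le hT]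
  have hmc' : ContinuousOn m (uIcc 0 T) := by rwa [uIcc_of_le hT]
  have i1 : IntervalIntegrable (fun s => 2 * ((-(l * (l * m s)) - G s) * v s)) volume 0 t :=
    hmono ((hpi.mul_continuousOn hvc').const_mul 2)
  have i2 : IntervalIntegrable (fun s => 2 * (v s * m s)) volume 0 t :=
    hmono ((hvi.mul_continuousOn hmc').const_mul 2)
  rw [mul_pow, mul_pow, e1, e2]
  have e3 : (∫ s in (0:ℝ)..t, 2 * ((-(l * (l * m s)) - G s) * v s))
      + l ^ 2 * (∫ s in (0:ℝ)..t, 2 * (v s * m s)) = - (2 * ∫ s in (0:ℝ)..t, G s * v s) := by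
    rw [← intervalIntegral.integral_const_mul, ← intervalIntegral.integral_const_mul,
      ← intervalIntegral.integral_add i1 (i2.const_mul _), ← intervalIntegral.integral_neg]
    congr 1
    ext s
    ring
  linarith

theorem memLp_slice_ae {a b T : ℝ} {g : ℝ → ℝ → ℝ}
    (hg : Integrable (fun p : ℝ × ℝ => g p.1 p.2) (cylM a b T))
    (hg2 : Integrable (fun p : ℝ × ℝ => g p.1 p.2 ^ 2) (cylM a b T)) :
    ∀ᵐ t ∂volume.restrict (Ioo 0 T), MemLp (fun x => g x t) 2 (volume.restrict (Ioo a b)) := by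
  filter_upwards [integrable_slice_ae hg, integrable_slice_ae (H := fun x t => g x t ^ 2) hg2]
    with t h1 h2
  exact (memLp_two_iff_integrable_sq h1.aestronglyMeasurable).2 h2

theorem ae_uIoc_of_ae_Ioo {T t : ℝ} (ht : t ∈ Icc 0 T) {P : ℝ → Prop}
    (h : ∀ᵐ s ∂volume.restrict (Ioo 0 T), P s) : ∀ᵐ s, s ∈ uIoc 0 t → P s := by
  rw [ae_restrict_iff' measurableSet_Ioo] at h
  filter_upwards [h, (measure_singleton (μ := volume) t : volume {t} = 0) |>
    measure_eq_zero_iff_ae_notMem.1] with s hs hst hs'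
  rw [uIoc_of_le ht.1] at hs'
  exact hs ⟨hs'.1, (lt_of_le_of_ne hs'.2 hst).trans_le ht.2⟩

theorem intervalIntegrable_sub_Icc {T t : ℝ} (ht : t ∈ Icc 0 T) {h : ℝ → ℝ}
    (hh : IntervalIntegrable h volume 0 T) : IntervalIntegrable h volume 0 t :=
  hh.mono_set (by
    rw [uIcc_of_le ht.1, uIcc_of_le (ht.1.trans ht.2)]; exact Icc_subset_Icc_right ht.2)

theorem wave_mode_energy {a b T : ℝ} (hab : a < b) (hT : 0 < T) {w wt wx g : ℝ → ℝ → ℝ}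
    {w0 w0x w1 : ℝ → ℝ}
    (hwc : ContL2 a b (Icc 0 T) w) (hwtc : ContL2 a b (Icc 0 T) wt)
    (hW : ∀ t ∈ Icc 0 T, WeakDerivZ a b (fun x => w x t) (fun x => wx x t))
    (hw : Integrable (fun p : ℝ × ℝ => w p.1 p.2) (cylM a b T))
    (hwt : Integrable (fun p : ℝ × ℝ => wt p.1 p.2) (cylM a b T))
    (hwx : Integrable (fun p : ℝ × ℝ => wx p.1 p.2) (cylM a b T))
    (hg : Integrable (fun p : ℝ × ℝ => g p.1 p.2) (cylM a b T))
    (hw0 : IntegrableOn w0 (Ioo a b)) (hw1 : IntegrableOn w1 (Ioo a b))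
    (hW0 : WeakDerivZ a b w0 w0x)
    (hweakt : ∀ φ : ℝ → ℝ → ℝ, TestInt a b T φ →
      intOmT a b T (fun x t => w x t * pdt φ x t) = - intOmT a b T (fun x t => wt x t * φ x t))
    (hweak : ∀ φ : ℝ → ℝ → ℝ, TestU a b T φ →
      intOmT a b T (fun x t => w x t * pdt (pdt φ) x t)
          - intOm a b (fun x => w1 x * φ x 0) + intOm a b (fun x => w0 x * pdt φ x 0)
        = - intOmT a b T (fun x t => wx x t * pdx φ x t)
          - intOmT a b T (fun x t => g x t * φ x t)) (k : ℕ) :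
    ∀ t ∈ Icc 0 T, (∫ x in Ioo a b, wt x t * sinB a b k x) ^ 2
        + (∫ x in Ioo a b, wx x t * cosB a b (k + 1) x) ^ 2
      = (∫ x in Ioo a b, w1 x * sinB a b k x) ^ 2
        + (∫ x in Ioo a b, w0x x * cosB a b (k + 1) x) ^ 2
        - 2 * ∫ s in (0:ℝ)..t, mode a b g (sinB a b k) s * mode a b wt (sinB a b k) s := by
  have hs := contDiff_sinB a b k
  have hsm := memLp_of_continuous (a := a) (b := b) hs.continuous
  have hmc := hwc.continuousOn_mode hsm
  have hvc := hwtc.continuousOn_mode hsm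
  have hGi := intervalIntegrable_mode hT.le hg hs.continuous
  have hXi := intervalIntegrable_mode hT.le hwx (contDiff_deriv hs).continuous
  have hmx : ∀ t ∈ Icc 0 T, mode a b wx (deriv (sinB a b k)) t
      = freq a b k * (freq a b k * mode a b w (sinB a b k) t) := by
    intro t ht
    rw [mode, mode, ← (hW t ht).integral_mul_cosB_succ, deriv_sinB, ← integral_const_mul]
    congr 1
    ext x
    ring
  have hode := ode2_of_weak hT hmc hvc (hXi.neg.sub hGi)
    (fun χ h1 h2 h3 => time_weak_sep hab hT hw hwt hweakt hs (sinB_left a b k)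
      (sinB_right hab k) h1 h2 h3)
    (A := ∫ x in Ioo a b, w0 x * sinB a b k x) (B := ∫ x in Ioo a b, w1 x * sinB a b k x)
    (fun χ h1 h2 => by
      rw [wave_weak_sep hab hT hw hwx hg hw0 hw1 hweak hs (sinB_left a b k) (sinB_right hab k) h1 h2]
      have hχ := h1.continuous.continuousOn (s := uIcc 0 T)
      have i1 : IntervalIntegrable (fun t => -(mode a b wx (deriv (sinB a b k)) t * χ t))
          volume 0 T := (hXi.mul_continuousOn hχ).neg
      have i2 : IntervalIntegrable (fun t => mode a b g (sinB a b k) t * χ t) volume 0 T :=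
        hGi.mul_continuousOn hχ
      rw [← intervalIntegral.integral_neg, ← intervalIntegral.integral_sub i1 i2]
      congr 1
      ext t
      simp only [Pi.neg_apply]
      ring)
  intro t ht
  have := oscillator_energy (l := freq a b k) hT.le hmc hvc hGi (fun s hs => by
      rw [(hode s hs).1]
      congr 1
      apply intervalIntegral.integral_congr
      intro r hr
      rw [uIcc_of_le hs.1] at hr
      simp only [Pi.neg_apply, hmx r ⟨hr.1, hr.2.trans hs.2⟩])
    (fun s hs => (hode s hs).2) t ht
  rw [hW0.integral_mul_cosB_succ, (hW t ht).integral_mul_cosB_succ]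
  exact this

/-- Energy identity for the forced wave equation. -/
theorem wave_energy {a b T : ℝ} (hab : a < b) (hT : 0 < T) {w wt wx g : ℝ → ℝ → ℝ}
    {w0 w0x w1 : ℝ → ℝ}
    (hwc : ContL2 a b (Icc 0 T) w) (hwtc : ContL2 a b (Icc 0 T) wt)
    (hwxc : ContL2 a b (Icc 0 T) wx)
    (hW : ∀ t ∈ Icc 0 T, WeakDerivZ a b (fun x => w x t) (fun x => wx x t))
    (hw : Integrable (fun p : ℝ × ℝ => w p.1 p.2) (cylM a b T))
    (hwt : Integrable (fun p : ℝ × ℝ => wt p.1 p.2) (cylM a b T))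
    (hwx : Integrable (fun p : ℝ × ℝ => wx p.1 p.2) (cylM a b T))
    (hg : Integrable (fun p : ℝ × ℝ => g p.1 p.2) (cylM a b T))
    (hg2 : Integrable (fun p : ℝ × ℝ => g p.1 p.2 ^ 2) (cylM a b T))
    (hw0 : MemL2 a b w0) (hw0x : MemL2 a b w0x) (hw1 : MemL2 a b w1)
    (hW0 : WeakDerivZ a b w0 w0x)
    (hweakt : ∀ φ : ℝ → ℝ → ℝ, TestInt a b T φ →
      intOmT a b T (fun x t => w x t * pdt φ x t) = - intOmT a b T (fun x t => wt x t * φ x t))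
    (hweak : ∀ φ : ℝ → ℝ → ℝ, TestU a b T φ →
      intOmT a b T (fun x t => w x t * pdt (pdt φ) x t)
          - intOm a b (fun x => w1 x * φ x 0) + intOm a b (fun x => w0 x * pdt φ x 0)
        = - intOmT a b T (fun x t => wx x t * pdx φ x t)
          - intOmT a b T (fun x t => g x t * φ x t)) :
    ∀ t ∈ Icc 0 T, (∫ x in Ioo a b, wt x t ^ 2) + (∫ x in Ioo a b, wx x t ^ 2)
      = (∫ x in Ioo a b, w1 x ^ 2) + (∫ x in Ioo a b, w0x x ^ 2)
        - 2 * ∫ s in (0:ℝ)..t, ∫ x in Ioo a b, g x s * wt x s := by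
  intro t ht
  have hS := isONB_sinB hab
  have hsm := fun k => memLp_of_continuous (a := a) (b := b) (contDiff_sinB a b k).continuous
  have hprod : ∀ k, IntervalIntegrable
      (fun s => mode a b g (sinB a b k) s * mode a b wt (sinB a b k) s) volume 0 t := by
    intro k
    refine intervalIntegrable_sub_Icc ht
      ((intervalIntegrable_mode hT.le hg (contDiff_sinB a b k).continuous).mul_continuousOn ?_)
    rw [uIcc_of_le hT.le]
    exact hwtc.continuousOn_mode (hsm k)
  have hlim : Tendsto (fun n => ∫ s in (0:ℝ)..t, ∑ k ∈ Finset.range n,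
      mode a b g (sinB a b k) s * mode a b wt (sinB a b k) s) atTop
      (nhds (∫ s in (0:ℝ)..t, ∫ x in Ioo a b, g x s * wt x s)) := by
    apply intervalIntegral.tendsto_integral_filter_of_dominated_convergence
      (fun s => (∫ x in Ioo a b, g x s ^ 2) + ∫ x in Ioo a b, wt x s ^ 2)
    · refine Eventually.of_forall fun n => ?_
      exact (IntervalIntegrable.sum (Finset.range n) fun k _ => hprod k).def'.aestronglyMeasurable
        |>.congr (ae_of_all _ fun s => by simp)
    · refine Eventually.of_forall fun n => ?_
      filter_upwards [ae_uIoc_of_ae_Ioo ht (memLp_slice_ae hg hg2)] with s h1 h2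
      have h3 : s ∈ Icc 0 T := by
        rw [uIoc_of_le ht.1] at h2
        exact ⟨h2.1.le, h2.2.trans ht.2⟩
      exact hS.abs_sum_le n (h1 h2) (hwtc.1 s h3).memLp
    · refine intervalIntegrable_sub_Icc ht (IntervalIntegrable.add ?_ ?_)
      · exact intervalIntegrable_slice (H := fun x t => g x t ^ 2) hT.le hg2
      · exact hwtc.continuousOn_sq.intervalIntegrable_of_Icc hT.le
    · filter_upwards [ae_uIoc_of_ae_Ioo ht (memLp_slice_ae hg hg2)] with s h1 h2
      have h3 : s ∈ Icc 0 T := by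
        rw [uIoc_of_le ht.1] at h2
        exact ⟨h2.1.le, h2.2.trans ht.2⟩
      exact (hS.hasSum_parseval (h1 h2) (hwtc.1 s h3).memLp).tendsto_sum_nat
  have l1 := hS.tendsto_sum_sq (hwtc.1 t ht).memLp
  have l2 := (hW t ht).tendsto_sum_cosB hab (hwxc.1 t ht).memLp
  have l3 := hS.tendsto_sum_sq hw1.memLp
  have l4 := hW0.tendsto_sum_cosB hab hw0x.memLp
  refine tendsto_nhds_unique (l1.add l2) (((l3.add l4).sub (hlim.const_mul 2)).congr fun n => ?_)
  rw [intervalIntegral.integral_finsetSum fun k _ => hprod k, Finset.mul_sum,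
    ← Finset.sum_add_distrib, ← Finset.sum_add_distrib, ← Finset.sum_sub_distrib]
  refine Finset.sum_congr rfl fun k _ => ?_
  exact (wave_mode_energy hab hT hwc hwtc hW hw hwt hwx hg (hw0.memLp.integrable (by norm_num))
    (hw1.memLp.integrable (by norm_num)) hW0 hweakt hweak k t ht).symm

theorem WeakDerivI.integral_mul_sinB {a b : ℝ} (hab : a < b) {g g' : ℝ → ℝ}
    (h : WeakDerivI a b g g') (hg : IntegrableOn g (Ioo a b)) (hg' : IntegrableOn g' (Ioo a b))
    (k : ℕ) :
    ∫ x in Ioo a b, g' x * sinB a b k x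
      = -(freq a b k * ∫ x in Ioo a b, g x * cosB a b (k + 1) x) := by
  have := h.integral_eq hab hg hg' (contDiff_sinB a b k) (sinB_left a b k) (sinB_right hab k)
  rw [deriv_sinB] at this
  have e : ∀ x, g x * (freq a b k * cosB a b (k + 1) x)
      = freq a b k * (g x * cosB a b (k + 1) x) := fun x => by ring
  simp_rw [e] at this
  rw [integral_const_mul] at this
  linarith

theorem weakDerivI_of_hasDerivAt {a b : ℝ} (hab : a < b) {φ φ' : ℝ → ℝ}
    (h : ∀ x, HasDerivAt φ (φ' x) x) (hc : Continuous φ') : WeakDerivI a b φ φ' := by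
  intro ψ hψ hs
  have hψ' : ∀ x, HasDerivAt ψ (deriv ψ x) x := fun x =>
    (hψ.differentiable (by simp) x).hasDerivAt
  rw [setIntegral_Ioo_eq hab.le, setIntegral_Ioo_eq hab.le]
  rw [intervalIntegral.integral_mul_deriv_eq_deriv_mul (fun x _ => h x) (fun x _ => hψ' x)
    (hc.intervalIntegrable _ _) ((contDiff_deriv hψ).continuous.intervalIntegrable _ _)]
  rw [eq_zero_of_notMem_tsupport (ψ := ψ) (x := a) fun hx => (hs hx).1.ne rfl,
    eq_zero_of_notMem_tsupport (ψ := ψ) (x := b) fun hx => (hs hx).2.ne rfl]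
  simp

theorem WeakDerivI.sub {a b : ℝ} {g g' h h' : ℝ → ℝ}
    (hg : WeakDerivI a b g g') (hh : WeakDerivI a b h h')
    (ig : IntegrableOn g (Ioo a b)) (ig' : IntegrableOn g' (Ioo a b))
    (ih : IntegrableOn h (Ioo a b)) (ih' : IntegrableOn h' (Ioo a b)) :
    WeakDerivI a b (fun x => g x - h x) (fun x => g' x - h' x) := by
  intro ψ hψ hs
  have c1 := (contDiff_deriv hψ).continuous
  have c0 := hψ.continuous
  simp_rw [sub_mul]
  rw [integral_sub (integrable_mul_continuous ig c1) (integrable_mul_continuous ih c1),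
    integral_sub (integrable_mul_continuous ig' c0) (integrable_mul_continuous ih' c0),
    hg ψ hψ hs, hh ψ hψ hs]
  ring

theorem WeakDerivI.proj {a b : ℝ} (hab : a < b) {g g' : ℝ → ℝ}
    (h : WeakDerivI a b g g') (hg : IntegrableOn g (Ioo a b)) (hg' : IntegrableOn g' (Ioo a b))
    (n : ℕ) :
    WeakDerivI a b (onbProj (volume.restrict (Ioo a b)) (cosB a b) (n + 1) g)
      (onbProj (volume.restrict (Ioo a b)) (sinB a b) n g') := by
  apply weakDerivI_of_hasDerivAt hab
  · intro x
    unfold onbProj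
    simp_rw [Finset.sum_range_succ', cosB_zero]
    refine (HasDerivAt.fun_sum (A' := fun k => (∫ x in Ioo a b, g' x * sinB a b k x) * sinB a b k x)
      fun k _ => ?_).add_const _
    refine ((hasDerivAt_cosB a b k x).const_mul _).congr_deriv ?_
    rw [h.integral_mul_sinB hab hg hg']
    ring
  · unfold onbProj
    exact continuous_finsetSum _ fun k _ => continuous_const.mul (contDiff_sinB a b k).continuous

theorem abs_integral_mul_le_of_sq_le {μ : Measure ℝ} {G g : ℝ → ℝ} {B : ℝ} (hG : Integrable G μ)
    (h : ∀ᵐ x ∂μ, g x ^ 2 ≤ B) : |∫ x, G x * g x ∂μ| ≤ (∫ x, |G x| ∂μ) * √B := by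
  rw [← integral_mul_const]
  refine (abs_integral_le_integral_abs).trans (integral_mono_of_nonneg
    (ae_of_all _ fun x => abs_nonneg _) (hG.abs.mul_const _) ?_)
  filter_upwards [h] with x hx
  rw [abs_mul]
  exact mul_le_mul_of_nonneg_left (Real.abs_le_sqrt hx) (abs_nonneg _)

theorem abs_integral_mul_proj_le {a b : ℝ} (hab : a < b) {g g' G : ℝ → ℝ}
    (h : WeakDerivI a b g g') (hg : MemLp g 2 (volume.restrict (Ioo a b)))
    (hg' : MemLp g' 2 (volume.restrict (Ioo a b))) (hG : IntegrableOn G (Ioo a b)) (n : ℕ) :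
    |∫ x in Ioo a b, G x * onbProj (volume.restrict (Ioo a b)) (cosB a b) (n + 1) g x|
      ≤ (∫ x in Ioo a b, |G x|) ^ 2 + (1 / (b - a) + 1) * (∫ x in Ioo a b, g x ^ 2)
        + ∫ x in Ioo a b, g' x ^ 2 := by
  have hC := isONB_cosB hab
  have hS := isONB_sinB hab
  have hw := h.proj hab (hg.integrable (by norm_num)) (hg'.integrable (by norm_num)) n
  refine (abs_integral_mul_le_of_sq_le hG
    (hw.sq_le hab (hC.memLp_proj _ _) (hS.memLp_proj _ _))).trans ?_
  have p1 := hC.proj_sq_le (n + 1) hg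
  have p2 := hS.proj_sq_le n hg'
  set A := ∫ x in Ioo a b, onbProj (volume.restrict (Ioo a b)) (cosB a b) (n + 1) g x ^ 2
  set B := ∫ x in Ioo a b, onbProj (volume.restrict (Ioo a b)) (sinB a b) n g' x ^ 2
  have hA : 0 ≤ A := integral_nonneg fun x => sq_nonneg _
  have hB : 0 ≤ B := integral_nonneg fun x => sq_nonneg _
  have hL : 0 ≤ 1 / (b - a) := by have := sub_pos.2 hab; positivity
  have q := mul_le_mul_of_nonneg_left p1 hL
  have hR : 0 ≤ 1 / (b - a) * A + 2 * (√A * √B) := by positivity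
  nlinarith [sq_nonneg ((∫ x in Ioo a b, |G x|) - √(1 / (b - a) * A + 2 * (√A * √B))),
    Real.sq_sqrt hR, Real.sq_sqrt hA, Real.sq_sqrt hB, sq_nonneg (√A - √B),
    sq_nonneg (∫ x in Ioo a b, |G x|)]

theorem tendsto_integral_mul_proj {a b : ℝ} (hab : a < b) {g g' G : ℝ → ℝ}
    (h : WeakDerivI a b g g') (hg : MemLp g 2 (volume.restrict (Ioo a b)))
    (hg' : MemLp g' 2 (volume.restrict (Ioo a b))) (hG : IntegrableOn G (Ioo a b)) :
    Tendsto (fun n => ∫ x in Ioo a b,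
        G x * onbProj (volume.restrict (Ioo a b)) (cosB a b) (n + 1) g x) atTop
      (nhds (∫ x in Ioo a b, G x * g x)) := by
  have hC := isONB_cosB hab
  have hS := isONB_sinB hab
  have ig : IntegrableOn g (Ioo a b) := hg.integrable (by norm_num)
  have ig' : IntegrableOn g' (Ioo a b) := hg'.integrable (by norm_num)
  rw [tendsto_iff_dist_tendsto_zero]
  have l1 := (hC.tendsto_proj hg).comp (tendsto_add_atTop_nat 1)
  have l2 := hS.tendsto_proj hg'
  have lim := (((l1.const_mul (1 / (b - a))).add
    ((l1.sqrt.mul l2.sqrt).const_mul 2)).sqrt).const_mul (∫ x in Ioo a b, |G x|)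
  simp only [mul_zero, Real.sqrt_zero, add_zero] at lim
  refine squeeze_zero (fun n => dist_nonneg) (fun n => ?_) lim
  have hPc : Continuous (onbProj (volume.restrict (Ioo a b)) (cosB a b) (n + 1) g) := by
    unfold onbProj
    exact continuous_finsetSum _ fun k _ => continuous_const.mul (contDiff_cosB a b k).continuous
  have m1 : MemLp (fun x => g x - onbProj (volume.restrict (Ioo a b)) (cosB a b) (n + 1) g x) 2
    (volume.restrict (Ioo a b)) := hg.sub (hC.memLp_proj _ _)
  have m2 : MemLp (fun x => g' x - onbProj (volume.restrict (Ioo a b)) (sinB a b) n g' x) 2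
    (volume.restrict (Ioo a b)) := hg'.sub (hS.memLp_proj _ _)
  have hw := h.sub (h.proj hab ig ig' n) ig ig' ((hC.memLp_proj _ _).integrable (by norm_num))
    ((hS.memLp_proj _ _).integrable (by norm_num))
  have hsq := hw.sq_le hab m1 m2
  have hGg : IntegrableOn (fun x => G x * g x) (Ioo a b) := by
    refine hG.mul_bdd (c := √(1 / (b - a) * (∫ x in Ioo a b, g x ^ 2) +
      2 * (√(∫ x in Ioo a b, g x ^ 2) * √(∫ x in Ioo a b, g' x ^ 2)))) ig.aestronglyMeasurable ?_
    filter_upwards [h.sq_le hab hg hg'] with x hx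
    exact Real.abs_le_sqrt hx
  rw [dist_comm, Real.dist_eq, ← integral_sub hGg (integrable_mul_continuous hG hPc)]
  simp_rw [← mul_sub]
  exact abs_integral_mul_le_of_sq_le hG hsq

/-- Right-hand side of the ordinary differential equation satisfied by a heat mode. -/
def heatRhs (a b : ℝ) (zx G F : ℝ → ℝ → ℝ) (k : ℕ) (t : ℝ) : ℝ :=
  -mode a b zx (deriv (cosB a b k)) t + mode a b G (cosB a b k) t
    + mode a b F (deriv (cosB a b k)) t

theorem sum_heatRhs {a b : ℝ} (hab : a < b) {z zx G F : ℝ → ℝ → ℝ} {t : ℝ}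
    (h : WeakDerivI a b (fun x => z x t) (fun x => zx x t))
    (hz : MemLp (fun x => z x t) 2 (volume.restrict (Ioo a b)))
    (hzx : MemLp (fun x => zx x t) 2 (volume.restrict (Ioo a b)))
    (hG : IntegrableOn (fun x => G x t) (Ioo a b)) (n : ℕ) :
    ∑ k ∈ Finset.range (n + 1), heatRhs a b zx G F k t * mode a b z (cosB a b k) t
      = - (∑ k ∈ Finset.range n, (∫ x in Ioo a b, zx x t * sinB a b k x) ^ 2)
        + (∑ k ∈ Finset.range n, (∫ x in Ioo a b, F x t * sinB a b k x)
            * ∫ x in Ioo a b, zx x t * sinB a b k x)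
        + ∫ x in Ioo a b, G x t
            * onbProj (volume.restrict (Ioo a b)) (cosB a b) (n + 1) (fun x => z x t) x := by
  have iz : IntegrableOn (fun x => z x t) (Ioo a b) := hz.integrable (by norm_num)
  have izx : IntegrableOn (fun x => zx x t) (Ioo a b) := hzx.integrable (by norm_num)
  rw [IsONB.integral_mul_proj fun k => integrable_mul_continuous hG (contDiff_cosB a b k).continuous,
    Finset.sum_range_succ', Finset.sum_range_succ' _ n, ← Finset.sum_neg_distrib, ← add_assoc,
    ← Finset.sum_add_distrib, ← Finset.sum_add_distrib]
  have hd : ∀ (H : ℝ → ℝ → ℝ) (k : ℕ), mode a b H (deriv (cosB a b (k + 1))) t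
      = -(freq a b k * ∫ x in Ioo a b, H x t * sinB a b k x) := by
    intro H k
    rw [mode, deriv_cosB, ← integral_const_mul, ← integral_neg]
    congr 1; ext x; ring
  congr 1
  · refine Finset.sum_congr rfl fun k _ => ?_
    have e := h.integral_mul_sinB hab iz izx k
    rw [heatRhs, hd, hd, e]
    simp only [mode]
    ring
  · simp [heatRhs, mode, deriv_cosB_zero, mul_comm]

theorem heat_mode_energy {a b T : ℝ} (hT : 0 < T) {z zx G F : ℝ → ℝ → ℝ}
    {z0 : ℝ → ℝ} (hzc : ContL2 a b (Icc 0 T) z)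
    (hz : Integrable (fun p : ℝ × ℝ => z p.1 p.2) (cylM a b T))
    (hzx : Integrable (fun p : ℝ × ℝ => zx p.1 p.2) (cylM a b T))
    (hG : Integrable (fun p : ℝ × ℝ => G p.1 p.2) (cylM a b T))
    (hF : Integrable (fun p : ℝ × ℝ => F p.1 p.2) (cylM a b T))
    (hweak : ∀ φ : ℝ → ℝ → ℝ, TestT T φ →
      - intOmT a b T (fun x t => z x t * pdt φ x t) - intOm a b (fun x => z0 x * φ x 0)
        = - intOmT a b T (fun x t => zx x t * pdx φ x t)
          + intOmT a b T (fun x t => G x t * φ x t)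
          + intOmT a b T (fun x t => F x t * pdx φ x t)) (k : ℕ) :
    IntervalIntegrable (fun s => heatRhs a b zx G F k s * mode a b z (cosB a b k) s) volume 0 T ∧
    ∀ t ∈ Icc 0 T, (∫ x in Ioo a b, z x t * cosB a b k x) ^ 2
      = (∫ x in Ioo a b, z0 x * cosB a b k x) ^ 2
        + 2 * ∫ s in (0:ℝ)..t, heatRhs a b zx G F k s * mode a b z (cosB a b k) s := by
  have hc := contDiff_cosB a b k
  have hmc := hzc.continuousOn_mode (memLp_of_continuous (a := a) (b := b) hc.continuous)
  have hGi := intervalIntegrable_mode hT.le hG hc.continuous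
  have hXi := intervalIntegrable_mode hT.le hzx (contDiff_deriv hc).continuous
  have hFi := intervalIntegrable_mode hT.le hF (contDiff_deriv hc).continuous
  have hq : IntervalIntegrable (heatRhs a b zx G F k) volume 0 T := (hXi.neg.add hGi).add hFi
  refine ⟨hq.mul_continuousOn (by rwa [uIcc_of_le hT.le]), ?_⟩
  have hode := ode_of_weak hT hmc hq (A := ∫ x in Ioo a b, z0 x * cosB a b k x)
    (fun χ h1 h2 => by
      rw [heat_weak_sep hT hz hzx hG hF hweak hc h1 h2]
      have hχ := h1.continuous.continuousOn (s := uIcc 0 T)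
      have i1 : IntervalIntegrable (fun t => -(mode a b zx (deriv (cosB a b k)) t * χ t))
          volume 0 T := (hXi.mul_continuousOn hχ).neg
      have i2 : IntervalIntegrable (fun t => mode a b G (cosB a b k) t * χ t) volume 0 T :=
        hGi.mul_continuousOn hχ
      have i3 : IntervalIntegrable (fun t => mode a b F (deriv (cosB a b k)) t * χ t) volume 0 T :=
        hFi.mul_continuousOn hχ
      rw [← intervalIntegral.integral_neg, ← intervalIntegral.integral_add i1 i2,
        ← intervalIntegral.integral_add (i1.add i2) i3]
      congr 1
      ext t
      simp only [heatRhs]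
      ring)
  intro t ht
  have := primitive_sq hq hode t ht
  rwa [intervalIntegral.integral_const_mul] at this

/-- Energy identity for the forced heat equation. -/
theorem heat_energy {a b T : ℝ} (hab : a < b) (hT : 0 < T) {z zx G F : ℝ → ℝ → ℝ}
    {z0 : ℝ → ℝ} (hzc : ContL2 a b (Icc 0 T) z)
    (hW : ∀ᵐ t ∂volume.restrict (Ioo 0 T), WeakDerivI a b (fun x => z x t) (fun x => zx x t))
    (hz : Integrable (fun p : ℝ × ℝ => z p.1 p.2) (cylM a b T))
    (hzx : Integrable (fun p : ℝ × ℝ => zx p.1 p.2) (cylM a b T))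
    (hzx2 : Integrable (fun p : ℝ × ℝ => zx p.1 p.2 ^ 2) (cylM a b T))
    (hG : Integrable (fun p : ℝ × ℝ => G p.1 p.2) (cylM a b T))
    (hG2 : IntervalIntegrable (fun t => (∫ x in Ioo a b, |G x t|) ^ 2) volume 0 T)
    (hF : Integrable (fun p : ℝ × ℝ => F p.1 p.2) (cylM a b T))
    (hF2 : Integrable (fun p : ℝ × ℝ => F p.1 p.2 ^ 2) (cylM a b T))
    (hz0 : MemL2 a b z0)
    (hweak : ∀ φ : ℝ → ℝ → ℝ, TestT T φ →
      - intOmT a b T (fun x t => z x t * pdt φ x t) - intOm a b (fun x => z0 x * φ x 0)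
        = - intOmT a b T (fun x t => zx x t * pdx φ x t)
          + intOmT a b T (fun x t => G x t * φ x t)
          + intOmT a b T (fun x t => F x t * pdx φ x t)) :
    ∀ t ∈ Icc 0 T, (∫ x in Ioo a b, z x t ^ 2)
      = (∫ x in Ioo a b, z0 x ^ 2)
        + 2 * ∫ s in (0:ℝ)..t, (-(∫ x in Ioo a b, zx x s ^ 2)
          + (∫ x in Ioo a b, F x s * zx x s) + ∫ x in Ioo a b, G x s * z x s) := by
  intro t ht
  have hC := isONB_cosB hab
  have hS := isONB_sinB hab
  have hmode := heat_mode_energy hT hzc hz hzx hG hF hweak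
  have hprod := fun k => intervalIntegrable_sub_Icc ht (hmode k).1
  have hmem : ∀ {s}, s ∈ uIoc 0 t → s ∈ Icc 0 T := by
    intro s hs
    rw [uIoc_of_le ht.1] at hs
    exact ⟨hs.1.le, hs.2.trans ht.2⟩
  have hae : ∀ᵐ s, s ∈ uIoc 0 t → WeakDerivI a b (fun x => z x s) (fun x => zx x s) ∧
      MemLp (fun x => zx x s) 2 (volume.restrict (Ioo a b)) ∧
      MemLp (fun x => F x s) 2 (volume.restrict (Ioo a b)) ∧
      IntegrableOn (fun x => G x s) (Ioo a b) := by
    apply ae_uIoc_of_ae_Ioo ht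
    filter_upwards [hW, memLp_slice_ae hzx hzx2, memLp_slice_ae hF hF2, integrable_slice_ae hG]
      with s h1 h2 h3 h4
    exact ⟨h1, h2, h3, h4⟩
  have hlim : Tendsto (fun n => ∫ s in (0:ℝ)..t, ∑ k ∈ Finset.range (n + 1),
      heatRhs a b zx G F k s * mode a b z (cosB a b k) s) atTop
      (nhds (∫ s in (0:ℝ)..t, (-(∫ x in Ioo a b, zx x s ^ 2)
          + (∫ x in Ioo a b, F x s * zx x s) + ∫ x in Ioo a b, G x s * z x s))) := by
    apply intervalIntegral.tendsto_integral_filter_of_dominated_convergence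
      (fun s => (∫ x in Ioo a b, zx x s ^ 2) + ((∫ x in Ioo a b, F x s ^ 2)
        + ∫ x in Ioo a b, zx x s ^ 2) + ((∫ x in Ioo a b, |G x s|) ^ 2
          + (1 / (b - a) + 1) * (∫ x in Ioo a b, z x s ^ 2) + ∫ x in Ioo a b, zx x s ^ 2))
    · refine Eventually.of_forall fun n => ?_
      exact (IntervalIntegrable.sum (Finset.range (n + 1)) fun k _ => hprod k).def'.aestronglyMeasurable
        |>.congr (ae_of_all _ fun s => by simp)
    · refine Eventually.of_forall fun n => ?_
      filter_upwards [hae] with s h1 h2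
      obtain ⟨w, m1, m2, m3⟩ := h1 h2
      have m0 := (hzc.1 s (hmem h2)).memLp
      rw [sum_heatRhs hab w m0 m1 m3 n, Real.norm_eq_abs]
      refine (abs_add_le _ _).trans (add_le_add ((abs_add_le _ _).trans (add_le_add ?_ ?_)) ?_)
      · rw [abs_neg, abs_of_nonneg (Finset.sum_nonneg fun k _ => sq_nonneg _),
          ← hS.integral_proj_sq]
        exact hS.proj_sq_le n m1
      · exact hS.abs_sum_le n m2 m1
      · exact abs_integral_mul_proj_le hab w m0 m1 m3 n
    · have j1 := intervalIntegrable_slice (H := fun x t => zx x t ^ 2) hT.le hzx2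
      have j2 := intervalIntegrable_slice (H := fun x t => F x t ^ 2) hT.le hF2
      have j3 := (hzc.continuousOn_sq.intervalIntegrable_of_Icc hT.le (μ := volume)).const_mul
        (1 / (b - a) + 1)
      exact intervalIntegrable_sub_Icc ht ((j1.add (j2.add j1)).add ((hG2.add j3).add j1))
    · filter_upwards [hae] with s h1 h2
      obtain ⟨w, m1, m2, m3⟩ := h1 h2
      have m0 := (hzc.1 s (hmem h2)).memLp
      refine (((hS.tendsto_sum_sq m1).neg.add
        (hS.hasSum_parseval m2 m1).tendsto_sum_nat).add
          (tendsto_integral_mul_proj hab w m0 m1 m3)).congr fun n => ?_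
      exact (sum_heatRhs hab w m0 m1 m3 n).symm
  have l1 := (hC.tendsto_sum_sq (hzc.1 t ht).memLp).comp (tendsto_add_atTop_nat 1)
  have l2 := (hC.tendsto_sum_sq hz0.memLp).comp (tendsto_add_atTop_nat 1)
  refine tendsto_nhds_unique l1 ((l2.add (hlim.const_mul 2)).congr fun n => ?_)
  simp only [comp_apply]
  rw [intervalIntegral.integral_finsetSum fun k _ => hprod k, Finset.mul_sum,
    ← Finset.sum_add_distrib]
  exact Finset.sum_congr rfl fun k _ => ((hmode k).2 t ht).symm

theorem abs_sub_le_of_hasDerivWithinAt {f f' : ℝ → ℝ} {M : ℝ}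
    (h : ∀ x ∈ Ici (0 : ℝ), HasDerivWithinAt f (f' x) (Ici 0) x)
    (hM : ∀ x ∈ Ici (0 : ℝ), |f' x| ≤ M) {x y : ℝ} (hx : 0 ≤ x) (hy : 0 ≤ y) :
    |f x - f y| ≤ M * |x - y| :=
  (convex_Ici (0:ℝ)).norm_image_sub_le_of_norm_hasDerivWithin_le h hM hy hx

/-- Uniform bounds for the nonlinearity and its derivative on the half line. -/
structure NonlinBound (f f' : ℝ → ℝ) (M : ℝ) : Prop where
  nonneg : 0 ≤ M
  deriv_le : ∀ x, 0 ≤ x → |f' x| ≤ M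
  le : ∀ x, 0 ≤ x → |f x| ≤ M * x
  lip : ∀ x y, 0 ≤ x → 0 ≤ y → |f x - f y| ≤ M * |x - y|
  lip_deriv : ∀ x y, 0 ≤ x → 0 ≤ y → |f' x - f' y| ≤ M * |x - y|

theorem HypF.exists_bound {f f' f'' : ℝ → ℝ} (hf : HypF f f' f'') : ∃ M, NonlinBound f f' M := by
  obtain ⟨M, hM⟩ := hf.bdd
  have lip : ∀ x y, 0 ≤ x → 0 ≤ y → |f x - f y| ≤ M * |x - y| := fun x y hx hy =>
    abs_sub_le_of_hasDerivWithinAt hf.hasDeriv₁ (fun x hx => (hM x hx).1) hx hy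
  refine ⟨M, (abs_nonneg _).trans (hM 0 self_mem_Ici).1, fun x hx => (hM x hx).1, fun x hx => ?_,
    lip, fun x y hx hy =>
      abs_sub_le_of_hasDerivWithinAt hf.hasDeriv₂ (fun x hx => (hM x hx).2) hx hy⟩
  have := lip x 0 hx le_rfl
  rwa [hf.zero, sub_zero, sub_zero, abs_of_nonneg hx] at this

theorem ae_slice_of_ae {a b T : ℝ} {P : ℝ × ℝ → Prop} (h : ∀ᵐ p ∂cylM a b T, P p) :
    ∀ᵐ t ∂volume.restrict (Ioo 0 T), ∀ᵐ x ∂volume.restrict (Ioo a b), P (x, t) := by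
  have h1 := (Measure.measurePreserving_swap (μ := volume.restrict (Ioo 0 T))
    (ν := volume.restrict (Ioo a b))).quasiMeasurePreserving.ae h
  exact Measure.ae_ae_of_ae_prod h1

theorem integrable_cyl_of_slice_bound {a b T : ℝ} {H : ℝ → ℝ → ℝ} {B : ℝ → ℝ}
    (hH : AEStronglyMeasurable (fun p : ℝ × ℝ => H p.1 p.2) (cylM a b T))
    (hB : IntegrableOn B (Ioo 0 T))
    (h : ∀ᵐ t ∂volume.restrict (Ioo 0 T), IntegrableOn (fun x => H x t) (Ioo a b) ∧
      ∫ x in Ioo a b, |H x t| ≤ B t) :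
    Integrable (fun p : ℝ × ℝ => H p.1 p.2) (cylM a b T) := by
  refine (integrable_prod_iff' hH).2 ⟨h.mono fun t ht => ht.1, hB.mono' ?_ ?_⟩
  · exact hH.norm.prod_swap.integral_prod_right'
  · filter_upwards [h] with t ht
    rw [Real.norm_eq_abs, abs_of_nonneg (integral_nonneg fun x => norm_nonneg _)]
    exact ht.2

/-- Square integrability of the fluxes of a weak solution. -/
structure FluxBound (a b T : ℝ) (f f' : ℝ → ℝ) (ut Θ Θx : ℝ → ℝ → ℝ) : Prop where
  ut_int : Integrable (fun p : ℝ × ℝ => ut p.1 p.2) (cylM a b T)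
  Θ_int : Integrable (fun p : ℝ × ℝ => Θ p.1 p.2) (cylM a b T)
  Θx_int : Integrable (fun p : ℝ × ℝ => Θx p.1 p.2) (cylM a b T)
  Θx_sq : Integrable (fun p : ℝ × ℝ => Θx p.1 p.2 ^ 2) (cylM a b T)
  g_int : Integrable (fun p : ℝ × ℝ => f' (Θ p.1 p.2) * Θx p.1 p.2) (cylM a b T)
  g_sq : Integrable (fun p : ℝ × ℝ => (f' (Θ p.1 p.2) * Θx p.1 p.2) ^ 2) (cylM a b T)
  G_int : Integrable (fun p : ℝ × ℝ => f' (Θ p.1 p.2) * Θx p.1 p.2 * ut p.1 p.2) (cylM a b T)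
  G_sq : IntervalIntegrable
    (fun t => (∫ x in Ioo a b, |f' (Θ x t) * Θx x t * ut x t|) ^ 2) volume 0 T
  F_int : Integrable (fun p : ℝ × ℝ => f (Θ p.1 p.2) * ut p.1 p.2) (cylM a b T)
  F_sq : Integrable (fun p : ℝ × ℝ => (f (Θ p.1 p.2) * ut p.1 p.2) ^ 2) (cylM a b T)
  slice : ∀ᵐ t ∂volume.restrict (Ioo 0 T),
    WeakDerivI a b (fun x => Θ x t) (fun x => Θx x t) ∧
    (∀ᵐ x ∂volume.restrict (Ioo a b), 0 ≤ Θ x t) ∧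
    MemLp (fun x => Θ x t) 2 (volume.restrict (Ioo a b)) ∧
    MemLp (fun x => Θx x t) 2 (volume.restrict (Ioo a b)) ∧
    MemLp (fun x => ut x t) 2 (volume.restrict (Ioo a b))

theorem ContL2.exists_bound {a b T : ℝ} {w : ℝ → ℝ → ℝ} (hw : ContL2 a b (Icc 0 T) w) :
    ∃ C, ∀ t ∈ Icc 0 T, ∫ x in Ioo a b, w x t ^ 2 ≤ C := by
  obtain ⟨C, hC⟩ := isCompact_Icc.exists_bound_of_continuousOn hw.continuousOn_sq
  exact ⟨C, fun t ht => (le_abs_self _).trans (hC t ht)⟩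

theorem integral_abs_mul_le {μ : Measure ℝ} {g h : ℝ → ℝ} (hg : MemLp g 2 μ) (hh : MemLp h 2 μ) :
    ∫ x, |g x| * |h x| ∂μ ≤ √(∫ x, g x ^ 2 ∂μ) * √(∫ x, h x ^ 2 ∂μ) := by
  have := (le_abs_self _).trans (abs_integral_mul_le hg.abs hh.abs)
  simpa only [Pi.abs_apply, sq_abs] using this

theorem IsWeakSol.fluxBound {a b T M : ℝ} (hab : a < b) (hT : 0 < T) {f f' : ℝ → ℝ}
    {u0 u0t Θ0 : ℝ → ℝ} {u ut ux Θ Θx : ℝ → ℝ → ℝ} (hM : NonlinBound f f' M)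
    (hs : IsWeakSol a b T f f' u0 u0t Θ0 u ut ux Θ Θx) (hr : RegT a b T u ut ux Θ Θx) :
    FluxBound a b T f f' ut Θ Θx := by
  have i1 := hs.ut_int
  have i2 := hs.Θ_int
  have i3 := hs.Θx_int
  have i4 := hr.Θx_sq_int
  have i5 := hs.g1_int
  have i6 := hs.g2_int
  have i7 := hs.g3_int
  have hpos := hs.Θ_nonneg
  rw [IntegrableOn, restrict_cylinder] at i1 i2 i3 i4 i5 i6 i7
  rw [restrict_cylinder] at hpos
  obtain ⟨U, hU⟩ := hr.ut_cont.exists_bound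
  obtain ⟨N, hN⟩ := hr.Θ_cont.exists_bound
  have hL : 0 < b - a := sub_pos.2 hab
  have j5 : Integrable (fun p : ℝ × ℝ => (f' (Θ p.1 p.2) * Θx p.1 p.2) ^ 2) (cylM a b T) := by
    refine (i4.const_mul (M ^ 2)).mono' (i5.aestronglyMeasurable.pow 2) ?_
    filter_upwards [hpos] with p hp
    rw [Real.norm_eq_abs, abs_of_nonneg (sq_nonneg _), mul_pow]
    exact mul_le_mul_of_nonneg_right (sq_le_sq' (abs_le.1 (hM.deriv_le _ hp)).1
      (abs_le.1 (hM.deriv_le _ hp)).2) (sq_nonneg _)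
  have hsl : ∀ᵐ t ∂volume.restrict (Ioo 0 T),
      WeakDerivI a b (fun x => Θ x t) (fun x => Θx x t) ∧
      (∀ᵐ x ∂volume.restrict (Ioo a b), 0 ≤ Θ x t) ∧
      MemLp (fun x => Θ x t) 2 (volume.restrict (Ioo a b)) ∧
      MemLp (fun x => Θx x t) 2 (volume.restrict (Ioo a b)) ∧
      MemLp (fun x => ut x t) 2 (volume.restrict (Ioo a b)) := by
    filter_upwards [hs.Θ_W, ae_slice_of_ae hpos, memLp_slice_ae i3 i4,
      ae_restrict_mem measurableSet_Ioo] with t h1 h2 h3 h4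
    exact ⟨h1, h2, (hr.Θ_cont.1 t (Ioo_subset_Icc_self h4)).memLp, h3,
      (hr.ut_cont.1 t (Ioo_subset_Icc_self h4)).memLp⟩
  have s4 := intervalIntegrable_slice (H := fun x t => Θx x t ^ 2) hT.le i4
  have o4 : IntegrableOn (fun t => ∫ x in Ioo a b, Θx x t ^ 2) (Ioo 0 T) := i4.integral_prod_right
  have j6 : IntervalIntegrable
      (fun t => (∫ x in Ioo a b, |f' (Θ x t) * Θx x t * ut x t|) ^ 2) volume 0 T := by
    refine intervalIntegrable_of_Ioo hT.le ((o4.mul_const (M ^ 2 * U)).mono'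
      ((i6.abs.integral_prod_right).aestronglyMeasurable.pow 2) ?_)
    filter_upwards [hsl, ae_restrict_mem measurableSet_Ioo, integrable_slice_ae
      (H := fun x t => f' (Θ x t) * Θx x t * ut x t) i6] with t h1 ht hi
    obtain ⟨w, p, m0, m1, m2⟩ := h1
    have ht := Ioo_subset_Icc_self ht
    rw [Real.norm_eq_abs, abs_of_nonneg (sq_nonneg _)]
    have e1 : ∫ x in Ioo a b, |f' (Θ x t) * Θx x t * ut x t|
        ≤ M * (√(∫ x in Ioo a b, Θx x t ^ 2) * √(∫ x in Ioo a b, ut x t ^ 2)) := by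
      refine le_trans ?_ (mul_le_mul_of_nonneg_left (integral_abs_mul_le m1 m2) hM.nonneg)
      rw [← integral_const_mul]
      refine integral_mono_ae hi.abs ((integrable_fun_mul m1.abs m2.abs).const_mul M) ?_
      filter_upwards [p] with x hx
      rw [abs_mul, abs_mul, mul_assoc]
      exact mul_le_mul_of_nonneg_right (hM.deriv_le _ hx) (by positivity)
    have n1 : 0 ≤ ∫ x in Ioo a b, Θx x t ^ 2 := integral_nonneg fun x => sq_nonneg _
    have n2 : 0 ≤ ∫ x in Ioo a b, ut x t ^ 2 := integral_nonneg fun x => sq_nonneg _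
    have n3 : 0 ≤ ∫ x in Ioo a b, |f' (Θ x t) * Θx x t * ut x t| :=
      integral_nonneg fun x => abs_nonneg _
    refine (pow_le_pow_left₀ n3 e1 2).trans ?_
    rw [mul_pow, mul_pow, Real.sq_sqrt n1, Real.sq_sqrt n2]
    have := mul_le_mul_of_nonneg_left (hU t ht) (mul_nonneg (sq_nonneg M) n1)
    linarith
  have j7 : Integrable (fun p : ℝ × ℝ => (f (Θ p.1 p.2) * ut p.1 p.2) ^ 2) (cylM a b T) := by
    refine integrable_cyl_of_slice_bound (H := fun x t => (f (Θ x t) * ut x t) ^ 2)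
      (B := fun t => M ^ 2 * (1 / (b - a) * N + N + ∫ x in Ioo a b, Θx x t ^ 2) * U)
      (i7.aestronglyMeasurable.pow 2) ?_ ?_
    · exact (((integrable_const (1 / (b - a) * N + N)).add o4).const_mul _).mul_const _
    · filter_upwards [hsl, ae_restrict_mem measurableSet_Ioo, integrable_slice_ae
        (H := fun x t => f (Θ x t) * ut x t) i7] with t h1 ht hi
      obtain ⟨w, p, m0, m1, m2⟩ := h1
      have ht := Ioo_subset_Icc_self ht
      set S := M ^ 2 * (1 / (b - a) * N + N + ∫ x in Ioo a b, Θx x t ^ 2) with hS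
      have n1 : 0 ≤ ∫ x in Ioo a b, Θx x t ^ 2 := integral_nonneg fun x => sq_nonneg _
      have n0 : 0 ≤ ∫ x in Ioo a b, Θ x t ^ 2 := integral_nonneg fun x => sq_nonneg _
      have hN0 := n0.trans (hN t ht)
      have hS0 : 0 ≤ S := by positivity
      have hpt : ∀ᵐ x ∂volume.restrict (Ioo a b), (f (Θ x t) * ut x t) ^ 2 ≤ S * ut x t ^ 2 := by
        filter_upwards [p, w.sq_le hab m0 m1] with x hx h2
        rw [mul_pow]
        refine mul_le_mul_of_nonneg_right ?_ (sq_nonneg _)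
        have h3 := pow_le_pow_left₀ (abs_nonneg _) (hM.le _ hx) 2
        rw [sq_abs, mul_pow] at h3
        refine h3.trans (mul_le_mul_of_nonneg_left (h2.trans ?_) (sq_nonneg M))
        have h4 := mul_le_mul_of_nonneg_left (hN t ht) (by positivity : 0 ≤ 1 / (b - a))
        have h5 := hN t ht
        nlinarith [sq_nonneg (√(∫ x in Ioo a b, Θ x t ^ 2) - √(∫ x in Ioo a b, Θx x t ^ 2)),
          Real.sq_sqrt n1, Real.sq_sqrt n0]
      have hInt : IntegrableOn (fun x => (f (Θ x t) * ut x t) ^ 2) (Ioo a b) := by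
        refine (m2.integrable_sq.const_mul S).mono' (hi.aestronglyMeasurable.pow 2) ?_
        filter_upwards [hpt] with x hx
        rwa [Real.norm_eq_abs, abs_of_nonneg (sq_nonneg _)]
      refine ⟨hInt, ?_⟩
      have : ∫ x in Ioo a b, |(f (Θ x t) * ut x t) ^ 2| ≤ S * ∫ x in Ioo a b, ut x t ^ 2 := by
        rw [← integral_const_mul]
        refine integral_mono_ae hInt.abs (m2.integrable_sq.const_mul S) ?_
        filter_upwards [hpt] with x hx
        rwa [abs_of_nonneg (sq_nonneg _)]
      exact this.trans (mul_le_mul_of_nonneg_left (hU t ht) hS0)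
  exact ⟨i1, i2, i3, i4, i5, j5, i6, j6, i7, j7, hsl⟩

/-- Growth constant in the differential inequality for differences of solutions. -/
def couplingConst (M K L : ℝ) : ℝ :=
  2 * M * (1 / L) + 32 * M ^ 2 + 2 * M + 8 * M ^ 2 + 16 * M ^ 2 * K ^ 2 * (1 / L) ^ 2
    + 16 * M ^ 2 * L + 32 * M ^ 2 * K ^ 2 * (1 / L) + 8192 * M ^ 4 * K ^ 4
    + 2 * M * K * (1 / L) + 32 * M ^ 2 * K ^ 2

theorem couplingConst_nonneg {M K L : ℝ} (hM : 0 ≤ M) (hK : 0 ≤ K) (hL : 0 < L) :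
    0 ≤ couplingConst M K L := by
  unfold couplingConst
  positivity

theorem coupling_absorb {M K L r w n y Z H : ℝ} (hM : 0 ≤ M) (hK : 0 ≤ K) (hL : 0 < L)
    (hr : 0 ≤ r) (hZ : Z ^ 2 ≤ 1 / L * n ^ 2 + 2 * (n * y)) (hH : H = 1 / L * K + √L * r) :
    2 * (M * Z * (r * w) + M * (y * w)) + 2 * (M * H * (w * y) + M * Z * (K * y))
      + 2 * (M * Z * (r * w) + M * Z ^ 2 * (r * K) + M * Z * (y * K))
      ≤ y ^ 2 + couplingConst M K L * (1 + r ^ 2) * (w ^ 2 + n ^ 2) := by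
  have hl : 0 ≤ 1 / L := by positivity
  unfold couplingConst
  set l := 1 / L
  have hH2 : H ^ 2 ≤ 2 * (l ^ 2 * K ^ 2) + 2 * (L * r ^ 2) := by
    have := Real.sq_sqrt hL.le
    rw [hH]
    nlinarith [sq_nonneg (l * K - √L * r)]
  set D := (1 + r ^ 2) * (w ^ 2 + n ^ 2) with hD
  have d1 : w ^ 2 ≤ D := by
    nlinarith [mul_nonneg (sq_nonneg r) (sq_nonneg w),
      mul_nonneg (sq_nonneg r) (sq_nonneg n), sq_nonneg n]
  have d2 : n ^ 2 ≤ D := by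
    nlinarith [mul_nonneg (sq_nonneg r) (sq_nonneg w),
      mul_nonneg (sq_nonneg r) (sq_nonneg n), sq_nonneg w]
  have d3 : r ^ 2 * w ^ 2 ≤ D := by
    nlinarith [sq_nonneg w,
      mul_nonneg (sq_nonneg r) (sq_nonneg n), sq_nonneg n]
  have d4 : r ^ 2 * n ^ 2 ≤ D := by
    nlinarith [sq_nonneg w,
      mul_nonneg (sq_nonneg r) (sq_nonneg w), sq_nonneg n]
  have d5 : r * n ^ 2 ≤ D := by
    have : r ≤ 1 + r ^ 2 := by nlinarith [sq_nonneg (r - 1)]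
    have := mul_le_mul_of_nonneg_right this (sq_nonneg n)
    nlinarith [mul_nonneg (sq_nonneg r) (sq_nonneg w), sq_nonneg w]
  have t1 : 4 * M * Z * r * w ≤ 2 * M * l * D + y ^ 2 / 8 + 32 * M ^ 2 * D + 2 * M * D := by
    have e1 : 4 * M * Z * r * w ≤ 2 * M * Z ^ 2 + 2 * M * (r ^ 2 * w ^ 2) := by
      linarith [mul_nonneg hM (sq_nonneg (Z - r * w))]
    have e2 := mul_le_mul_of_nonneg_left hZ (by positivity : 0 ≤ 2 * M)
    have e3 := mul_le_mul_of_nonneg_left d2 (by positivity : 0 ≤ 2 * M * l)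
    have e4 := mul_le_mul_of_nonneg_left d3 (by positivity : 0 ≤ 2 * M)
    have e5 := mul_le_mul_of_nonneg_left d2 (by positivity : 0 ≤ 32 * M ^ 2)
    linarith [sq_nonneg (y - 16 * M * n)]
  have t2 : 2 * M * y * w ≤ y ^ 2 / 8 + 8 * M ^ 2 * D := by
    have e5 := mul_le_mul_of_nonneg_left d1 (by positivity : 0 ≤ 8 * M ^ 2)
    linarith [sq_nonneg (y - 8 * M * w)]
  have t3 : 2 * M * H * w * y ≤ y ^ 2 / 8 + 16 * M ^ 2 * K ^ 2 * l ^ 2 * D + 16 * M ^ 2 * L * D := by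
    have e1 : 2 * M * H * w * y ≤ y ^ 2 / 8 + 8 * M ^ 2 * w ^ 2 * H ^ 2 := by
      linarith [sq_nonneg (y - 8 * M * H * w)]
    have e2 := mul_le_mul_of_nonneg_left hH2 (by positivity : 0 ≤ 8 * M ^ 2 * w ^ 2)
    have e3 := mul_le_mul_of_nonneg_left d1 (by positivity : 0 ≤ 16 * M ^ 2 * K ^ 2 * l ^ 2)
    have e4 := mul_le_mul_of_nonneg_left d3 (by positivity : 0 ≤ 16 * M ^ 2 * L)
    linarith
  have t4 : 4 * M * K * Z * y ≤ y ^ 2 / 8 + 32 * M ^ 2 * K ^ 2 * l * D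
      + y ^ 2 / 8 + 8192 * M ^ 4 * K ^ 4 * D := by
    have e1 : 4 * M * K * Z * y ≤ y ^ 2 / 8 + 32 * M ^ 2 * K ^ 2 * Z ^ 2 := by
      linarith [sq_nonneg (y - 16 * M * K * Z)]
    have e2 := mul_le_mul_of_nonneg_left hZ (by positivity : 0 ≤ 32 * M ^ 2 * K ^ 2)
    have e3 := mul_le_mul_of_nonneg_left d2 (by positivity : 0 ≤ 32 * M ^ 2 * K ^ 2 * l)
    have e4 := mul_le_mul_of_nonneg_left d2 (by positivity : 0 ≤ 8192 * M ^ 4 * K ^ 4)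
    have e5 : 64 * M ^ 2 * K ^ 2 * (n * y) ≤ y ^ 2 / 8 + 8192 * M ^ 4 * K ^ 4 * n ^ 2 := by
      linarith [sq_nonneg (y - 256 * M ^ 2 * K ^ 2 * n)]
    linarith
  have t5 : 2 * M * K * r * Z ^ 2 ≤ 2 * M * K * l * D + y ^ 2 / 8 + 32 * M ^ 2 * K ^ 2 * D := by
    have e2 := mul_le_mul_of_nonneg_left hZ (by positivity : 0 ≤ 2 * M * K * r)
    have e3 := mul_le_mul_of_nonneg_left d5 (by positivity : 0 ≤ 2 * M * K * l)
    have e4 := mul_le_mul_of_nonneg_left d4 (by positivity : 0 ≤ 32 * M ^ 2 * K ^ 2)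
    have e5 : 4 * M * K * r * (n * y) ≤ y ^ 2 / 8 + 32 * M ^ 2 * K ^ 2 * (r ^ 2 * n ^ 2) := by
      linarith [sq_nonneg (y - 16 * M * K * r * n)]
    linarith
  rw [mul_assoc _ (1 + r ^ 2) (w ^ 2 + n ^ 2), ← hD]
  linarith [sq_nonneg y]

theorem abs_integral_le_of_ae_le {μ : Measure ℝ} {h k : ℝ → ℝ} (hk : Integrable k μ)
    (hle : ∀ᵐ x ∂μ, |h x| ≤ k x) : |∫ x, h x ∂μ| ≤ ∫ x, k x ∂μ :=
  abs_integral_le_integral_abs.trans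
    (integral_mono_of_nonneg (ae_of_all _ fun _ => abs_nonneg _) hk hle)

/-- Estimate of the coupling terms at a fixed time. -/
theorem coupling_slice_le {a b M K : ℝ} (hab : a < b) (hK : 0 ≤ K) {f f' : ℝ → ℝ}
    (hM : NonlinBound f f' M) {θ θx θh θhx v vh : ℝ → ℝ}
    (hw : WeakDerivI a b θ θx) (hwh : WeakDerivI a b θh θhx)
    (hp : ∀ᵐ x ∂volume.restrict (Ioo a b), 0 ≤ θ x)
    (hph : ∀ᵐ x ∂volume.restrict (Ioo a b), 0 ≤ θh x)
    (m1 : MemLp θ 2 (volume.restrict (Ioo a b))) (m2 : MemLp θx 2 (volume.restrict (Ioo a b)))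
    (m3 : MemLp v 2 (volume.restrict (Ioo a b))) (n1 : MemLp θh 2 (volume.restrict (Ioo a b)))
    (n2 : MemLp θhx 2 (volume.restrict (Ioo a b))) (n3 : MemLp vh 2 (volume.restrict (Ioo a b)))
    (hv : √(∫ x in Ioo a b, vh x ^ 2) ≤ K) (hθ : ∫ x in Ioo a b, |θ x| ≤ K) :
    -2 * (∫ x in Ioo a b, (f' (θ x) * θx x - f' (θh x) * θhx x) * (v x - vh x))
      + 2 * (∫ x in Ioo a b, (f (θ x) * v x - f (θh x) * vh x) * (θx x - θhx x))
      + 2 * (∫ x in Ioo a b, (f' (θ x) * θx x * v x - f' (θh x) * θhx x * vh x) * (θ x - θh x))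
    ≤ (∫ x in Ioo a b, (θx x - θhx x) ^ 2)
      + couplingConst M K (b - a) * (1 + ∫ x in Ioo a b, θx x ^ 2)
        * ((∫ x in Ioo a b, (v x - vh x) ^ 2) + ∫ x in Ioo a b, (θ x - θh x) ^ 2) := by
  have hL : 0 < b - a := sub_pos.2 hab
  have hM0 := hM.nonneg
  have k1 : MemLp (fun x => θ x - θh x) 2 (volume.restrict (Ioo a b)) := m1.sub n1
  have k2 : MemLp (fun x => θx x - θhx x) 2 (volume.restrict (Ioo a b)) := m2.sub n2
  have k3 : MemLp (fun x => v x - vh x) 2 (volume.restrict (Ioo a b)) := m3.sub n3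
  have i1 : IntegrableOn θ (Ioo a b) := m1.integrable (by norm_num)
  have hz := (hw.sub hwh i1 (m2.integrable (by norm_num)) (n1.integrable (by norm_num))
    (n2.integrable (by norm_num))).sq_le hab k1 k2
  have hb := hw.abs_le hab i1 m2
  have sq0 : ∀ {h : ℝ → ℝ}, 0 ≤ ∫ x in Ioo a b, h x ^ 2 := integral_nonneg fun _ => sq_nonneg _
  set r := √(∫ x in Ioo a b, θx x ^ 2) with hr
  set w := √(∫ x in Ioo a b, (v x - vh x) ^ 2) with hw'
  set n := √(∫ x in Ioo a b, (θ x - θh x) ^ 2) with hn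
  set y := √(∫ x in Ioo a b, (θx x - θhx x) ^ 2) with hy
  have r2 : ∫ x in Ioo a b, θx x ^ 2 = r ^ 2 := (Real.sq_sqrt sq0).symm
  have w2 : ∫ x in Ioo a b, (v x - vh x) ^ 2 = w ^ 2 := (Real.sq_sqrt sq0).symm
  have n2' : ∫ x in Ioo a b, (θ x - θh x) ^ 2 = n ^ 2 := (Real.sq_sqrt sq0).symm
  have y2 : ∫ x in Ioo a b, (θx x - θhx x) ^ 2 = y ^ 2 := (Real.sq_sqrt sq0).symm
  have hr0 : 0 ≤ r := Real.sqrt_nonneg _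
  have hw0 : 0 ≤ w := Real.sqrt_nonneg _
  have hn0 : 0 ≤ n := Real.sqrt_nonneg _
  have hy0 : 0 ≤ y := Real.sqrt_nonneg _
  rw [n2'] at hz
  set Z := √(1 / (b - a) * n ^ 2 + 2 * (n * y)) with hZ
  have hZ0 : 0 ≤ Z := Real.sqrt_nonneg _
  have hZ2 : Z ^ 2 ≤ 1 / (b - a) * n ^ 2 + 2 * (n * y) :=
    (Real.sq_sqrt (by positivity)).le
  set H := 1 / (b - a) * K + √(b - a) * r with hH
  have hH0 : 0 ≤ H := by positivity
  have hpt : ∀ᵐ x ∂volume.restrict (Ioo a b),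
      |f' (θ x) * θx x - f' (θh x) * θhx x| ≤ M * Z * |θx x| + M * |θx x - θhx x| ∧
      |f (θ x) * v x - f (θh x) * vh x| ≤ M * H * |v x - vh x| + M * Z * |vh x| ∧
      |f' (θ x) * θx x * v x - f' (θh x) * θhx x * vh x|
        ≤ M * |θx x| * |v x - vh x| + (M * Z * |θx x| + M * |θx x - θhx x|) * |vh x| ∧
      |θ x - θh x| ≤ Z := by
    filter_upwards [hz, hb, hp, hph] with x hz hb hp hph
    have z1 : |θ x - θh x| ≤ Z := Real.abs_le_sqrt hz
    have f1 : |f' (θ x) - f' (θh x)| ≤ M * Z :=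
      (hM.lip_deriv _ _ hp hph).trans (mul_le_mul_of_nonneg_left z1 hM0)
    have f2 : |f (θ x) - f (θh x)| ≤ M * Z :=
      (hM.lip _ _ hp hph).trans (mul_le_mul_of_nonneg_left z1 hM0)
    have f3 : |f (θ x)| ≤ M * H := by
      refine (hM.le _ hp).trans (mul_le_mul_of_nonneg_left ?_ hM0)
      refine (le_abs_self _).trans (hb.trans ?_)
      have := mul_le_mul_of_nonneg_left hθ (by positivity : 0 ≤ 1 / (b - a))
      linarith
    have g1 : |f' (θ x) * θx x - f' (θh x) * θhx x| ≤ M * Z * |θx x| + M * |θx x - θhx x| := by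
      have e : f' (θ x) * θx x - f' (θh x) * θhx x
          = (f' (θ x) - f' (θh x)) * θx x + f' (θh x) * (θx x - θhx x) := by ring
      rw [e]
      refine (abs_add_le _ _).trans (add_le_add ?_ ?_) <;> rw [abs_mul]
      · exact mul_le_mul_of_nonneg_right f1 (abs_nonneg _)
      · exact mul_le_mul_of_nonneg_right (hM.deriv_le _ hph) (abs_nonneg _)
    refine ⟨g1, ?_, ?_, z1⟩
    · have e : f (θ x) * v x - f (θh x) * vh x
          = f (θ x) * (v x - vh x) + (f (θ x) - f (θh x)) * vh x := by ring
      rw [e]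
      refine (abs_add_le _ _).trans (add_le_add ?_ ?_) <;> rw [abs_mul]
      · exact mul_le_mul_of_nonneg_right f3 (abs_nonneg _)
      · exact mul_le_mul_of_nonneg_right f2 (abs_nonneg _)
    · have e : f' (θ x) * θx x * v x - f' (θh x) * θhx x * vh x
          = f' (θ x) * θx x * (v x - vh x) + (f' (θ x) * θx x - f' (θh x) * θhx x) * vh x := by
        ring
      rw [e]
      refine (abs_add_le _ _).trans (add_le_add ?_ ?_) <;> rw [abs_mul]
      · rw [abs_mul]
        exact mul_le_mul_of_nonneg_right
          (mul_le_mul_of_nonneg_right (hM.deriv_le _ hp) (abs_nonneg _)) (abs_nonneg _)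
      · exact mul_le_mul_of_nonneg_right g1 (abs_nonneg _)
  have c1 := integrable_fun_mul m2.abs k3.abs
  have c2 := integrable_fun_mul k2.abs k3.abs
  have c3 := integrable_fun_mul k3.abs k2.abs
  have c4 := integrable_fun_mul n3.abs k2.abs
  have c5 := integrable_fun_mul m2.abs n3.abs
  have c6 := integrable_fun_mul k2.abs n3.abs
  simp only [Pi.abs_apply] at c1 c2 c3 c4 c5 c6
  have b1 : ∫ x in Ioo a b, |θx x| * |v x - vh x| ≤ r * w := integral_abs_mul_le m2 k3
  have b2 : ∫ x in Ioo a b, |θx x - θhx x| * |v x - vh x| ≤ y * w := integral_abs_mul_le k2 k3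
  have b3 : ∫ x in Ioo a b, |v x - vh x| * |θx x - θhx x| ≤ w * y := integral_abs_mul_le k3 k2
  have b4 : ∫ x in Ioo a b, |vh x| * |θx x - θhx x| ≤ K * y :=
    (integral_abs_mul_le n3 k2).trans (mul_le_mul_of_nonneg_right hv hy0)
  have b5 : ∫ x in Ioo a b, |θx x| * |vh x| ≤ r * K :=
    (integral_abs_mul_le m2 n3).trans (mul_le_mul_of_nonneg_left hv hr0)
  have b6 : ∫ x in Ioo a b, |θx x - θhx x| * |vh x| ≤ y * K :=
    (integral_abs_mul_le k2 n3).trans (mul_le_mul_of_nonneg_left hv hy0)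
  have I1 : |∫ x in Ioo a b, (f' (θ x) * θx x - f' (θh x) * θhx x) * (v x - vh x)|
      ≤ M * Z * (r * w) + M * (y * w) := by
    refine (abs_integral_le_of_ae_le (k := fun x => M * Z * (|θx x| * |v x - vh x|)
      + M * (|θx x - θhx x| * |v x - vh x|)) ((c1.const_mul _).add (c2.const_mul _)) ?_).trans ?_
    · filter_upwards [hpt] with x hx
      rw [abs_mul]
      refine (mul_le_mul_of_nonneg_right hx.1 (abs_nonneg _)).trans_eq (by ring)
    · rw [integral_add (c1.const_mul _) (c2.const_mul _), integral_const_mul, integral_const_mul]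
      gcongr
  have I2 : |∫ x in Ioo a b, (f (θ x) * v x - f (θh x) * vh x) * (θx x - θhx x)|
      ≤ M * H * (w * y) + M * Z * (K * y) := by
    refine (abs_integral_le_of_ae_le (k := fun x => M * H * (|v x - vh x| * |θx x - θhx x|)
      + M * Z * (|vh x| * |θx x - θhx x|)) ((c3.const_mul _).add (c4.const_mul _)) ?_).trans ?_
    · filter_upwards [hpt] with x hx
      rw [abs_mul]
      refine (mul_le_mul_of_nonneg_right hx.2.1 (abs_nonneg _)).trans_eq (by ring)
    · rw [integral_add (c3.const_mul _) (c4.const_mul _), integral_const_mul, integral_const_mul]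
      gcongr
  have I3 : |∫ x in Ioo a b,
        (f' (θ x) * θx x * v x - f' (θh x) * θhx x * vh x) * (θ x - θh x)|
      ≤ M * Z * (r * w) + M * Z ^ 2 * (r * K) + M * Z * (y * K) := by
    refine (abs_integral_le_of_ae_le (k := fun x => M * Z * (|θx x| * |v x - vh x|)
      + M * Z ^ 2 * (|θx x| * |vh x|) + M * Z * (|θx x - θhx x| * |vh x|))
      (((c1.const_mul _).add (c5.const_mul _)).add (c6.const_mul _)) ?_).trans ?_
    · filter_upwards [hpt] with x hx
      rw [abs_mul]
      refine (mul_le_mul hx.2.2.1 hx.2.2.2 (abs_nonneg _) (by positivity)).trans_eq (by ring)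
    · have c15 : IntegrableOn (fun x => M * Z * (|θx x| * |v x - vh x|)
          + M * Z ^ 2 * (|θx x| * |vh x|)) (Ioo a b) := (c1.const_mul _).add (c5.const_mul _)
      rw [integral_add c15 (c6.const_mul _),
        integral_add (c1.const_mul _) (c5.const_mul _), integral_const_mul, integral_const_mul,
        integral_const_mul]
      gcongr
  have := coupling_absorb (w := w) hM0 hK hL hr0 hZ2 hH
  rw [y2, r2, w2, n2']
  linarith [neg_abs_le (∫ x in Ioo a b, (f' (θ x) * θx x - f' (θh x) * θhx x) * (v x - vh x)),
    le_abs_self (∫ x in Ioo a b, (f (θ x) * v x - f (θh x) * vh x) * (θx x - θhx x)),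
    le_abs_self (∫ x in Ioo a b,
      (f' (θ x) * θx x * v x - f' (θh x) * θhx x * vh x) * (θ x - θh x))]

theorem contDiff_pdt {φ : ℝ → ℝ → ℝ} (h : ContDiff ℝ (⊤ : ℕ∞) (uncurry φ)) :
    ContDiff ℝ (⊤ : ℕ∞) (uncurry (pdt φ)) := by
  have e : uncurry (pdt φ) = fun p => fderiv ℝ (uncurry φ) p (0, 1) := by
    ext ⟨x, t⟩
    have h1 : HasDerivAt (fun s : ℝ => (x, s)) ((0 : ℝ), (1 : ℝ)) t :=
      (hasDerivAt_const t x).prodMk (hasDerivAt_id t)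
    exact ((h.differentiable (by simp) (x, t)).hasFDerivAt.comp_hasDerivAt t h1).deriv
  rw [e]
  exact (h.fderiv_right (m := (⊤ : ℕ∞)) (by simp)).clm_apply contDiff_const

theorem contDiff_pdx {φ : ℝ → ℝ → ℝ} (h : ContDiff ℝ (⊤ : ℕ∞) (uncurry φ)) :
    ContDiff ℝ (⊤ : ℕ∞) (uncurry (pdx φ)) := by
  have e : uncurry (pdx φ) = fun p => fderiv ℝ (uncurry φ) p (1, 0) := by
    ext ⟨x, t⟩
    have h1 : HasDerivAt (fun s : ℝ => (s, t)) ((1 : ℝ), (0 : ℝ)) x :=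
      (hasDerivAt_id x).prodMk (hasDerivAt_const x t)
    exact ((h.differentiable (by simp) (x, t)).hasFDerivAt.comp_hasDerivAt x h1).deriv
  rw [e]
  exact (h.fderiv_right (m := (⊤ : ℕ∞)) (by simp)).clm_apply contDiff_const

theorem intOmT_sub_mul {a b T : ℝ} {A B φ : ℝ → ℝ → ℝ}
    (hA : Integrable (fun p : ℝ × ℝ => A p.1 p.2) (cylM a b T))
    (hB : Integrable (fun p : ℝ × ℝ => B p.1 p.2) (cylM a b T)) (hφ : Continuous (uncurry φ)) :
    intOmT a b T (fun x t => (A x t - B x t) * φ x t)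
      = intOmT a b T (fun x t => A x t * φ x t) - intOmT a b T (fun x t => B x t * φ x t) := by
  simp_rw [intOmT_eq_cylM, sub_mul]
  exact integral_sub (integrable_mul_continuous₂ hA hφ) (integrable_mul_continuous₂ hB hφ)

theorem intOm_sub_mul {a b : ℝ} {A B φ : ℝ → ℝ} (hA : MemL2 a b A) (hB : MemL2 a b B)
    (hφ : Continuous φ) :
    intOm a b (fun x => (A x - B x) * φ x)
      = intOm a b (fun x => A x * φ x) - intOm a b (fun x => B x * φ x) := by
  simp_rw [intOm, sub_mul]
  exact integral_sub (integrable_mul_continuous (hA.memLp.integrable (by norm_num)) hφ)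
    (integrable_mul_continuous (hB.memLp.integrable (by norm_num)) hφ)

theorem WeakDerivZ.sub {a b : ℝ} {g g' h h' : ℝ → ℝ}
    (hg : WeakDerivZ a b g g') (hh : WeakDerivZ a b h h')
    (ig : MemL2 a b g) (ig' : MemL2 a b g') (ih : MemL2 a b h) (ih' : MemL2 a b h') :
    WeakDerivZ a b (fun x => g x - h x) (fun x => g' x - h' x) := by
  intro ψ hψ
  have e1 := intOm_sub_mul ig ih (contDiff_deriv hψ).continuous
  have e2 := intOm_sub_mul ig' ih' hψ.continuous
  simp only [intOm] at e1 e2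
  rw [e1, e2, hg ψ hψ, hh ψ hψ]
  ring

theorem integrable_cyl_sub_sq {a b T : ℝ} {A B : ℝ → ℝ → ℝ}
    (hA : Integrable (fun p : ℝ × ℝ => A p.1 p.2) (cylM a b T))
    (hB : Integrable (fun p : ℝ × ℝ => B p.1 p.2) (cylM a b T))
    (hA2 : Integrable (fun p : ℝ × ℝ => A p.1 p.2 ^ 2) (cylM a b T))
    (hB2 : Integrable (fun p : ℝ × ℝ => B p.1 p.2 ^ 2) (cylM a b T)) :
    Integrable (fun p : ℝ × ℝ => (A p.1 p.2 - B p.1 p.2) ^ 2) (cylM a b T) :=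
  (((memLp_two_iff_integrable_sq hA.aestronglyMeasurable).2 hA2).sub
    ((memLp_two_iff_integrable_sq hB.aestronglyMeasurable).2 hB2)).integrable_sq

theorem integrable_cyl_mul {a b T : ℝ} {A B : ℝ → ℝ → ℝ}
    (hA : Integrable (fun p : ℝ × ℝ => A p.1 p.2) (cylM a b T))
    (hB : Integrable (fun p : ℝ × ℝ => B p.1 p.2) (cylM a b T))
    (hA2 : Integrable (fun p : ℝ × ℝ => A p.1 p.2 ^ 2) (cylM a b T))
    (hB2 : Integrable (fun p : ℝ × ℝ => B p.1 p.2 ^ 2) (cylM a b T)) :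
    Integrable (fun p : ℝ × ℝ => A p.1 p.2 * B p.1 p.2) (cylM a b T) :=
  ((memLp_two_iff_integrable_sq hA.aestronglyMeasurable).2 hA2).integrable_mul
    ((memLp_two_iff_integrable_sq hB.aestronglyMeasurable).2 hB2)

theorem ContL2.integrable_sq {a b T : ℝ} {w : ℝ → ℝ → ℝ} (hw : ContL2 a b (Icc 0 T) w)
    (hi : Integrable (fun p : ℝ × ℝ => w p.1 p.2) (cylM a b T)) :
    Integrable (fun p : ℝ × ℝ => w p.1 p.2 ^ 2) (cylM a b T) := by
  obtain ⟨C, hC⟩ := hw.exists_bound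
  refine integrable_cyl_of_slice_bound (H := fun x t => w x t ^ 2) (B := fun _ => C)
    (hi.aestronglyMeasurable.pow 2) (integrable_const C) ?_
  filter_upwards [ae_restrict_mem measurableSet_Ioo] with t ht
  refine ⟨(hw.1 t (Ioo_subset_Icc_self ht)).2, ?_⟩
  simp only [abs_pow, sq_abs]
  exact hC t (Ioo_subset_Icc_self ht)

/-- An `L²_t L¹_x` function times an `L²_t W^{1,2}_x` function is integrable. -/
theorem integrable_cyl_mul_of_weakDerivI {a b T : ℝ} (hab : a < b) (hT : 0 < T)
    {z zx G : ℝ → ℝ → ℝ} (hzc : ContL2 a b (Icc 0 T) z)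
    (hW : ∀ᵐ t ∂volume.restrict (Ioo 0 T), WeakDerivI a b (fun x => z x t) (fun x => zx x t))
    (hz : Integrable (fun p : ℝ × ℝ => z p.1 p.2) (cylM a b T))
    (hzx : Integrable (fun p : ℝ × ℝ => zx p.1 p.2) (cylM a b T))
    (hzx2 : Integrable (fun p : ℝ × ℝ => zx p.1 p.2 ^ 2) (cylM a b T))
    (hG : Integrable (fun p : ℝ × ℝ => G p.1 p.2) (cylM a b T))
    (hG2 : IntervalIntegrable (fun t => (∫ x in Ioo a b, |G x t|) ^ 2) volume 0 T) :
    Integrable (fun p : ℝ × ℝ => G p.1 p.2 * z p.1 p.2) (cylM a b T) := by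
  have hz2 := hzc.integrable_sq hz
  have hG2' : IntegrableOn (fun t => (∫ x in Ioo a b, |G x t|) ^ 2) (Ioo 0 T) :=
    ((intervalIntegrable_iff_integrableOn_Ioc_of_le hT.le).1 hG2).mono_set Ioo_subset_Ioc_self
  refine integrable_cyl_of_slice_bound (H := fun x t => G x t * z x t)
    (B := fun t => (∫ x in Ioo a b, |G x t|) ^ 2 + (1 / (b - a) + 1) * (∫ x in Ioo a b, z x t ^ 2)
      + ∫ x in Ioo a b, zx x t ^ 2) (hG.aestronglyMeasurable.mul hz.aestronglyMeasurable)
    ((hG2'.add ((hz2.integral_prod_right).const_mul _)).add hzx2.integral_prod_right) ?_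
  filter_upwards [hW, memLp_slice_ae hz hz2, memLp_slice_ae hzx hzx2, integrable_slice_ae hG]
    with t w m0 m1 iG
  have hsq := w.sq_le hab m0 m1
  have n0 : 0 ≤ ∫ x in Ioo a b, z x t ^ 2 := integral_nonneg fun x => sq_nonneg _
  have n1 : 0 ≤ ∫ x in Ioo a b, zx x t ^ 2 := integral_nonneg fun x => sq_nonneg _
  have hL : 0 < b - a := sub_pos.2 hab
  set A := ∫ x in Ioo a b, z x t ^ 2
  set B := ∫ x in Ioo a b, zx x t ^ 2
  have hR : 0 ≤ 1 / (b - a) * A + 2 * (√A * √B) := by positivity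
  refine ⟨iG.mul_bdd (c := √(1 / (b - a) * A + 2 * (√A * √B))) m0.aestronglyMeasurable
    (hsq.mono fun x hx => Real.abs_le_sqrt hx), ?_⟩
  have e := (le_abs_self _).trans (abs_integral_mul_le_of_sq_le (G := fun x => |G x t|)
    (g := fun x => |z x t|) iG.abs (hsq.mono fun x hx => by rwa [sq_abs]))
  simp_rw [abs_abs] at e
  simp_rw [abs_mul]
  refine e.trans ?_
  nlinarith [sq_nonneg ((∫ x in Ioo a b, |G x t|) - √(1 / (b - a) * A + 2 * (√A * √B))),
    Real.sq_sqrt hR, Real.sq_sqrt n0, Real.sq_sqrt n1, sq_nonneg (√A - √B),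
    sq_nonneg (∫ x in Ioo a b, |G x t|)]

theorem IsWeakSol.integrable_u {a b T : ℝ} {f f' : ℝ → ℝ} {u0 u0t Θ0 : ℝ → ℝ}
    {u ut ux Θ Θx : ℝ → ℝ → ℝ} (hs : IsWeakSol a b T f f' u0 u0t Θ0 u ut ux Θ Θx) :
    Integrable (fun p : ℝ × ℝ => u p.1 p.2) (cylM a b T) := by
  have := hs.u_int
  rwa [IntegrableOn, restrict_cylinder] at this

theorem IsWeakSol.integrable_ux {a b T : ℝ} {f f' : ℝ → ℝ} {u0 u0t Θ0 : ℝ → ℝ}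
    {u ut ux Θ Θx : ℝ → ℝ → ℝ} (hs : IsWeakSol a b T f f' u0 u0t Θ0 u ut ux Θ Θx) :
    Integrable (fun p : ℝ × ℝ => ux p.1 p.2) (cylM a b T) := by
  have := hs.ux_int
  rwa [IntegrableOn, restrict_cylinder] at this

theorem continuous_slice_zero {φ : ℝ → ℝ → ℝ} (h : Continuous (uncurry φ)) :
    Continuous fun x => φ x 0 :=
  h.comp (continuous_id.prodMk continuous_const)

section Difference

variable {a b T : ℝ} {f f' : ℝ → ℝ} {u0 u0x u0t Θ0 uh0 uh0x uh0t Θh0 : ℝ → ℝ}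
  {u ut ux Θ Θx uh uht uhx Θh Θhx : ℝ → ℝ → ℝ}

/-- Energy identity for the mechanical part of the difference of two weak solutions. -/
theorem wave_difference_energy (hab : a < b) (hT : 0 < T)
    (hd : DataI a b u0 u0x u0t Θ0) (hdh : DataI a b uh0 uh0x uh0t Θh0)
    (hs : IsWeakSol a b T f f' u0 u0t Θ0 u ut ux Θ Θx) (hr : RegT a b T u ut ux Θ Θx)
    (hsh : IsWeakSol a b T f f' uh0 uh0t Θh0 uh uht uhx Θh Θhx)
    (hrh : RegT a b T uh uht uhx Θh Θhx)
    (fb : FluxBound a b T f f' ut Θ Θx) (fbh : FluxBound a b T f f' uht Θh Θhx) :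
    ∀ t ∈ Icc 0 T, (∫ x in Ioo a b, (ut x t - uht x t) ^ 2)
        + (∫ x in Ioo a b, (ux x t - uhx x t) ^ 2)
      = (∫ x in Ioo a b, (u0t x - uh0t x) ^ 2) + (∫ x in Ioo a b, (u0x x - uh0x x) ^ 2)
        - 2 * ∫ s in (0:ℝ)..t, ∫ x in Ioo a b,
          (f' (Θ x s) * Θx x s - f' (Θh x s) * Θhx x s) * (ut x s - uht x s) := by
  refine wave_energy (w := fun x t => u x t - uh x t) (wt := fun x t => ut x t - uht x t)
    (wx := fun x t => ux x t - uhx x t)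
    (g := fun x t => f' (Θ x t) * Θx x t - f' (Θh x t) * Θhx x t)
    (w0 := fun x => u0 x - uh0 x) (w0x := fun x => u0x x - uh0x x)
    (w1 := fun x => u0t x - uh0t x) hab hT (hr.u_cont.sub hrh.u_cont)
    (hr.ut_cont.sub hrh.ut_cont) (hr.ux_cont.sub hrh.ux_cont) ?_
    (hs.integrable_u.sub hsh.integrable_u) (fb.ut_int.sub fbh.ut_int)
    (hs.integrable_ux.sub hsh.integrable_ux) (fb.g_int.sub fbh.g_int) ?_
    (hd.u0_L2.sub hdh.u0_L2) (hd.u0x_L2.sub hdh.u0x_L2) (hd.u0t_L2.sub hdh.u0t_L2)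
    (hd.u0_W0.sub hdh.u0_W0 hd.u0_L2 hd.u0x_L2 hdh.u0_L2 hdh.u0x_L2) ?_ ?_
  · exact fun t ht => (hr.u_W0 t ht).sub (hrh.u_W0 t ht) (hr.u_cont.1 t ht) (hr.ux_cont.1 t ht)
      (hrh.u_cont.1 t ht) (hrh.ux_cont.1 t ht)
  · exact integrable_cyl_sub_sq (A := fun x t => f' (Θ x t) * Θx x t)
      (B := fun x t => f' (Θh x t) * Θhx x t) fb.g_int fbh.g_int fb.g_sq fbh.g_sq
  · intro φ hφ
    have e1 := intOmT_sub_mul hs.integrable_u hsh.integrable_u (contDiff_pdt hφ.smooth).continuous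
    have e2 := intOmT_sub_mul fb.ut_int fbh.ut_int hφ.smooth.continuous
    rw [e1, e2, hs.ut_weak φ hφ, hsh.ut_weak φ hφ]
    ring
  · intro φ hφ
    have c0 := hφ.smooth.continuous
    have ct := contDiff_pdt hφ.smooth
    have e1 := intOmT_sub_mul hs.integrable_u hsh.integrable_u (contDiff_pdt ct).continuous
    have e2 := intOm_sub_mul hd.u0t_L2 hdh.u0t_L2 (continuous_slice_zero c0)
    have e3 := intOm_sub_mul hd.u0_L2 hdh.u0_L2 (continuous_slice_zero ct.continuous)
    have e4 := intOmT_sub_mul hs.integrable_ux hsh.integrable_ux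
      (contDiff_pdx hφ.smooth).continuous
    have e5 := intOmT_sub_mul (A := fun x t => f' (Θ x t) * Θx x t)
      (B := fun x t => f' (Θh x t) * Θhx x t) fb.g_int fbh.g_int c0
    rw [e1, e2, e3, e4, e5]
    linarith [hs.weak_u φ hφ, hsh.weak_u φ hφ]

/-- Square integrability in time of the spatial `L¹` norm of a difference. -/
theorem intervalIntegrable_sq_integral_abs_sub (hT : 0 < T) {A B : ℝ → ℝ → ℝ}
    (hA : Integrable (fun p : ℝ × ℝ => A p.1 p.2) (cylM a b T))
    (hB : Integrable (fun p : ℝ × ℝ => B p.1 p.2) (cylM a b T))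
    (hA2 : IntervalIntegrable (fun t => (∫ x in Ioo a b, |A x t|) ^ 2) volume 0 T)
    (hB2 : IntervalIntegrable (fun t => (∫ x in Ioo a b, |B x t|) ^ 2) volume 0 T) :
    IntervalIntegrable (fun t => (∫ x in Ioo a b, |A x t - B x t|) ^ 2) volume 0 T := by
  have iA := ((intervalIntegrable_iff_integrableOn_Ioc_of_le hT.le).1 hA2).mono_set
    Ioo_subset_Ioc_self
  have iB := ((intervalIntegrable_iff_integrableOn_Ioc_of_le hT.le).1 hB2).mono_set
    Ioo_subset_Ioc_self
  refine intervalIntegrable_of_Ioo hT.le (((iA.const_mul 2).add (iB.const_mul 2)).mono'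
    (((hA.sub hB).abs.integral_prod_right).aestronglyMeasurable.pow 2) ?_)
  filter_upwards [integrable_slice_ae hA, integrable_slice_ae hB] with t h1 h2
  have h0 : 0 ≤ ∫ x in Ioo a b, |A x t - B x t| := integral_nonneg fun x => abs_nonneg _
  have h3 : ∫ x in Ioo a b, |A x t - B x t|
      ≤ (∫ x in Ioo a b, |A x t|) + ∫ x in Ioo a b, |B x t| := by
    rw [← integral_add h1.abs h2.abs]
    exact integral_mono (h1.sub h2).abs (h1.abs.add h2.abs) fun x => abs_sub _ _
  rw [Real.norm_eq_abs, abs_of_nonneg (sq_nonneg _)]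
  refine (pow_le_pow_left₀ h0 h3 2).trans ?_
  simp only [Pi.add_apply]
  nlinarith [sq_nonneg ((∫ x in Ioo a b, |A x t|) - ∫ x in Ioo a b, |B x t|)]

/-- Energy identity for the thermal part of the difference of two weak solutions. -/
theorem heat_difference_energy (hab : a < b) (hT : 0 < T)
    (hd : DataI a b u0 u0x u0t Θ0) (hdh : DataI a b uh0 uh0x uh0t Θh0)
    (hs : IsWeakSol a b T f f' u0 u0t Θ0 u ut ux Θ Θx) (hr : RegT a b T u ut ux Θ Θx)
    (hsh : IsWeakSol a b T f f' uh0 uh0t Θh0 uh uht uhx Θh Θhx)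
    (hrh : RegT a b T uh uht uhx Θh Θhx)
    (fb : FluxBound a b T f f' ut Θ Θx) (fbh : FluxBound a b T f f' uht Θh Θhx)
    (hW : ∀ᵐ t ∂volume.restrict (Ioo 0 T),
      WeakDerivI a b (fun x => Θ x t - Θh x t) (fun x => Θx x t - Θhx x t)) :
    ∀ t ∈ Icc 0 T, (∫ x in Ioo a b, (Θ x t - Θh x t) ^ 2)
      = (∫ x in Ioo a b, (Θ0 x - Θh0 x) ^ 2)
        + 2 * ∫ s in (0:ℝ)..t, (-(∫ x in Ioo a b, (Θx x s - Θhx x s) ^ 2)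
          + (∫ x in Ioo a b, (f (Θ x s) * ut x s - f (Θh x s) * uht x s) * (Θx x s - Θhx x s))
          + ∫ x in Ioo a b, (f' (Θ x s) * Θx x s * ut x s - f' (Θh x s) * Θhx x s * uht x s)
            * (Θ x s - Θh x s)) := by
  refine heat_energy (z := fun x t => Θ x t - Θh x t) (zx := fun x t => Θx x t - Θhx x t)
    (G := fun x t => f' (Θ x t) * Θx x t * ut x t - f' (Θh x t) * Θhx x t * uht x t)
    (F := fun x t => f (Θ x t) * ut x t - f (Θh x t) * uht x t)
    (z0 := fun x => Θ0 x - Θh0 x) hab hT (hr.Θ_cont.sub hrh.Θ_cont) hW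
    (fb.Θ_int.sub fbh.Θ_int) (fb.Θx_int.sub fbh.Θx_int)
    (integrable_cyl_sub_sq fb.Θx_int fbh.Θx_int fb.Θx_sq fbh.Θx_sq)
    (fb.G_int.sub fbh.G_int)
    (intervalIntegrable_sq_integral_abs_sub (A := fun x t => f' (Θ x t) * Θx x t * ut x t)
      (B := fun x t => f' (Θh x t) * Θhx x t * uht x t) hT fb.G_int fbh.G_int fb.G_sq fbh.G_sq)
    (fb.F_int.sub fbh.F_int)
    (integrable_cyl_sub_sq (A := fun x t => f (Θ x t) * ut x t)
      (B := fun x t => f (Θh x t) * uht x t) fb.F_int fbh.F_int fb.F_sq fbh.F_sq)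
    (hd.Θ0_L2.sub hdh.Θ0_L2) ?_
  intro φ hφ
  have c0 := hφ.smooth.continuous
  have cx := (contDiff_pdx hφ.smooth).continuous
  have e1 := intOmT_sub_mul fb.Θ_int fbh.Θ_int (contDiff_pdt hφ.smooth).continuous
  have e2 := intOm_sub_mul hd.Θ0_L2 hdh.Θ0_L2 (continuous_slice_zero c0)
  have e3 := intOmT_sub_mul fb.Θx_int fbh.Θx_int cx
  have e4 := intOmT_sub_mul (A := fun x t => f' (Θ x t) * Θx x t * ut x t)
      (B := fun x t => f' (Θh x t) * Θhx x t * uht x t) fb.G_int fbh.G_int c0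
  have e5 := intOmT_sub_mul (A := fun x t => f (Θ x t) * ut x t)
      (B := fun x t => f (Θh x t) * uht x t) fb.F_int fbh.F_int cx
  rw [e1, e2, e3, e4, e5]
  linarith [hs.weak_Θ φ hφ, hsh.weak_Θ φ hφ]

theorem nrmL2_eq_sqrt (a b : ℝ) (g : ℝ → ℝ) : nrmL2 a b g = √(∫ x in Ioo a b, g x ^ 2) := by
  rw [nrmL2, Real.sqrt_eq_rpow]

/-- Integral inequality for the energy of the difference of two weak solutions. -/
theorem difference_energy_ineq {M K : ℝ} (hab : a < b) (hT : 0 < T) (hK : 0 ≤ K)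
    (hM : NonlinBound f f' M)
    (hd : DataI a b u0 u0x u0t Θ0) (hdh : DataI a b uh0 uh0x uh0t Θh0)
    (hs : IsWeakSol a b T f f' u0 u0t Θ0 u ut ux Θ Θx) (hr : RegT a b T u ut ux Θ Θx)
    (hsh : IsWeakSol a b T f f' uh0 uh0t Θh0 uh uht uhx Θh Θhx)
    (hrh : RegT a b T uh uht uhx Θh Θhx)
    (fb : FluxBound a b T f f' ut Θ Θx) (fbh : FluxBound a b T f f' uht Θh Θhx)
    (hbd : ∀ t ∈ Ioo 0 T, nrmL2 a b (fun x => uht x t) + nrmL1 a b (fun x => Θ x t) ≤ K)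
    {E : ℝ → ℝ} (hE : E = fun t => (∫ x in Ioo a b, (ut x t - uht x t) ^ 2)
      + (∫ x in Ioo a b, (ux x t - uhx x t) ^ 2) + ∫ x in Ioo a b, (Θ x t - Θh x t) ^ 2)
    (hi : IntervalIntegrable (fun s => couplingConst M K (b - a)
      * (1 + ∫ x in Ioo a b, Θx x s ^ 2) * E s) volume 0 T) :
    ∀ t ∈ Icc 0 T, E t + (∫ s in (0:ℝ)..t, ∫ x in Ioo a b, (Θx x s - Θhx x s) ^ 2)
      ≤ (∫ x in Ioo a b, (u0t x - uh0t x) ^ 2) + (∫ x in Ioo a b, (u0x x - uh0x x) ^ 2)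
        + (∫ x in Ioo a b, (Θ0 x - Θh0 x) ^ 2)
        + ∫ s in (0:ℝ)..t, couplingConst M K (b - a)
          * (1 + ∫ x in Ioo a b, Θx x s ^ 2) * E s := by
  intro t ht
  have hW : ∀ᵐ t ∂volume.restrict (Ioo 0 T),
      WeakDerivI a b (fun x => Θ x t - Θh x t) (fun x => Θx x t - Θhx x t) := by
    filter_upwards [fb.slice, fbh.slice] with t h1 h2
    obtain ⟨w, -, m1, m2, -⟩ := h1
    obtain ⟨wh, -, n1, n2, -⟩ := h2
    exact w.sub wh (m1.integrable (by norm_num)) (m2.integrable (by norm_num))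
      (n1.integrable (by norm_num)) (n2.integrable (by norm_num))
  have ew := wave_difference_energy hab hT hd hdh hs hr hsh hrh fb fbh t ht
  have eh := heat_difference_energy hab hT hd hdh hs hr hsh hrh fb fbh hW t ht
  have iut : Integrable (fun p : ℝ × ℝ => ut p.1 p.2 - uht p.1 p.2) (cylM a b T) :=
    fb.ut_int.sub fbh.ut_int
  have izx : Integrable (fun p : ℝ × ℝ => Θx p.1 p.2 - Θhx p.1 p.2) (cylM a b T) :=
    fb.Θx_int.sub fbh.Θx_int
  have izx2 := integrable_cyl_sub_sq fb.Θx_int fbh.Θx_int fb.Θx_sq fbh.Θx_sq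
  have iY := intervalIntegrable_sub_Icc ht (intervalIntegrable_slice
    (H := fun x t => (Θx x t - Θhx x t) ^ 2) hT.le izx2)
  have ig := intervalIntegrable_sub_Icc ht (intervalIntegrable_slice
    (H := fun x t => (f' (Θ x t) * Θx x t - f' (Θh x t) * Θhx x t) * (ut x t - uht x t)) hT.le
    (integrable_cyl_mul (A := fun x t => f' (Θ x t) * Θx x t - f' (Θh x t) * Θhx x t)
      (B := fun x t => ut x t - uht x t) (fb.g_int.sub fbh.g_int) iut
      (integrable_cyl_sub_sq (A := fun x t => f' (Θ x t) * Θx x t)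
        (B := fun x t => f' (Θh x t) * Θhx x t) fb.g_int fbh.g_int fb.g_sq fbh.g_sq)
      ((hr.ut_cont.sub hrh.ut_cont).integrable_sq iut)))
  have iF := intervalIntegrable_sub_Icc ht (intervalIntegrable_slice
    (H := fun x t => (f (Θ x t) * ut x t - f (Θh x t) * uht x t) * (Θx x t - Θhx x t)) hT.le
    (integrable_cyl_mul (A := fun x t => f (Θ x t) * ut x t - f (Θh x t) * uht x t)
      (B := fun x t => Θx x t - Θhx x t) (fb.F_int.sub fbh.F_int) izx
      (integrable_cyl_sub_sq (A := fun x t => f (Θ x t) * ut x t)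
        (B := fun x t => f (Θh x t) * uht x t) fb.F_int fbh.F_int fb.F_sq fbh.F_sq) izx2))
  have iG := intervalIntegrable_sub_Icc ht (intervalIntegrable_slice
    (H := fun x t => (f' (Θ x t) * Θx x t * ut x t - f' (Θh x t) * Θhx x t * uht x t)
      * (Θ x t - Θh x t)) hT.le
    (integrable_cyl_mul_of_weakDerivI
      (G := fun x t => f' (Θ x t) * Θx x t * ut x t - f' (Θh x t) * Θhx x t * uht x t)
      (z := fun x t => Θ x t - Θh x t) (zx := fun x t => Θx x t - Θhx x t) hab hT
      (hr.Θ_cont.sub hrh.Θ_cont) hW (fb.Θ_int.sub fbh.Θ_int) izx izx2 (fb.G_int.sub fbh.G_int)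
      (intervalIntegrable_sq_integral_abs_sub (A := fun x t => f' (Θ x t) * Θx x t * ut x t)
        (B := fun x t => f' (Θh x t) * Θhx x t * uht x t) hT fb.G_int fbh.G_int
        fb.G_sq fbh.G_sq)))
  have hi' := intervalIntegrable_sub_Icc ht hi
  have key : ∀ᵐ s, s ∈ uIoc 0 t →
      -2 * (∫ x in Ioo a b, (f' (Θ x s) * Θx x s - f' (Θh x s) * Θhx x s) * (ut x s - uht x s))
        + 2 * (-(∫ x in Ioo a b, (Θx x s - Θhx x s) ^ 2)
          + (∫ x in Ioo a b, (f (Θ x s) * ut x s - f (Θh x s) * uht x s) * (Θx x s - Θhx x s))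
          + ∫ x in Ioo a b, (f' (Θ x s) * Θx x s * ut x s - f' (Θh x s) * Θhx x s * uht x s)
            * (Θ x s - Θh x s))
      ≤ couplingConst M K (b - a) * (1 + ∫ x in Ioo a b, Θx x s ^ 2) * E s
        - ∫ x in Ioo a b, (Θx x s - Θhx x s) ^ 2 := by
    apply ae_uIoc_of_ae_Ioo ht
    filter_upwards [fb.slice, fbh.slice, ae_restrict_mem measurableSet_Ioo] with s h1 h2 hs
    obtain ⟨w, p, m1, m2, m3⟩ := h1
    obtain ⟨wh, ph, n1, n2, n3⟩ := h2
    have hb := hbd s hs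
    rw [nrmL2_eq_sqrt, nrmL1] at hb
    have q1 : 0 ≤ √(∫ x in Ioo a b, uht x s ^ 2) := Real.sqrt_nonneg _
    have q2 : 0 ≤ ∫ x in Ioo a b, |Θ x s| := integral_nonneg fun x => abs_nonneg _
    have c := coupling_slice_le hab hK hM w wh p ph m1 m2 m3 n1 n2 n3 (by linarith) (by linarith)
    have q3 : 0 ≤ couplingConst M K (b - a) * (1 + ∫ x in Ioo a b, Θx x s ^ 2) :=
      mul_nonneg (couplingConst_nonneg hM.nonneg hK (sub_pos.2 hab))
        (add_nonneg zero_le_one (integral_nonneg fun x => sq_nonneg _))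
    have q4 : 0 ≤ ∫ x in Ioo a b, (ux x s - uhx x s) ^ 2 := integral_nonneg fun x => sq_nonneg _
    have q5 : (∫ x in Ioo a b, (ut x s - uht x s) ^ 2) + ∫ x in Ioo a b, (Θ x s - Θh x s) ^ 2
        ≤ E s := by
      rw [hE]
      linarith
    linarith [mul_le_mul_of_nonneg_left q5 q3]
  have iL := (ig.const_mul (-2)).add (((iY.neg.add iF).add iG).const_mul 2)
  have hmono := intervalIntegral.integral_mono_ae_restrict ht.1 iL (hi'.sub iY) (by
    rw [EventuallyLE, ae_restrict_iff' measurableSet_Icc]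
    filter_upwards [key, (measure_singleton (μ := volume) 0 : volume {(0:ℝ)} = 0) |>
      measure_eq_zero_iff_ae_notMem.1] with s hs hs0 hs1
    refine hs ?_
    rw [uIoc_of_le ht.1]
    exact ⟨lt_of_le_of_ne hs1.1 (Ne.symm hs0), hs1.2⟩)
  have hL := intervalIntegral.integral_add (ig.const_mul (-2))
    (((iY.neg.add iF).add iG).const_mul 2)
  rw [intervalIntegral.integral_const_mul, intervalIntegral.integral_const_mul] at hL
  have hR := intervalIntegral.integral_sub hi' iY
  have hEt : E t = (∫ x in Ioo a b, (ut x t - uht x t) ^ 2)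
      + (∫ x in Ioo a b, (ux x t - uhx x t) ^ 2) + ∫ x in Ioo a b, (Θ x t - Θh x t) ^ 2 := by
    rw [hE]
  rw [hEt, ew, eh]
  have hmono' := hL.symm.trans_le (hmono.trans_eq hR)
  simp only [Pi.neg_apply] at hmono'
  linarith

end Difference

/-- Gronwall estimate with dissipation. -/
theorem gronwall_dissipation {E h Y : ℝ → ℝ} {E0 A T : ℝ} (hT : 0 ≤ T) (hE0 : 0 ≤ E0)
    (hEc : ContinuousOn E (Icc 0 T)) (hE : ∀ t, 0 ≤ E t) (hh : IntervalIntegrable h volume 0 T)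
    (hh0 : ∀ t, 0 ≤ h t) (hY : ∀ t, 0 ≤ Y t) (hA : ∫ s in (0:ℝ)..T, h s ≤ A)
    (hle : ∀ t ∈ Icc 0 T, E t + (∫ s in (0:ℝ)..t, Y s) ≤ E0 + ∫ s in (0:ℝ)..t, h s * E s) :
    ∀ t ∈ Icc 0 T, E t + (∫ s in (0:ℝ)..T, Y s)
      ≤ (Real.exp A + 1 + A * Real.exp A) * E0 := by
  have hhE : IntervalIntegrable (fun s => h s * E s) volume 0 T :=
    hh.mul_continuousOn (by rwa [uIcc_of_le hT])
  have hexp : ∀ t ∈ Icc 0 T, E t ≤ E0 * Real.exp A := by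
    intro t ht
    refine (gronwall_integral hT hh (ae_of_all _ fun s _ => hh0 s) hhE (fun t ht => ?_) t ht).trans
      (mul_le_mul_of_nonneg_left (Real.exp_le_exp.2 (le_trans ?_ hA)) hE0)
    · have := hle t ht
      have h1 : 0 ≤ ∫ s in (0:ℝ)..t, Y s := intervalIntegral.integral_nonneg ht.1 fun s _ => hY s
      linarith
    · exact intervalIntegral.integral_mono_interval le_rfl ht.1 ht.2 (ae_of_all _ hh0) hh
  have hInt : ∫ s in (0:ℝ)..T, h s * E s ≤ A * (E0 * Real.exp A) := by
    refine (intervalIntegral.integral_mono_on hT hhE (hh.mul_const (E0 * Real.exp A))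
      fun s hs => mul_le_mul_of_nonneg_left (hexp s hs) (hh0 s)).trans ?_
    rw [intervalIntegral.integral_mul_const]
    exact mul_le_mul_of_nonneg_right hA (mul_nonneg hE0 (Real.exp_pos _).le)
  intro t ht
  linarith [hexp t ht, hle T ⟨hT, le_rfl⟩, hE T]

/-- Lemma 3.3: stability estimate for differences of two weak solutions. -/
theorem statement5
    (a b : ℝ) (hab : a < b)
    (f f' f'' : ℝ → ℝ) (hf : HypF f f' f'')
    (K T : ℝ) (hK : 0 < K) (hT : 0 < T) :
    ∃ Γ > (0 : ℝ),
      ∀ u0 u0x u0t Θ0 uh0 uh0x uh0t Θh0 : ℝ → ℝ,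
      ∀ u ut ux Θ Θx uh uht uhx Θh Θhx : ℝ → ℝ → ℝ,
      DataI a b u0 u0x u0t Θ0 → DataI a b uh0 uh0x uh0t Θh0 →
      IsWeakSol a b T f f' u0 u0t Θ0 u ut ux Θ Θx →
      RegT a b T u ut ux Θ Θx →
      IsWeakSol a b T f f' uh0 uh0t Θh0 uh uht uhx Θh Θhx →
      RegT a b T uh uht uhx Θh Θhx →
      (∀ t ∈ Ioo 0 T, nrmL2 a b (fun x => uht x t) + nrmL1 a b (fun x => Θ x t) ≤ K) →
      intOmT a b T (fun x t => (Θx x t) ^ 2) ≤ K →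
      ∀ t ∈ Ioo 0 T,
        (∫ x in Ioo a b, (ut x t - uht x t) ^ 2)
            + (∫ x in Ioo a b, (ux x t - uhx x t) ^ 2)
            + (∫ x in Ioo a b, (Θ x t - Θh x t) ^ 2)
            + intOmT a b T (fun x s => (Θx x s - Θhx x s) ^ 2)
          ≤ Γ * ((∫ x in Ioo a b, (u0t x - uh0t x) ^ 2)
              + (∫ x in Ioo a b, (u0x x - uh0x x) ^ 2)
              + ∫ x in Ioo a b, (Θ0 x - Θh0 x) ^ 2) := by
  obtain ⟨M, hM⟩ := hf.exists_bound
  have hC := couplingConst_nonneg hM.nonneg hK.le (sub_pos.2 hab)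
  set C := couplingConst M K (b - a) with hCdef
  refine ⟨Real.exp (C * (T + K)) + 1 + C * (T + K) * Real.exp (C * (T + K)), by positivity, ?_⟩
  intro u0 u0x u0t Θ0 uh0 uh0x uh0t Θh0 u ut ux Θ Θx uh uht uhx Θh Θhx hd hdh hs hr hsh hrh hbd
    hΘx t ht
  have fb := hs.fluxBound hab hT hM hr
  have fbh := hsh.fluxBound hab hT hM hrh
  have sq0 : ∀ h : ℝ → ℝ, 0 ≤ ∫ x in Ioo a b, h x ^ 2 := fun h =>
    integral_nonneg fun _ => sq_nonneg _
  have iR := intervalIntegrable_slice (H := fun x t => Θx x t ^ 2) hT.le fb.Θx_sq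
  rw [intOmT_eq_iterated hT.le fb.Θx_sq] at hΘx
  rw [intOmT_eq_iterated hT.le (integrable_cyl_sub_sq fb.Θx_int fbh.Θx_int fb.Θx_sq fbh.Θx_sq)]
  have ih : IntervalIntegrable (fun s => C * (1 + ∫ x in Ioo a b, Θx x s ^ 2)) volume 0 T :=
    (intervalIntegrable_const.add iR).const_mul C
  have hInt : ∫ s in (0:ℝ)..T, C * (1 + ∫ x in Ioo a b, Θx x s ^ 2) ≤ C * (T + K) := by
    rw [intervalIntegral.integral_const_mul,
      intervalIntegral.integral_add intervalIntegrable_const iR, intervalIntegral.integral_const]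
    refine mul_le_mul_of_nonneg_left ?_ hC
    simpa using hΘx
  have hEc := ((hr.ut_cont.sub hrh.ut_cont).continuousOn_sq.add
    (hr.ux_cont.sub hrh.ux_cont).continuousOn_sq).add (hr.Θ_cont.sub hrh.Θ_cont).continuousOn_sq
  exact gronwall_dissipation (E := fun t => (∫ x in Ioo a b, (ut x t - uht x t) ^ 2)
      + (∫ x in Ioo a b, (ux x t - uhx x t) ^ 2) + ∫ x in Ioo a b, (Θ x t - Θh x t) ^ 2)
    hT.le (add_nonneg (add_nonneg (sq0 _) (sq0 _)) (sq0 _)) hEc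
    (fun t => add_nonneg (add_nonneg (sq0 _) (sq0 _)) (sq0 _)) ih
    (fun t => mul_nonneg hC (add_nonneg zero_le_one (sq0 _))) (fun t => sq0 _) hInt
    (difference_energy_ineq hab hT hK.le hM hd hdh hs hr hsh hrh fb fbh hbd rfl
      (ih.mul_continuousOn (by rwa [uIcc_of_le hT.le]))) t (Ioo_subset_Icc_self ht)
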